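/- arXiv:2506.00529 — 3 statements merged into one kernel-verified Lean document; each statement's English description precedes it below -/
import Mathlib

section
/- Let R be a commutative Noetherian ring, r ≥ 1 an integer, I_1,…,I_r ideals of R, and N ⊆ M finitely generated R-modules. Let f : K → L be an R-linear map between finitely generated R-modules and let F denote the associated coherent functor, F(X) := Hom_R(K,X) / {g ∘ f : g ∈ Hom_R(L,X)}. Then there exist d ∈ ℕ^r, a finitely generated R-module T, and submodules U, V, W of T with W ⊆ V, such that U is isomorphic to F(M) and for all n ≥ d there is an R-module isomorphism F(M/I^n N) ≅ (U + I^{n−d}V)/(I^{n−d}W). -/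
universe u

/-- The value of the coherent functor presented by `f : K →ₗ[R] L` on a module `X`:
`F(X) = Hom_R(K, X) / {g ∘ f : g ∈ Hom_R(L, X)}`. -/
abbrev coherentApply {R K L : Type u} [CommRing R] [AddCommGroup K] [Module R K]
    [AddCommGroup L] [Module R L] (f : K →ₗ[R] L)
    (X : Type u) [AddCommGroup X] [Module R X] : Type u :=
  (K →ₗ[R] X) ⧸ LinearMap.range (LinearMap.lcomp R X f)

/-- The product ideal `I^n = I_1^{n_1} ⋯ I_r^{n_r}`. -/
abbrev prodPow {R : Type u} [CommRing R] {r : ℕ} (I : Fin r → Ideal R)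
    (n : Fin r → ℕ) : Ideal R :=
  ∏ i, I i ^ n i

namespace CohAux

open MvPolynomial

section AR
variable {R : Type u} [CommRing R] {r : ℕ} (I : Fin r → Ideal R)

lemma prodPow_add (m n : Fin r → ℕ) : prodPow I (m + n) = prodPow I m * prodPow I n := by
  simp [prodPow, pow_add, Finset.prod_mul_distrib]

lemma prodPow_single (i : Fin r) : prodPow I (Pi.single i 1) = I i := by
  unfold prodPow
  rw [Finset.prod_eq_single i]
  · simp
  · intro b _ hb
    simp [hb]
  · simp

variable {B : Type*} [AddCommGroup B] [Module R B]

/-- the part of degree `n` generated in degrees bounded by `k` -/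
def EE (B' C : Submodule R B) (k : ℕ) (n : Fin r → ℕ) : Submodule R B :=
  ⨆ m : {m : Fin r → ℕ // m ≤ n ∧ ∀ i, m i ≤ k}, prodPow I (n - m.1) • (prodPow I m.1 • B' ⊓ C)

lemma EE_mono (B' C : Submodule R B) (n : Fin r → ℕ) {k l : ℕ} (h : k ≤ l) :
    EE I B' C k n ≤ EE I B' C l n := by
  unfold EE
  refine iSup_le fun m => ?_
  exact le_iSup (fun m : {m : Fin r → ℕ // m ≤ n ∧ ∀ i, m i ≤ l} =>
    prodPow I (n - m.1) • (prodPow I m.1 • B' ⊓ C)) ⟨m.1, m.2.1, fun i => (m.2.2 i).trans h⟩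

lemma EE_shift (B' C : Submodule R B) (n e : Fin r → ℕ) (k : ℕ) :
    prodPow I e • EE I B' C k n ≤ EE I B' C k (e + n) := by
  unfold EE
  rw [Submodule.smul_iSup]
  refine iSup_le fun m => ?_
  refine le_trans ?_ (le_iSup (fun m : {m : Fin r → ℕ // m ≤ e + n ∧ ∀ i, m i ≤ k} =>
    prodPow I (e + n - m.1) • (prodPow I m.1 • B' ⊓ C)) ⟨m.1, m.2.1.trans le_add_self, m.2.2⟩)
  simp only
  rw [add_tsub_assoc_of_le m.2.1, prodPow_add, ← smul_eq_mul, Submodule.smul_assoc]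

lemma EE_le (B' C : Submodule R B) (k : ℕ) (n : Fin r → ℕ) : EE I B' C k n ≤ prodPow I n • B' := by
  unfold EE
  refine iSup_le fun m => ?_
  refine (Submodule.smul_mono le_rfl inf_le_left).trans ?_
  rw [← Submodule.smul_assoc, smul_eq_mul, ← prodPow_add, tsub_add_cancel_of_le m.2.1]

lemma smul_inf_le (B' C : Submodule R B) (m d : Fin r → ℕ) (h : m ≤ d) :
    prodPow I (d - m) • (prodPow I m • B' ⊓ C) ≤ prodPow I d • B' ⊓ C := by
  refine le_inf ?_ (Submodule.smul_le_right.trans inf_le_right)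
  refine (Submodule.smul_mono le_rfl inf_le_left).trans ?_
  rw [← Submodule.smul_assoc, smul_eq_mul, ← prodPow_add, tsub_add_cancel_of_le h]

lemma smul_inf_le' (B' C : Submodule R B) (m d n : Fin r → ℕ) (h : m ≤ d) (hn : d ≤ n) :
    prodPow I (n - m) • (prodPow I m • B' ⊓ C) ≤
      prodPow I (n - d) • (prodPow I d • B' ⊓ C) := by
  have : n - m = (n - d) + (d - m) := by
    ext i
    have h1 : m i ≤ d i := h i
    have h2 : d i ≤ n i := hn i
    simp only [Pi.sub_apply, Pi.add_apply]
    omega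
  rw [this, prodPow_add, ← smul_eq_mul, Submodule.smul_assoc]
  exact Submodule.smul_mono le_rfl (smul_inf_le I B' C m d h)

/-- coefficient vector -/
noncomputable def cv {ι : Type*} (n : Fin r →₀ ℕ) : (ι → MvPolynomial (Fin r) R) →ₗ[R] (ι → R) :=
  LinearMap.pi fun j => (MvPolynomial.lcoeff R n).comp (LinearMap.proj j)

@[simp] lemma cv_apply {ι : Type*} (n : Fin r →₀ ℕ) (v : ι → MvPolynomial (Fin r) R) (j : ι) :
    cv n v j = coeff n (v j) := rfl

/-- Rees algebra -/
noncomputable def AA (g : Fin r → Finset R) : Subalgebra R (MvPolynomial (Fin r) R) :=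
  Algebra.adjoin R (⋃ i, (fun a => monomial (Finsupp.single i 1) a) '' (g i : Set R))

/-- elements appearing as coefficients -/
noncomputable def JJ (A : Subalgebra R (MvPolynomial (Fin r) R)) (n : Fin r →₀ ℕ) : Ideal R :=
  (Subalgebra.toSubmodule A).comap (monomial n)

lemma mem_JJ (A : Subalgebra R (MvPolynomial (Fin r) R)) (n : Fin r →₀ ℕ) (a : R) :
    a ∈ JJ A n ↔ monomial n a ∈ A := Iff.rfl

lemma JJ_mul (A : Subalgebra R (MvPolynomial (Fin r) R)) (m n : Fin r →₀ ℕ) :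
    JJ A m * JJ A n ≤ JJ A (m + n) := by
  rw [Ideal.mul_le]
  intro a ha b hb
  rw [mem_JJ] at *
  have := A.mul_mem ha hb
  rwa [monomial_mul] at this

lemma JJ_zero (A : Subalgebra R (MvPolynomial (Fin r) R)) : JJ A 0 = ⊤ := by
  rw [eq_top_iff]
  intro a _
  exact A.algebraMap_mem a

lemma JJ_pow (A : Subalgebra R (MvPolynomial (Fin r) R)) (i : Fin r)
    (h : I i ≤ JJ A (Finsupp.single i 1)) (k : ℕ) : I i ^ k ≤ JJ A (Finsupp.single i k) := by
  induction k with
  | zero => simp [JJ_zero]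
  | succ k ih =>
    rw [pow_succ, Finsupp.single_add]
    exact (Ideal.mul_mono ih h).trans (JJ_mul _ _ _)

lemma prodPow_le_JJ (A : Subalgebra R (MvPolynomial (Fin r) R))
    (h : ∀ i, I i ≤ JJ A (Finsupp.single i 1)) (n : Fin r →₀ ℕ) : prodPow I n ≤ JJ A n := by
  have key : ∀ s : Finset (Fin r), ∏ i ∈ s, I i ^ n i ≤ JJ A (∑ i ∈ s, Finsupp.single i (n i)) := by
    intro s
    induction s using Finset.induction_on with
    | empty => simp [JJ_zero]
    | insert a s ha ih =>
      rw [Finset.prod_insert ha, Finset.sum_insert ha]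
      exact (Ideal.mul_mono (JJ_pow I A a (h a) _) ih).trans (JJ_mul _ _ _)
  have := key Finset.univ
  rwa [Finsupp.univ_sum_single] at this

lemma gen_le (g : Fin r → Finset R) (hg : ∀ i, Ideal.span (g i : Set R) = I i) (i : Fin r) :
    I i ≤ JJ (AA g) (Finsupp.single i 1) := by
  rw [← hg i, Ideal.span_le]
  intro a ha
  exact Algebra.subset_adjoin (Set.mem_iUnion.2 ⟨i, a, ha, rfl⟩)

/-- graded submodule as an R-submodule -/
noncomputable def QR {ι : Type*} (E : (Fin r →₀ ℕ) → Submodule R (ι → R)) :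
    Submodule R (ι → MvPolynomial (Fin r) R) := ⨅ n, (E n).comap (cv n)

lemma mem_QR {ι : Type*} (E : (Fin r →₀ ℕ) → Submodule R (ι → R))
    (v : ι → MvPolynomial (Fin r) R) : v ∈ QR E ↔ ∀ n, cv n v ∈ E n := by
  simp [QR]

lemma QR_smul {ι : Type*} (E : (Fin r →₀ ℕ) → Submodule R (ι → R)) (g : Fin r → Finset R)
    (hE : ∀ i n, ∀ a ∈ g i, ∀ x ∈ E n, a • x ∈ E (Finsupp.single i 1 + n))
    (p : MvPolynomial (Fin r) R) (hp : p ∈ AA g) : ∀ v ∈ QR E, p • v ∈ QR E := by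
  unfold AA at hp
  induction hp using Algebra.adjoin_induction with
  | mem x hx =>
    obtain ⟨i, a, ha, rfl⟩ := Set.mem_iUnion.1 hx
    intro v hv
    rw [mem_QR] at *
    intro n
    by_cases h : Finsupp.single i 1 ≤ n
    · obtain ⟨m, rfl⟩ := exists_add_of_le h
      have : cv (Finsupp.single i 1 + m) ((monomial (Finsupp.single i 1) a) • v) = a • cv m v := by
        ext j
        simp [coeff_monomial_mul]
      simp only [this]
      exact hE i m a ha _ (hv m)
    · have : cv n ((monomial (Finsupp.single i 1) a) • v) = 0 := by
        ext j
        simp only [cv_apply, Pi.smul_apply, smul_eq_mul, coeff_monomial_mul', if_neg h,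
          Pi.zero_apply]
      simp only [this]
      exact zero_mem _
  | algebraMap c =>
    intro v hv
    rw [algebraMap_smul]
    exact (QR E).smul_mem c hv
  | add x y _ _ hx hy =>
    intro v hv
    rw [add_smul]
    exact add_mem (hx v hv) (hy v hv)
  | mul x y _ _ hx hy =>
    intro v hv
    rw [mul_smul]
    exact hx _ (hy v hv)

/-- graded submodule as a module over the Rees algebra -/
noncomputable def QA {ι : Type*} (E : (Fin r →₀ ℕ) → Submodule R (ι → R)) (g : Fin r → Finset R)
    (hE : ∀ i n, ∀ a ∈ g i, ∀ x ∈ E n, a • x ∈ E (Finsupp.single i 1 + n)) :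
    Submodule (AA g) (ι → MvPolynomial (Fin r) R) where
  carrier := {v | ∀ n, cv n v ∈ E n}
  add_mem' := fun {a b} ha hb n => by
    rw [map_add]
    exact add_mem (ha n) (hb n)
  zero_mem' := fun n => by
    rw [map_zero]
    exact zero_mem _
  smul_mem' := fun c v hv => (mem_QR E _).1 (QR_smul E g hE c.1 c.2 v ((mem_QR E _).2 hv))

/-- monomial vector -/
noncomputable def mv {ι : Type*} (n : Fin r →₀ ℕ) : (ι → R) →ₗ[R] (ι → MvPolynomial (Fin r) R) :=
  LinearMap.pi fun j => (monomial n).comp (LinearMap.proj j)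

@[simp] lemma mv_apply {ι : Type*} (n : Fin r →₀ ℕ) (v : ι → R) (j : ι) :
    mv n v j = monomial n (v j) := rfl

lemma QA_le {ι : Type*} [Finite ι] (E : (Fin r →₀ ℕ) → Submodule R (ι → R)) (g : Fin r → Finset R)
    (hE : ∀ i n, ∀ a ∈ g i, ∀ x ∈ E n, a • x ∈ E (Finsupp.single i 1 + n))
    (hg : ∀ i, Ideal.span (g i : Set R) = I i) (S : Set (ι → R))
    (hS : ∀ n, E n ≤ prodPow I n • Submodule.span R S) :
    QA E g hE ≤ Submodule.span (AA g) (mv 0 '' S) := by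
  classical
  cases nonempty_fintype ι
  have h0 : ∀ b ∈ Submodule.span R S, mv (0 : Fin r →₀ ℕ) b ∈ Submodule.span (AA g) (mv 0 '' S) := by
    intro b hb
    induction hb using Submodule.span_induction with
    | mem x hx => exact Submodule.subset_span ⟨x, hx, rfl⟩
    | zero => simp
    | add x y _ _ hx hy => rw [map_add]; exact add_mem hx hy
    | smul a x _ hx =>
      have := (Submodule.span (AA g) (mv 0 '' S)).smul_mem (algebraMap R (AA g) a) hx
      rwa [algebraMap_smul, ← map_smul] at this
  have h1 : ∀ n : Fin r →₀ ℕ, ∀ x ∈ prodPow I n • Submodule.span R S,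
      mv n x ∈ Submodule.span (AA g) (mv 0 '' S) := by
    intro n x hx
    induction hx using Submodule.smul_induction_on' with
    | smul a ha b hb =>
      have hm : monomial n a ∈ AA g := prodPow_le_JJ I (AA g) (gen_le I g hg) n ha
      have := (Submodule.span (AA g) (mv 0 '' S)).smul_mem ⟨_, hm⟩ (h0 b hb)
      convert this using 1
      ext1 j
      change monomial n (a * b j) = monomial n a * monomial 0 (b j)
      rw [monomial_mul, add_zero]
    | add x _ y _ hx hy => rw [map_add]; exact add_mem hx hy
  intro v hv
  have hv : ∀ n, cv n v ∈ E n := hv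
  have : v = ∑ n ∈ Finset.univ.biUnion (fun j => (v j).support), mv n (cv n v) := by
    ext1 j
    rw [Finset.sum_apply]
    simp only [mv_apply, cv_apply]
    conv_lhs => rw [(v j).as_sum]
    refine Finset.sum_subset (Finset.subset_biUnion_of_mem (fun j => (v j).support)
      (Finset.mem_univ j)) ?_
    intro n _ hn
    simp only [mem_support_iff, not_not] at hn
    simp [hn]
  rw [this]
  exact sum_mem fun n _ => h1 n _ (hS n (hv n))

lemma stab_aux {A X : Type*} [CommRing A] [IsNoetherianRing A] [AddCommGroup X] [Module A X]
    (Q : ℕ → Submodule A X) (hQ : Monotone Q) (S : Set X) (hS : S.Finite)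
    (hle : ∀ k, Q k ≤ Submodule.span A S) : ∃ k, ∀ l, k ≤ l → Q l ≤ Q k := by
  have hnP : IsNoetherian A (Submodule.span A S) :=
    isNoetherian_of_fg_of_noetherian _ (Submodule.fg_span hS)
  obtain ⟨k, hk⟩ := monotone_stabilizes_iff_noetherian.2 hnP
    ⟨fun k => (Q k).comap (Submodule.span A S).subtype,
      fun k l hkl => Submodule.comap_mono (hQ hkl)⟩
  refine ⟨k, fun l hl x hx => ?_⟩
  have hh : (Q k).comap (Submodule.span A S).subtype = (Q l).comap (Submodule.span A S).subtype :=
    hk l hl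
  have : (⟨x, hle l hx⟩ : Submodule.span A S) ∈ (Q k).comap (Submodule.span A S).subtype := by
    rw [hh]
    exact hx
  exact this

lemma artinRees_free [IsNoetherianRing R] {ι : Type*} [Finite ι] (B' C : Submodule R (ι → R)) :
    ∃ k : ℕ, ∀ n : Fin r → ℕ, prodPow I n • B' ⊓ C ≤ EE I B' C k n := by
  classical
  have hfg : ∀ i, ∃ g : Finset R, Ideal.span (g : Set R) = I i := fun i =>
    (IsNoetherian.noetherian (I i))
  choose g hg using hfg
  obtain ⟨S, hS⟩ := IsNoetherian.noetherian B'
  have hE : ∀ k : ℕ, ∀ i, ∀ n : Fin r →₀ ℕ, ∀ a ∈ g i, ∀ x ∈ EE I B' C k n,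
      a • x ∈ EE I B' C k ⇑((Finsupp.single i 1 : Fin r →₀ ℕ) + n) := by
    intro k i n a ha x hx
    have : a ∈ prodPow I (Finsupp.single i 1) := by
      rw [Finsupp.single_eq_pi_single, prodPow_single, ← hg i]
      exact Ideal.subset_span ha
    rw [Finsupp.coe_add]
    exact EE_shift I B' C n _ k (Submodule.smul_mem_smul this hx)
  let Q : ℕ → Submodule (AA g) (ι → MvPolynomial (Fin r) R) := fun k =>
    QA (fun n => EE I B' C k n) g (hE k)
  let P : Submodule (AA g) (ι → MvPolynomial (Fin r) R) := Submodule.span (AA g) (mv 0 '' (S : Set _))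
  have hQP : ∀ k, Q k ≤ P := fun k => QA_le I _ g (hE k) hg _ fun n => by
    rw [hS]
    exact EE_le I B' C k n
  have hQmono : Monotone Q := fun k l hkl v hv n => EE_mono I B' C n hkl (hv n)
  have hnr : IsNoetherianRing (AA g) := by
    refine isNoetherianRing_of_fg (R := R) (S := AA g) ?_
    exact Subalgebra.fg_def.2 ⟨_, Set.finite_iUnion fun i => (g i).finite_toSet.image _, rfl⟩
  obtain ⟨k, hk⟩ := stab_aux Q hQmono _ (S.finite_toSet.image _) hQP
  refine ⟨k, fun n x hx => ?_⟩
  let n' : Fin r →₀ ℕ := Finsupp.equivFunOnFinite.symm n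
  let l := max k (∑ i, n i)
  have hxl : x ∈ EE I B' C l n := by
    unfold EE
    refine Submodule.mem_iSup_of_mem ⟨n, le_rfl, fun i => le_max_of_le_right
      (Finset.single_le_sum (f := n) (fun _ _ => Nat.zero_le _) (Finset.mem_univ i))⟩ ?_
    have h0 : prodPow I (n - n) = ⊤ := by simp [prodPow, Ideal.one_eq_top]
    change x ∈ prodPow I (n - n) • _
    rw [h0, Submodule.top_smul]
    exact hx
  have hcm : cv n' (mv n' x) = x := by
    ext j
    rw [cv_apply, mv_apply, coeff_monomial, if_pos rfl]
  have hvl : mv n' x ∈ Q l := by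
    intro m
    by_cases h : n' = m
    · subst h
      rw [hcm]
      exact hxl
    · have : cv m (mv n' x) = 0 := by
        ext j
        rw [cv_apply, mv_apply, coeff_monomial, if_neg h, Pi.zero_apply]
      rw [this]
      exact zero_mem _
  have h2 : cv n' (mv n' x) ∈ EE I B' C k n' := hk l (le_max_left _ _) hvl n'
  rw [hcm] at h2
  exact h2

lemma artinRees [IsNoetherianRing R] [Module.Finite R B] (B' C : Submodule R B) :
    ∃ d : Fin r → ℕ, ∀ d', d ≤ d' → ∀ n : Fin r → ℕ, d' ≤ n →
      prodPow I n • B' ⊓ C ≤ prodPow I (n - d') • (prodPow I d' • B' ⊓ C) := by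
  obtain ⟨a, p, hp⟩ := Module.Finite.exists_fin' R B
  obtain ⟨k, hk⟩ := artinRees_free I (B'.comap p) (C.comap p)
  refine ⟨fun _ => k, fun d' hd n hn x hx => ?_⟩
  have hB : ∀ J : Ideal R, Submodule.map p (J • B'.comap p) = J • B' := by
    intro J
    rw [Submodule.map_smul'', Submodule.map_comap_eq_of_surjective hp]
  have h1 : x ∈ Submodule.map p (prodPow I n • B'.comap p) := by
    rw [hB]; exact hx.1
  obtain ⟨y, hy, rfl⟩ := h1
  have h2 := hk n ⟨hy, hx.2⟩
  have h3 : EE I (B'.comap p) (C.comap p) k n ≤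
      prodPow I (n - d') • (prodPow I d' • B'.comap p ⊓ C.comap p) := by
    unfold EE
    refine iSup_le fun m => smul_inf_le' I _ _ _ _ _ (fun i => (m.2.2 i).trans (hd i)) hn
  have h4 := Submodule.mem_map_of_mem (f := p) (h3 h2)
  rw [Submodule.map_smul''] at h4
  refine Submodule.smul_mono le_rfl ?_ h4
  refine (Submodule.map_inf_le p).trans (inf_le_inf (hB _).le ?_)
  exact Submodule.map_comap_le _ _

end AR

section Hom
variable {R : Type u} [CommRing R] {F M : Type*} [AddCommGroup F] [Module R F]
  [AddCommGroup M] [Module R M]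

/-- maps sending `S` into `P` -/
def HH (S : Submodule R F) (P : Submodule R M) : Submodule R (F →ₗ[R] M) where
  carrier := {φ | ∀ x ∈ S, φ x ∈ P}
  add_mem' := fun ha hb x hx => add_mem (ha x hx) (hb x hx)
  zero_mem' := fun _ _ => zero_mem _
  smul_mem' := fun c _ h x hx => P.smul_mem c (h x hx)

lemma mem_HH {S : Submodule R F} {P : Submodule R M} {φ : F →ₗ[R] M} :
    φ ∈ HH S P ↔ ∀ x ∈ S, φ x ∈ P := Iff.rfl

lemma smul_HH_le (S : Submodule R F) (J : Ideal R) (P : Submodule R M) :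
    J • HH S P ≤ HH S (J • P) :=
  Submodule.smul_le.2 fun _ ha _ hφ x hx => Submodule.smul_mem_smul ha (hφ x hx)

lemma HH_smul (b : ℕ) (J : Ideal R) (P : Submodule R M) :
    HH (⊤ : Submodule R (Fin b → R)) (J • P) = J • HH ⊤ P := by
  refine le_antisymm ?_ (smul_HH_le _ _ _)
  intro φ hφ
  have key : ∀ i : Fin b, ∀ x ∈ J • P,
      (LinearMap.proj i : (Fin b → R) →ₗ[R] R).smulRight x ∈
        J • HH (⊤ : Submodule R (Fin b → R)) P := by
    intro i x hx
    induction hx using Submodule.smul_induction_on' with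
    | smul a ha y hy =>
      have : (LinearMap.proj i : (Fin b → R) →ₗ[R] R).smulRight (a • y) =
          a • (LinearMap.proj i : (Fin b → R) →ₗ[R] R).smulRight y := by
        refine LinearMap.ext fun z => ?_
        simp only [LinearMap.smulRight_apply, LinearMap.smul_apply]
        exact smul_comm _ _ _
      rw [this]
      refine Submodule.smul_mem_smul ha fun z _ => ?_
      exact P.smul_mem _ hy
    | add x _ y _ hx hy =>
      have : (LinearMap.proj i : (Fin b → R) →ₗ[R] R).smulRight (x + y) =
          (LinearMap.proj i : (Fin b → R) →ₗ[R] R).smulRight x +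
          (LinearMap.proj i : (Fin b → R) →ₗ[R] R).smulRight y := by
        ext
        simp
      rw [this]
      exact add_mem hx hy
  have : φ = ∑ i, (LinearMap.proj i : (Fin b → R) →ₗ[R] R).smulRight (φ (Pi.single i 1)) := by
    refine LinearMap.ext fun x => ?_
    rw [LinearMap.pi_apply_eq_sum_univ φ x]
    simp only [LinearMap.sum_apply, LinearMap.smulRight_apply, LinearMap.proj_apply]
    refine Finset.sum_congr rfl fun i _ => ?_
    congr 2
    ext j
    simp [Pi.single_apply, eq_comm]
  rw [this]
  exact sum_mem fun i _ => key i _ (hφ _ trivial)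

lemma HH_artinRees [IsNoetherianRing R] [Module.Finite R M] {r : ℕ} (I : Fin r → Ideal R) (a : ℕ)
    (S : Submodule R (Fin a → R)) (N : Submodule R M) :
    ∃ d : Fin r → ℕ, ∀ d', d ≤ d' → ∀ n : Fin r → ℕ, d' ≤ n →
      HH S (prodPow I n • N) = HH S ⊥ ⊔ prodPow I (n - d') • HH S (prodPow I d' • N) := by
  obtain ⟨b, q', hq'⟩ := Module.Finite.exists_fin' R S
  let q := S.subtype.comp q'
  have hq : ∀ x, x ∈ S ↔ ∃ y, q y = x := by
    intro x
    constructor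
    · intro hx
      obtain ⟨y, hy⟩ := hq' ⟨x, hx⟩
      exact ⟨y, by simp [q, hy]⟩
    · rintro ⟨y, rfl⟩
      exact (q' y).2
  let β : ((Fin a → R) →ₗ[R] M) →ₗ[R] ((Fin b → R) →ₗ[R] M) := LinearMap.lcomp R M q
  have hβ : ∀ P : Submodule R M, HH S P = (HH ⊤ P).comap β := by
    intro P
    ext φ
    simp only [mem_HH, Submodule.mem_comap, hq]
    constructor
    · intro h x _
      exact h _ ⟨x, rfl⟩
    · rintro h _ ⟨y, rfl⟩
      exact h y trivial
  obtain ⟨d, hd⟩ := artinRees I (HH (⊤ : Submodule R (Fin b → R)) N) (LinearMap.range β)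
  refine ⟨d, fun d' hdd n hn => le_antisymm ?_ (sup_le ?_ ?_)⟩
  · intro φ hφ
    rw [hβ, HH_smul] at hφ
    have h1 := hd d' hdd n hn ⟨hφ, φ, rfl⟩
    have h2 : prodPow I d' • HH (⊤ : Submodule R (Fin b → R)) N ⊓ LinearMap.range β =
        (HH S (prodPow I d' • N)).map β := by
      rw [hβ, HH_smul, Submodule.map_comap_eq, inf_comm]
    rw [h2, ← Submodule.map_smul''] at h1
    obtain ⟨ψ, hψ, hψφ⟩ := h1
    have : φ = (φ - ψ) + ψ := by abel
    rw [this]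
    refine Submodule.add_mem_sup ?_ hψ
    rw [hβ, Submodule.mem_comap, map_sub, hψφ, sub_self]
    exact zero_mem _
  · intro φ hφ x hx
    have := hφ x hx
    rw [Submodule.mem_bot] at this
    rw [this]
    exact zero_mem _
  · refine (smul_HH_le _ _ _).trans ?_
    rw [← Submodule.smul_assoc, smul_eq_mul, ← prodPow_add, tsub_add_cancel_of_le hn]

end Hom

end CohAux

namespace CohAux

section Main
variable {R : Type u} [CommRing R] {M K L : Type u} [AddCommGroup M] [Module R M]
  [AddCommGroup K] [Module R K] [AddCommGroup L] [Module R L]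

/-- a map killing `ker p` factors through surjective `p` -/
lemma exists_factor {F X : Type*} [AddCommGroup F] [Module R F] [AddCommGroup X] [Module R X]
    (p : F →ₗ[R] K) (hp : Function.Surjective p) (φ : F →ₗ[R] X)
    (h : ∀ x ∈ LinearMap.ker p, φ x = 0) : ∃ ψ : K →ₗ[R] X, ψ.comp p = φ := by
  refine ⟨((LinearMap.ker p).liftQ φ h).comp (p.quotKerEquivOfSurjective hp).symm.toLinearMap, ?_⟩
  ext x
  have : (p.quotKerEquivOfSurjective hp).symm (p x) = (LinearMap.ker p).mkQ x := by
    rw [LinearEquiv.symm_apply_eq]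
    rfl
  simp only [LinearMap.comp_apply, LinearEquiv.coe_coe, this]
  exact Submodule.liftQ_apply _ _ _

lemma comp_inj {F X : Type*} [AddCommGroup F] [Module R F] [AddCommGroup X] [Module R X]
    (p : F →ₗ[R] K) (hp : Function.Surjective p) :
    Function.Injective (LinearMap.lcomp R X p) := by
  intro φ ψ h
  refine LinearMap.ext fun y => ?_
  obtain ⟨x, rfl⟩ := hp y
  exact LinearMap.congr_fun h x

lemma exists_Phi {a c : ℕ} (f : K →ₗ[R] L) (p : (Fin a → R) →ₗ[R] K) (hp : Function.Surjective p)
    (p' : (Fin c → R) →ₗ[R] L) (hp' : Function.Surjective p')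
    (g : (Fin a → R) →ₗ[R] (Fin c → R)) (hg : p'.comp g = f.comp p) (P : Submodule R M) :
    ∃ Φ : HH (LinearMap.ker p) P →ₗ[R] coherentApply f (M ⧸ P), Function.Surjective Φ ∧
      LinearMap.ker Φ = (HH ⊤ P ⊔ (HH (LinearMap.ker p') P).map (LinearMap.lcomp R M g)).comap
        (HH (LinearMap.ker p) P).subtype := by
  let e := LinearMap.lcomp R (M ⧸ P) p
  have he : Function.Injective e := comp_inj p hp
  let κ : HH (LinearMap.ker p) P →ₗ[R] ((Fin a → R) →ₗ[R] (M ⧸ P)) :=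
    (LinearMap.llcomp R (Fin a → R) M (M ⧸ P) P.mkQ).comp (HH (LinearMap.ker p) P).subtype
  have hκ : ∀ φ, κ φ ∈ LinearMap.range e := by
    intro φ
    obtain ⟨ψ, hψ⟩ := exists_factor p hp (P.mkQ.comp φ.1) (fun x hx => by
      simpa using φ.2 x hx)
    exact ⟨ψ, hψ⟩
  let Φ0 : HH (LinearMap.ker p) P →ₗ[R] (K →ₗ[R] (M ⧸ P)) :=
    (LinearEquiv.ofInjective e he).symm.toLinearMap.comp (κ.codRestrict _ hκ)
  have hΦ0 : ∀ φ, (Φ0 φ).comp p = P.mkQ.comp φ.1 := by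
    intro φ
    have : LinearEquiv.ofInjective e he (Φ0 φ) = κ.codRestrict _ hκ φ := by
      simp [Φ0]
    exact congrArg Subtype.val this
  refine ⟨(LinearMap.range (LinearMap.lcomp R (M ⧸ P) f)).mkQ.comp Φ0, ?_, ?_⟩
  · refine (Submodule.mkQ_surjective _).comp ?_
    intro ψ
    obtain ⟨φ, hφ⟩ := Module.projective_lifting_property P.mkQ (ψ.comp p) P.mkQ_surjective
    refine ⟨⟨φ, fun x hx => ?_⟩, comp_inj p hp ?_⟩
    · have := LinearMap.congr_fun hφ x
      rw [LinearMap.mem_ker] at hx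
      simpa [hx] using this
    · exact (hΦ0 _).trans hφ
  · ext φ
    rw [LinearMap.mem_ker, LinearMap.comp_apply, Submodule.mkQ_apply,
      Submodule.Quotient.mk_eq_zero, Submodule.mem_comap, Submodule.subtype_apply]
    constructor
    · rintro ⟨ψ, hψ⟩
      have hψ : ψ.comp f = Φ0 φ := hψ
      obtain ⟨θ, hθ⟩ := Module.projective_lifting_property P.mkQ (ψ.comp p') P.mkQ_surjective
      have h1 : P.mkQ.comp φ.1 = P.mkQ.comp (θ.comp g) := by
        rw [← hΦ0, ← hψ, LinearMap.comp_assoc, ← hg, ← LinearMap.comp_assoc, ← hθ,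
          LinearMap.comp_assoc]
      have h2 : φ.1 = (φ.1 - θ.comp g) + θ.comp g := by abel
      rw [h2]
      refine Submodule.add_mem_sup ?_ ⟨θ, ?_, rfl⟩
      · intro x _
        have := LinearMap.congr_fun h1 x
        simp only [LinearMap.comp_apply, Submodule.mkQ_apply] at this
        exact (Submodule.Quotient.eq P).1 this
      · intro x hx
        have := LinearMap.congr_fun hθ x
        rw [LinearMap.mem_ker] at hx
        simpa [hx] using this
    · intro h
      obtain ⟨α, hα, _, ⟨θ, hθ, rfl⟩, hs⟩ := Submodule.mem_sup.1 h
      obtain ⟨ψ, hψ⟩ := exists_factor p' hp' (P.mkQ.comp θ) (fun x hx => by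
        simpa using hθ x hx)
      refine ⟨ψ, comp_inj p hp ?_⟩
      change (ψ.comp f).comp p = (Φ0 φ).comp p
      rw [hΦ0, ← hs, LinearMap.comp_assoc, ← hg, ← LinearMap.comp_assoc, hψ]
      ext1 i
      refine LinearMap.ext fun x => ?_
      have := hα (LinearMap.single R (fun _ => R) i x) trivial
      simp only [LinearMap.comp_apply, LinearMap.add_apply, map_add, LinearMap.lcomp_apply]
      rw [Submodule.mkQ_apply, Submodule.mkQ_apply, (Submodule.Quotient.mk_eq_zero P).2 this,
        zero_add]

/-- image of nested submodules under a quotient map -/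
lemma exists_Psi {A T : Type*} [AddCommGroup A] [Module R A] [AddCommGroup T] [Module R T]
    (π : A →ₗ[R] T) (X D : Submodule R A) (hker : LinearMap.ker π ≤ D)
    (X' D' : Submodule R T) (hX : X' = X.map π) (hD : D' = D.map π) :
    ∃ Ψ : X →ₗ[R] (X' ⧸ D'.comap X'.subtype), Function.Surjective Ψ ∧
      LinearMap.ker Ψ = D.comap X.subtype := by
  subst hX hD
  refine ⟨((D.map π).comap (X.map π).subtype).mkQ.comp (π.submoduleMap X), ?_, ?_⟩
  · exact (Submodule.mkQ_surjective _).comp (π.submoduleMap_surjective X)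
  · ext x
    rw [LinearMap.mem_ker, LinearMap.comp_apply, Submodule.mkQ_apply,
      Submodule.Quotient.mk_eq_zero, Submodule.mem_comap, Submodule.mem_comap]
    constructor
    · rintro ⟨y, hy, hxy⟩
      have hxy : π y = π x.1 := hxy
      have : x.1 - y ∈ LinearMap.ker π := by rw [LinearMap.mem_ker, map_sub, hxy, sub_self]
      have := add_mem (hker this) hy
      simpa using this
    · intro h
      exact ⟨x.1, h, rfl⟩

end Main

end CohAux

/-- there are a finitely generated module `T` and submodules
`W ⊆ V`, `U` of `T` with `U ≅ F(M)` such that `F(M/IⁿN) ≅ (U + I^{n−d}V)/(I^{n−d}W)`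
for all `n ≥ d`. -/
theorem stmt8 {R : Type u} [CommRing R] [IsNoetherianRing R]
    {r : ℕ} (hr : 1 ≤ r) (I : Fin r → Ideal R)
    (M : Type u) [AddCommGroup M] [Module R M] [Module.Finite R M]
    (N : Submodule R M)
    {K L : Type u} [AddCommGroup K] [Module R K] [Module.Finite R K]
    [AddCommGroup L] [Module R L] [Module.Finite R L]
    (f : K →ₗ[R] L) :
    ∃ (d : Fin r → ℕ) (T : Type u) (_ : AddCommGroup T) (_ : Module R T)
      (_ : Module.Finite R T) (U V W : Submodule R T),
      W ≤ V ∧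
      Nonempty (U ≃ₗ[R] coherentApply f M) ∧
      ∀ n : Fin r → ℕ, d ≤ n →
        Nonempty (
          coherentApply f (M ⧸ (prodPow I n • N : Submodule R M))
          ≃ₗ[R]
          (↥(U ⊔ prodPow I (n - d) • V) ⧸
            Submodule.comap (U ⊔ prodPow I (n - d) • V).subtype
              (prodPow I (n - d) • W))) := by
  classical
  obtain ⟨a, p, hp⟩ := Module.Finite.exists_fin' R K
  obtain ⟨c, p', hp'⟩ := Module.Finite.exists_fin' R L
  obtain ⟨g, hg⟩ := Module.projective_lifting_property p' (f.comp p) hp'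
  obtain ⟨d₁, hd₁⟩ := CohAux.HH_artinRees I a (LinearMap.ker p) N
  obtain ⟨d₂, hd₂⟩ := CohAux.HH_artinRees I c (LinearMap.ker p') N
  let d := d₁ ⊔ d₂
  let γ := LinearMap.lcomp R M g
  let Y : Submodule R ((Fin a → R) →ₗ[R] M) := (CohAux.HH (LinearMap.ker p') ⊥).map γ
  let π := Y.mkQ
  let V0 := CohAux.HH (LinearMap.ker p) (prodPow I d • N)
  let W0 := CohAux.HH ⊤ (prodPow I d • N) ⊔
    (CohAux.HH (LinearMap.ker p') (prodPow I d • N)).map γ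
  let μ : (K →ₗ[R] M) →ₗ[R] _ := π.comp (LinearMap.lcomp R M p)
  have hZ : LinearMap.range (LinearMap.lcomp R M p) = CohAux.HH (LinearMap.ker p) ⊥ := by
    ext φ
    constructor
    · rintro ⟨ψ, rfl⟩ x hx
      rw [LinearMap.mem_ker] at hx
      simp [hx]
    · intro h
      obtain ⟨ψ, hψ⟩ := CohAux.exists_factor p hp φ (fun x hx => by simpa using h x hx)
      exact ⟨ψ, hψ⟩
  refine ⟨d, _ ⧸ Y, inferInstance, inferInstance, inferInstance, LinearMap.range μ,
    V0.map π, W0.map π, ?_, ?_, ?_⟩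
  · refine Submodule.map_mono (sup_le ?_ ?_)
    · exact fun φ hφ x _ => hφ x trivial
    · rintro _ ⟨θ, hθ, rfl⟩ x hx
      refine hθ (g x) ?_
      have := LinearMap.congr_fun hg x
      rw [LinearMap.mem_ker] at *
      simpa [hx] using this
  · have hker : LinearMap.ker μ = LinearMap.range (LinearMap.lcomp R M f) := by
      ext φ
      rw [LinearMap.mem_ker, LinearMap.comp_apply, Submodule.mkQ_apply,
        Submodule.Quotient.mk_eq_zero]
      constructor
      · rintro ⟨θ, hθ, h⟩
        have h : θ.comp g = φ.comp p := h
        obtain ⟨ψ, hψ⟩ := CohAux.exists_factor p' hp' θ (fun x hx => by simpa using hθ x hx)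
        refine ⟨ψ, CohAux.comp_inj p hp ?_⟩
        change (ψ.comp f).comp p = φ.comp p
        rw [← h, LinearMap.comp_assoc, ← hg, ← LinearMap.comp_assoc, hψ]
      · rintro ⟨ψ, rfl⟩
        refine ⟨ψ.comp p', fun x hx => ?_, ?_⟩
        · rw [LinearMap.mem_ker] at hx
          simp [hx]
        · change (ψ.comp p').comp g = (ψ.comp f).comp p
          rw [LinearMap.comp_assoc, hg, LinearMap.comp_assoc]
    exact ⟨(μ.quotKerEquivRange.symm).trans (Submodule.quotEquivOfEq _ _ hker)⟩
  · intro n hn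
    have hK := hd₁ d le_sup_left n hn
    have hL := hd₂ d le_sup_right n hn
    obtain ⟨Φ, hΦ, hΦk⟩ := CohAux.exists_Phi f p hp p' hp' g hg (prodPow I n • N)
    have hY : LinearMap.ker π = Y := Submodule.ker_mkQ Y
    have hsm : prodPow I n • N = prodPow I (n - d) • prodPow I d • N := by
      rw [← Submodule.smul_assoc, smul_eq_mul, ← CohAux.prodPow_add, tsub_add_cancel_of_le hn]
    have hD : CohAux.HH ⊤ (prodPow I n • N) ⊔
        (CohAux.HH (LinearMap.ker p') (prodPow I n • N)).map (LinearMap.lcomp R M g) =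
        Y ⊔ prodPow I (n - d) • W0 := by
      rw [hL, hsm, CohAux.HH_smul, Submodule.map_sup, Submodule.map_smul'', Submodule.smul_sup,
        sup_left_comm]
    obtain ⟨Ψ, hΨ, hΨk⟩ := CohAux.exists_Psi π (CohAux.HH (LinearMap.ker p) (prodPow I n • N))
      (Y ⊔ prodPow I (n - d) • W0) (hY.le.trans le_sup_left)
      (LinearMap.range μ ⊔ prodPow I (n - d) • V0.map π) (prodPow I (n - d) • W0.map π)
      (by rw [hK, Submodule.map_sup, Submodule.map_smul'', ← hZ, LinearMap.range_comp])
      (by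
        have : Y.map π = ⊥ := by
          rw [eq_bot_iff, Submodule.map_le_iff_le_comap]
          exact hY.ge
        rw [Submodule.map_sup Y, Submodule.map_smul'', this, bot_sup_eq])
    exact ⟨(Φ.quotKerEquivOfSurjective hΦ).symm.trans
      ((Submodule.quotEquivOfEq _ _ (by rw [hΦk, hΨk, hD])).trans
        (Ψ.quotKerEquivOfSurjective hΨ))⟩
end

section
/- Let (R, 𝔪) be a commutative Noetherian local ring with residue field k, r ≥ 1 an integer, I_1,…,I_r ideals of R, and N ⊆ M finitely generated R-modules. Let f : K → L be an R-linear map between finitely generated R-modules and let F denote the associated coherent functor, F(X) := Hom_R(K,X) / {g ∘ f : g ∈ Hom_R(L,X)}. Fix i ≥ 0. Then there exist c ∈ ℕ^r and a polynomial P ∈ ℚ[x_1,…,x_r] such that the i-th Betti number satisfies β_i^R(F(M/I^n N)) = P(n) for all n ≥ c. -/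
universe u

open CategoryTheory

/-- The length `λ_R(X)` of an `R`-module `X`. -/
noncomputable def moduleLength (R X : Type u) [CommRing R] [AddCommGroup X]
    [Module R X] : WithBot ℕ∞ :=
  Order.krullDim (Submodule R X)

/-- The `i`-th Betti number of `X` over a local ring `(R,𝔪,k)`:
`β_i^R(X) = dim_k Tor_i^R(k, X)`, computed as the `R`-length of `Tor_i^R(k, X)`
(which coincides with its `k`-dimension since `𝔪` annihilates this module). -/
noncomputable def bettiNumber (R : Type u) [CommRing R] [IsLocalRing R] (i : ℕ)
    (X : Type u) [AddCommGroup X] [Module R X] : WithBot ℕ∞ :=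
  moduleLength R
    ↥(((Tor (ModuleCat.{u} R) i).obj
        (ModuleCat.of R (IsLocalRing.ResidueField R))).obj (ModuleCat.of R X))

open CategoryTheory MonoidalCategory

section TorPart
variable {R : Type u} [CommRing R]

noncomputable abbrev tc (Z : ModuleCat.{u} R) (P : ChainComplex (ModuleCat.{u} R) ℕ) :
    ChainComplex (ModuleCat.{u} R) ℕ :=
  (((tensoringLeft (ModuleCat.{u} R)).obj Z).mapHomologicalComplex _).obj P

noncomputable abbrev tcm {Z Z' : ModuleCat.{u} R} (f : Z ⟶ Z') (P : ChainComplex (ModuleCat.{u} R) ℕ) :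
    tc Z P ⟶ tc Z' P :=
  (NatTrans.mapHomologicalComplex ((tensoringLeft (ModuleCat.{u} R)).map f) _).app P

lemma tcm_zero_comp {S : ShortComplex (ModuleCat.{u} R)} (P : ChainComplex (ModuleCat.{u} R) ℕ) :
    tcm S.f P ≫ tcm S.g P = 0 := by
  ext i : 1
  have : S.f ▷ P.X i ≫ S.g ▷ P.X i = 0 := by
    rw [← comp_whiskerRight, S.zero]; simp
  exact this

noncomputable abbrev tcS (S : ShortComplex (ModuleCat.{u} R)) (P : ChainComplex (ModuleCat.{u} R) ℕ) :
    ShortComplex (ChainComplex (ModuleCat.{u} R) ℕ) :=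
  ShortComplex.mk _ _ (tcm_zero_comp (S := S) P)

lemma tcS_shortExact {S : ShortComplex (ModuleCat.{u} R)} (hS : S.ShortExact)
    (P : ChainComplex (ModuleCat.{u} R) ℕ) (hP : ∀ i, Module.Flat R (P.X i)) :
    (tcS S P).ShortExact := by
  apply HomologicalComplex.shortExact_of_degreewise_shortExact
  intro i
  have := hP i
  have h1 : (S.map (tensorRight (P.X i))).ShortExact := hS.map_of_exact (tensorRight (P.X i))
  exact h1

lemma tc_isZero (F : ModuleCat.{u} R) [Module.Flat R F] {X : ModuleCat.{u} R}
    (P : ProjectiveResolution X) (i : ℕ) : Limits.IsZero ((tc F P.complex).homology (i+1)) := by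
  rw [← HomologicalComplex.exactAt_iff_isZero_homology]
  have h := P.complex_exactAt_succ i
  rw [HomologicalComplex.exactAt_iff' _ (i+2) (i+1) i (by simp) (by simp)] at h
  have h2 := Module.Flat.lTensor_shortComplex_exact F _ h
  have h3 : ((tc F P.complex).sc' (i+2) (i+1) i).Exact := h2
  exact (HomologicalComplex.exactAt_iff' _ (i+2) (i+1) i (by simp) (by simp)).2 h3


noncomputable abbrev pr (X : ModuleCat.{u} R) : ProjectiveResolution X := projectiveResolution X

lemma pr_flat (X : ModuleCat.{u} R) (i : ℕ) : Module.Flat R ((pr X).complex.X i) := by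
  have : Module.Projective R ((pr X).complex.X i) :=
    (IsProjective.iff_projective (R := R) _).2 ((pr X).projective i)
  infer_instance

noncomputable def torIso (Z X : ModuleCat.{u} R) (i : ℕ) :
    ((Tor (ModuleCat.{u} R) i).obj Z).obj X ≅ (tc Z (pr X).complex).homology i :=
  (pr X).isoLeftDerivedObj ((tensoringLeft (ModuleCat.{u} R)).obj Z) i

lemma tor_shift {S : ShortComplex (ModuleCat.{u} R)} (hS : S.ShortExact) [Module.Flat R S.X₂]
    (X : ModuleCat.{u} R) (i : ℕ) :
    Nonempty (((Tor (ModuleCat.{u} R) (i+2)).obj S.X₃).obj X ≅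
      ((Tor (ModuleCat.{u} R) (i+1)).obj S.X₁).obj X) := by
  have h := tcS_shortExact hS (pr X).complex (pr_flat X)
  exact ⟨torIso _ _ _ ≪≫ h.δIso (i+2) (i+1) (by simp) (tc_isZero S.X₂ (pr X) (i+1))
    (tc_isZero S.X₂ (pr X) i) ≪≫ (torIso _ _ _).symm⟩

noncomputable def h0Iso (Z X : ModuleCat.{u} R) :
    (tc Z (pr X).complex).homology 0 ≅ Z ⊗ X :=
  (ChainComplex.isoHomologyι₀ _) ≪≫ asIso ((pr X).fromLeftDerivedZero' ((tensoringLeft (ModuleCat.{u} R)).obj Z))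

lemma tor_zero (Z X : ModuleCat.{u} R) :
    Nonempty (((Tor (ModuleCat.{u} R) 0).obj Z).obj X ≅ Z ⊗ X) :=
  ⟨torIso _ _ _ ≪≫ h0Iso _ _⟩

lemma h0Iso_nat {Z Z' : ModuleCat.{u} R} (f : Z ⟶ Z') (X : ModuleCat.{u} R) :
    HomologicalComplex.homologyMap (tcm f (pr X).complex) 0 ≫ (h0Iso Z' X).hom =
      (h0Iso Z X).hom ≫ f ▷ X := by
  have h1 : HomologicalComplex.opcyclesMap (tcm f (pr X).complex) 0 ≫
      (pr X).fromLeftDerivedZero' ((tensoringLeft (ModuleCat.{u} R)).obj Z') =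
      (pr X).fromLeftDerivedZero' ((tensoringLeft (ModuleCat.{u} R)).obj Z) ≫ f ▷ X := by
    rw [← cancel_epi (HomologicalComplex.pOpcycles _ _)]
    rw [HomologicalComplex.p_opcyclesMap_assoc, ProjectiveResolution.pOpcycles_comp_fromLeftDerivedZero',
      ProjectiveResolution.pOpcycles_comp_fromLeftDerivedZero'_assoc]
    exact (((tensoringLeft (ModuleCat.{u} R)).map f).naturality ((pr X).π.f 0)).symm
  have h2 := HomologicalComplex.homologyι_naturality (tcm f (pr X).complex) 0
  have h3 : (h0Iso Z X).hom = (tc Z (pr X).complex).homologyι 0 ≫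
    (pr X).fromLeftDerivedZero' ((tensoringLeft (ModuleCat.{u} R)).obj Z) := rfl
  have h4 : (h0Iso Z' X).hom = (tc Z' (pr X).complex).homologyι 0 ≫
    (pr X).fromLeftDerivedZero' ((tensoringLeft (ModuleCat.{u} R)).obj Z') := rfl
  rw [h3, h4, ← Category.assoc, h2, Category.assoc, h1, Category.assoc]

lemma tor_one {S : ShortComplex (ModuleCat.{u} R)} (hS : S.ShortExact) [Module.Flat R S.X₂]
    (X : ModuleCat.{u} R) :
    ∃ ε : ((Tor (ModuleCat.{u} R) 1).obj S.X₃).obj X ⟶ S.X₁ ⊗ X,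
      Function.Injective ε.hom ∧ Function.Exact ε.hom (S.f ▷ X).hom := by
  have h := tcS_shortExact hS (pr X).complex (pr_flat X)
  have hm : Mono (h.δ 1 0 (by simp)) := h.mono_δ 1 0 (by simp) (tc_isZero S.X₂ (pr X) 0)
  have he := h.homology_exact₁ 1 0 (by simp)
  rw [ShortComplex.ShortExact.moduleCat_exact_iff_function_exact] at he
  have hn : ∀ y, (S.f ▷ X).hom ((h0Iso S.X₁ X).hom.hom y) =
      (h0Iso S.X₂ X).hom.hom ((HomologicalComplex.homologyMap (tcm S.f (pr X).complex) 0).hom y) := by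
    intro y
    have := congrArg (fun t => t.hom y) (h0Iso_nat S.f X)
    exact this.symm
  have inj2 : Function.Injective (h0Iso S.X₂ X).hom.hom :=
    (ModuleCat.mono_iff_injective (h0Iso S.X₂ X).hom).1 inferInstance
  have surj1 : Function.Surjective (h0Iso S.X₁ X).hom.hom :=
    (ModuleCat.epi_iff_surjective (h0Iso S.X₁ X).hom).1 inferInstance
  have inj1 : Function.Injective (h0Iso S.X₁ X).hom.hom :=
    (ModuleCat.mono_iff_injective (h0Iso S.X₁ X).hom).1 inferInstance
  have surjT : Function.Surjective (torIso S.X₃ X 1).hom.hom :=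
    (ModuleCat.epi_iff_surjective (torIso S.X₃ X 1).hom).1 inferInstance
  have injT : Function.Injective (torIso S.X₃ X 1).hom.hom :=
    (ModuleCat.mono_iff_injective (torIso S.X₃ X 1).hom).1 inferInstance
  have injδ : Function.Injective (h.δ 1 0 (by simp)).hom :=
    (ModuleCat.mono_iff_injective _).1 hm
  refine ⟨(torIso _ _ _).hom ≫ h.δ 1 0 (by simp) ≫ (h0Iso _ _).hom, ?_, ?_⟩
  · exact inj1.comp (injδ.comp injT)
  · intro y
    obtain ⟨y, rfl⟩ := surj1 y
    rw [hn]
    constructor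
    · intro hy
      have : (HomologicalComplex.homologyMap (tcm S.f (pr X).complex) 0).hom y = 0 := by
        apply inj2; rw [hy, map_zero]
      obtain ⟨z, hz⟩ := (he y).1 this
      obtain ⟨w, rfl⟩ := surjT z
      exact ⟨w, congrArg (h0Iso S.X₁ X).hom.hom hz⟩
    · rintro ⟨w, hw⟩
      have h5 : (h.δ 1 0 (by simp)).hom ((torIso S.X₃ X 1).hom.hom w) = y := inj1 hw
      have : (HomologicalComplex.homologyMap (tcm S.f (pr X).complex) 0).hom y = 0 :=
        (he y).2 ⟨_, h5⟩
      rw [this, map_zero]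

lemma tor_smul_eq_zero (Z X : ModuleCat.{u} R) (i : ℕ) (a : R) (ha : ∀ z : Z, a • z = 0)
    (t : ((Tor (ModuleCat.{u} R) i).obj Z).obj X) : a • t = 0 := by
  have injT : Function.Injective (torIso Z X i).hom.hom :=
    (ModuleCat.mono_iff_injective (torIso Z X i).hom).1 inferInstance
  apply injT
  rw [map_smul, map_zero]
  set s := (torIso Z X i).hom.hom t
  have surj : Function.Surjective ((tc Z (pr X).complex).homologyπ i).hom :=
    (ModuleCat.epi_iff_surjective _).1 inferInstance
  have inj : Function.Injective ((tc Z (pr X).complex).iCycles i).hom :=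
    (ModuleCat.mono_iff_injective _).1 inferInstance
  obtain ⟨w, hw⟩ := surj s
  have : a • w = 0 := by
    apply inj
    rw [map_smul, map_zero]
    have key : ∀ v : TensorProduct R Z ((pr X).complex.X i), a • v = 0 := by
      intro v
      induction v with
      | zero => simp
      | tmul x y => rw [TensorProduct.smul_tmul', ha, TensorProduct.zero_tmul]
      | add x y hx hy => rw [smul_add, hx, hy, add_zero]
    exact key _
  rw [← hw, ← map_smul, this, map_zero]

/-- The action of a matrix on tuples of elements of a module. -/
def matX (X : Type*) [AddCommGroup X] [Module R X] {a b : ℕ} (A : Fin b → Fin a → R) :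
    (Fin a → X) →ₗ[R] (Fin b → X) :=
  LinearMap.pi fun i => ∑ j, A i j • LinearMap.proj j

lemma matX_apply (X : Type*) [AddCommGroup X] [Module R X] {a b : ℕ} (A : Fin b → Fin a → R)
    (x : Fin a → X) (i : Fin b) : matX X A x i = ∑ j, A i j • x j := by
  simp [matX]

lemma exists_gens (Z : Type*) [AddCommGroup Z] [Module R Z] [Module.Finite R Z] :
    ∃ (b : ℕ) (z : Fin b → Z), Submodule.span R (Set.range z) = ⊤ :=
  Submodule.fg_iff_exists_fin_generating_family.1 (Module.Finite.fg_top (R := R) (M := Z))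

lemma gens_rels [IsNoetherianRing R] {Z : Type*} [AddCommGroup Z] [Module R Z] {b : ℕ}
    (z : Fin b → Z) : ∃ (a : ℕ) (A : Fin b → Fin a → R), (∀ k, ∑ j, A j k • z j = 0) ∧
      ∀ w : Fin b → R, ∑ j, w j • z j = 0 → ∃ v : Fin a → R, ∀ j, w j = ∑ k, A j k * v k := by
  obtain ⟨a, y, hy⟩ := exists_gens (R := R) (LinearMap.ker (Fintype.linearCombination R z))
  refine ⟨a, fun j k => (y k).1 j, fun k => ?_, fun w hw => ?_⟩
  · have := (y k).2
    rwa [LinearMap.mem_ker, Fintype.linearCombination_apply] at this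
  · have h1 : (⟨w, by rwa [LinearMap.mem_ker, Fintype.linearCombination_apply]⟩ :
      LinearMap.ker (Fintype.linearCombination R z)) ∈ Submodule.span R (Set.range y) := by
      rw [hy]; trivial
    rw [Submodule.mem_span_range_iff_exists_fun] at h1
    obtain ⟨v, hv⟩ := h1
    refine ⟨v, fun j => ?_⟩
    have := congrFun (congrArg Subtype.val hv) j
    simp only [Submodule.coe_sum, Submodule.coe_smul, Finset.sum_apply, Pi.smul_apply, smul_eq_mul] at this
    rw [← this]
    exact Finset.sum_congr rfl fun _ _ => mul_comm _ _

open TensorProduct in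
/-- The map `X^b → Z ⊗ X` attached to elements of `Z`. -/
noncomputable def thetaMap {Z : Type*} [AddCommGroup Z] [Module R Z] {b : ℕ}
    (z : Fin b → Z) (X : Type*) [AddCommGroup X] [Module R X] : (Fin b → X) →ₗ[R] (Z ⊗[R] X) :=
  ∑ j, (TensorProduct.mk R Z X (z j)) ∘ₗ LinearMap.proj j

open TensorProduct in
lemma thetaMap_apply {Z : Type*} [AddCommGroup Z] [Module R Z] {b : ℕ}
    (z : Fin b → Z) (X : Type*) [AddCommGroup X] [Module R X] (x : Fin b → X) :
    thetaMap z X x = ∑ j, z j ⊗ₜ[R] x j := by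
  simp [thetaMap]

open TensorProduct in
lemma thetaMap_surj {Z : Type*} [AddCommGroup Z] [Module R Z] {b : ℕ}
    (z : Fin b → Z) (hz : Submodule.span R (Set.range z) = ⊤) (X : Type*) [AddCommGroup X] [Module R X] :
    Function.Surjective (thetaMap (R := R) z X) := by
  intro t
  induction t with
  | zero => exact ⟨0, map_zero _⟩
  | tmul w y =>
    have h : w ∈ Submodule.span R (Set.range z) := by rw [hz]; trivial
    rw [Submodule.mem_span_range_iff_exists_fun] at h
    obtain ⟨c, rfl⟩ := h
    refine ⟨fun j => c j • y, ?_⟩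
    rw [thetaMap_apply, TensorProduct.sum_tmul]
    simp [TensorProduct.smul_tmul]
  | add x y hx hy =>
    obtain ⟨u, rfl⟩ := hx
    obtain ⟨v, rfl⟩ := hy
    exact ⟨u + v, map_add _ _ _⟩

lemma thetaMap_ker {Z : Type*} [AddCommGroup Z] [Module R Z] {b a : ℕ}
    (z : Fin b → Z) (hz : Submodule.span R (Set.range z) = ⊤) (A : Fin b → Fin a → R)
    (hA : ∀ k, ∑ j, A j k • z j = 0)
    (hA' : ∀ w : Fin b → R, ∑ j, w j • z j = 0 → ∃ v : Fin a → R, ∀ j, w j = ∑ k, A j k * v k)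
    (X : Type*) [AddCommGroup X] [Module R X] :
    LinearMap.ker (thetaMap (R := R) z X) = LinearMap.range (matX X A) := by
  ext x
  rw [LinearMap.mem_ker, thetaMap_apply]
  constructor
  · intro h
    obtain ⟨κ, c, y, h1, h2⟩ := TensorProduct.vanishesTrivially_of_sum_tmul_eq_zero R hz h
    choose v hv using fun k => hA' (fun j => c j k) (h2 k)
    refine ⟨fun l => ∑ k, v k l • y k, ?_⟩
    ext j
    rw [matX_apply, h1]
    simp_rw [hv, Finset.sum_smul, Finset.smul_sum, smul_smul]
    rw [Finset.sum_comm]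
  · rintro ⟨y, rfl⟩
    exact TensorProduct.sum_tmul_eq_zero_of_vanishesTrivially R
      ⟨a, A, y, fun i => matX_apply _ _ _ _, hA⟩

/-- `T` is the homology of `X^a → X^b → X^c`. -/
def IsMatHom (X : Type*) [AddCommGroup X] [Module R X] {a b c : ℕ} (A : Fin b → Fin a → R)
    (B : Fin c → Fin b → R) (T : Type*) [AddCommGroup T] [Module R T] : Prop :=
  LinearMap.range (matX X A) ≤ LinearMap.ker (matX X B) ∧
  ∃ θ : LinearMap.ker (matX X B) →ₗ[R] T, Function.Surjective θ ∧
    LinearMap.ker θ = (LinearMap.range (matX X A)).comap (LinearMap.ker (matX X B)).subtype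

lemma IsMatHom.congr {X : Type*} [AddCommGroup X] [Module R X] {a b c : ℕ} {A : Fin b → Fin a → R}
    {B : Fin c → Fin b → R} {T T' : Type*} [AddCommGroup T] [Module R T] [AddCommGroup T'] [Module R T']
    (h : IsMatHom X A B T) (e : T ≃ₗ[R] T') : IsMatHom X A B T' := by
  obtain ⟨h1, θ, h2, h3⟩ := h
  refine ⟨h1, e.toLinearMap ∘ₗ θ, e.surjective.comp h2, ?_⟩
  rw [← h3]
  ext x
  simp

theorem tor_pres [IsNoetherianRing R] (i : ℕ) : ∀ (Z : Type u) [AddCommGroup Z] [Module R Z]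
    [Module.Finite R Z], ∃ (a b c : ℕ) (A : Fin b → Fin a → R) (B : Fin c → Fin b → R),
    ∀ (X : Type u) [AddCommGroup X] [Module R X],
      IsMatHom X A B (((Tor (ModuleCat.{u} R) i).obj (ModuleCat.of R Z)).obj (ModuleCat.of R X)) := by
  induction i with
  | zero =>
    intro Z _ _ _
    obtain ⟨b, z, hz⟩ := exists_gens (R := R) Z
    obtain ⟨a, A, hA, hA'⟩ := gens_rels (R := R) z
    refine ⟨a, b, 0, A, fun i => i.elim0, fun X _ _ => ?_⟩
    obtain ⟨e⟩ := tor_zero (ModuleCat.of R Z) (ModuleCat.of R X)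
    have htop : ∀ x, x ∈ LinearMap.ker (matX X (fun i : Fin 0 => (i.elim0 : Fin b → R))) := by
      intro x
      rw [LinearMap.mem_ker]
      exact Subsingleton.elim _ _
    refine IsMatHom.congr (T := TensorProduct R Z X) ?_ e.toLinearEquiv.symm
    refine ⟨fun x _ => htop x, (thetaMap z X) ∘ₗ Submodule.subtype _, ?_, ?_⟩
    · intro t
      obtain ⟨x, rfl⟩ := thetaMap_surj z hz X t
      exact ⟨⟨x, htop x⟩, rfl⟩
    · rw [LinearMap.ker_comp, thetaMap_ker z hz A hA hA']
  | succ i ih =>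
    intro Z _ _ _
    obtain ⟨c, z, hz⟩ := exists_gens (R := R) Z
    have hp : Function.Surjective (Fintype.linearCombination R z) := by
      rw [← LinearMap.range_eq_top, Fintype.range_linearCombination, hz]
    have hS := LinearMap.shortExact_shortComplexKer hp
    have hfl : Module.Flat R (LinearMap.shortComplexKer (Fintype.linearCombination R z)).X₂ :=
      inferInstanceAs (Module.Flat R (Fin c → R))
    cases i with
    | succ i =>
      obtain ⟨a, b, c', A, B, h⟩ := ih (LinearMap.ker (Fintype.linearCombination R z))
      refine ⟨a, b, c', A, B, fun X _ _ => ?_⟩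
      obtain ⟨e⟩ := tor_shift hS (ModuleCat.of R X) i
      exact (h X).congr e.toLinearEquiv.symm
    | zero =>
      clear ih
      obtain ⟨b, y, hy⟩ := exists_gens (R := R) (LinearMap.ker (Fintype.linearCombination R z))
      obtain ⟨a, A, hA, hA'⟩ := gens_rels (R := R) y
      refine ⟨a, b, c, A, fun i j => (y j).1 i, fun X _ _ => ?_⟩
      obtain ⟨ε, hε, hex⟩ := tor_one hS (ModuleCat.of R X)
      set B : Fin c → Fin b → R := fun i j => (y j).1 i with hB
      let ι : TensorProduct R (LinearMap.ker (Fintype.linearCombination R z)) X →ₗ[R]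
        TensorProduct R (Fin c → R) X := LinearMap.rTensor X (Submodule.subtype _)
      have key : ∀ x, ι (thetaMap y X x) =
          thetaMap (fun i : Fin c => (Pi.single i 1 : Fin c → R)) X (matX X B x) := by
        intro x
        simp only [thetaMap_apply, matX_apply, map_sum, ι, LinearMap.rTensor_tmul, Submodule.subtype_apply]
        simp_rw [TensorProduct.tmul_sum]
        rw [Finset.sum_comm]
        refine Finset.sum_congr rfl fun j _ => ?_
        simp_rw [← TensorProduct.smul_tmul, ← TensorProduct.sum_tmul]
        congr 1
        ext i
        simp [hB, Pi.single_apply]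
      have inj : Function.Injective (thetaMap (R := R) (fun i : Fin c => (Pi.single i 1 : Fin c → R)) X) := by
        rw [← LinearMap.ker_eq_bot]
        rw [thetaMap_ker (a := 0) _ _ (fun _ k => k.elim0)]
        · rw [LinearMap.range_eq_bot]
          ext x i
          simp [matX_apply]
        · intro k; exact k.elim0
        · intro w hw
          refine ⟨fun k => k.elim0, fun j => ?_⟩
          have := congrFun hw j
          simpa [Pi.single_apply] using this
        · rw [eq_top_iff]
          intro w _
          rw [Submodule.mem_span_range_iff_exists_fun]
          refine ⟨w, ?_⟩
          ext i
          simp [Pi.single_apply]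
      have hker : ∀ x, x ∈ LinearMap.ker (matX X B) ↔ ι (thetaMap y X x) = 0 := by
        intro x
        rw [key, LinearMap.mem_ker, map_eq_zero_iff _ inj]
      have hrange : ∀ t, ι t = 0 ↔ t ∈ LinearMap.range ε.hom := fun t => hex t
      have hker2 := thetaMap_ker y hy A hA hA' X
      refine IsMatHom.congr (T := LinearMap.range ε.hom) ?_ (LinearEquiv.ofInjective ε.hom hε).symm
      refine ⟨?_, LinearMap.codRestrict _ ((thetaMap y X) ∘ₗ Submodule.subtype _) ?_, ?_, ?_⟩
      · rw [← hker2]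
        intro x hx
        rw [hker, LinearMap.mem_ker.1 hx, map_zero]
      · rintro ⟨x, hx⟩
        exact (hrange _).1 ((hker _).1 hx)
      · rintro ⟨t, ht⟩
        obtain ⟨x, rfl⟩ := thetaMap_surj y hy X t
        exact ⟨⟨x, (hker _).2 ((hrange _).2 ht)⟩, rfl⟩
      · rw [LinearMap.ker_codRestrict, LinearMap.ker_comp, hker2]

end TorPart

section PolyPart
open MvPolynomial

lemma eval_bind_aux {r : ℕ} (f : Fin r → MvPolynomial (Fin r) ℚ) (x : Fin r → ℚ)
    (P : MvPolynomial (Fin r) ℚ) : eval x (bind₁ f P) = eval (fun i => eval x (f i)) P := by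
  induction P using MvPolynomial.induction_on with
  | C a => simp
  | add p q hp hq => simp [hp, hq]
  | mul_X p i hp => simp [hp]

/-- eventually polynomial functions on `ℕ^r` -/
def EvPoly {r : ℕ} (h : (Fin r → ℕ) → ℚ) : Prop :=
  ∃ (c : Fin r → ℕ) (P : MvPolynomial (Fin r) ℚ), ∀ n, c ≤ n →
    h n = MvPolynomial.eval (fun i => (n i : ℚ)) P

lemma EvPoly.const {r : ℕ} (q : ℚ) : EvPoly (fun _ : Fin r → ℕ => q) :=
  ⟨0, C q, fun n _ => by simp⟩

lemma EvPoly.add {r : ℕ} {h g : (Fin r → ℕ) → ℚ} (hh : EvPoly h) (hg : EvPoly g) :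
    EvPoly (fun n => h n + g n) := by
  obtain ⟨c, P, hP⟩ := hh
  obtain ⟨d, Q, hQ⟩ := hg
  refine ⟨c ⊔ d, P + Q, fun n hn => ?_⟩
  simp only []
  rw [map_add, hP n (le_sup_left.trans hn), hQ n (le_sup_right.trans hn)]

lemma EvPoly.neg {r : ℕ} {h : (Fin r → ℕ) → ℚ} (hh : EvPoly h) :
    EvPoly (fun n => - h n) := by
  obtain ⟨c, P, hP⟩ := hh
  refine ⟨c, -P, fun n hn => ?_⟩
  simp only []
  rw [map_neg, hP n hn]

lemma EvPoly.congr {r : ℕ} {h g : (Fin r → ℕ) → ℚ} (hh : EvPoly h) (d : Fin r → ℕ)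
    (e : ∀ n, d ≤ n → g n = h n) : EvPoly g := by
  obtain ⟨c, P, hP⟩ := hh
  refine ⟨c ⊔ d, P, fun n hn => ?_⟩
  rw [e n (le_sup_right.trans hn), hP n (le_sup_left.trans hn)]

lemma EvPoly.shift {r : ℕ} {h : (Fin r → ℕ) → ℚ} (hh : EvPoly h) (d : Fin r → ℕ) :
    EvPoly (fun n => h (n + d)) := by
  obtain ⟨c, P, hP⟩ := hh
  refine ⟨c, bind₁ (fun i => X i + C (d i : ℚ)) P, fun n hn => ?_⟩
  simp only []
  rw [hP _ (hn.trans (le_add_of_nonneg_right (zero_le))), eval_bind_aux]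
  simp

lemma EvPoly.of_shift {r : ℕ} {h : (Fin r → ℕ) → ℚ} (d : Fin r → ℕ)
    (hh : EvPoly (fun n => h (n + d))) : EvPoly h := by
  obtain ⟨c, P, hP⟩ := hh
  refine ⟨c + d, bind₁ (fun i => X i - C (d i : ℚ)) P, fun n hn => ?_⟩
  have hd : d ≤ n := (le_add_of_nonneg_left (zero_le)).trans hn
  have h1 := hP (n - d) (le_tsub_of_add_le_right hn)
  simp only [tsub_add_cancel_of_le hd] at h1
  rw [h1, eval_bind_aux]
  congr 2
  ext i
  simp [Nat.cast_sub (hd i)]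

lemma exists_antideriv {r : ℕ} (j : Fin r) (P : MvPolynomial (Fin r) ℚ) :
    ∃ Q : MvPolynomial (Fin r) ℚ, ∀ x : Fin r → ℚ,
      eval (x + Pi.single j 1) Q - eval x Q = eval x P := by
  induction P using MvPolynomial.induction_on' with
  | monomial u a =>
    let q : MvPolynomial (Fin r) ℚ := Polynomial.aeval (X j) (Polynomial.bernoulli (u j + 1))
    have hq : ∀ x : Fin r → ℚ, eval x q = (Polynomial.bernoulli (u j + 1)).eval (x j) := by
      intro x
      have := Polynomial.hom_eval₂ (Polynomial.bernoulli (u j + 1)) (algebraMap ℚ (MvPolynomial (Fin r) ℚ))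
        (eval x) (X j)
      rw [eval_X] at this
      simp only [q, Polynomial.aeval_def]
      rw [this, Polynomial.eval]
      congr 1
      ext t
      simp
    refine ⟨C (a / (u j + 1)) * (q * ∏ i ∈ Finset.univ.erase j, X i ^ u i), fun x => ?_⟩
    have h1 : ∏ i ∈ Finset.univ.erase j, (x + Pi.single j 1 : Fin r → ℚ) i ^ u i =
        ∏ i ∈ Finset.univ.erase j, x i ^ u i := by
      refine Finset.prod_congr rfl fun i hi => ?_
      simp [Finset.ne_of_mem_erase hi]
    simp only [map_mul, eval_C, hq, map_prod, map_pow, eval_X, h1, eval_monomial]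
    have h2 : (x + Pi.single j 1 : Fin r → ℚ) j = 1 + x j := by simp [add_comm]
    rw [h2, Polynomial.bernoulli_eval_one_add, Finsupp.prod_fintype _ _ (by simp),
      ← Finset.mul_prod_erase _ _ (Finset.mem_univ j)]
    have : (u j + 1 : ℚ) ≠ 0 := by positivity
    push_cast
    field_simp
    simp
    ring
  | add p q hp hq =>
    obtain ⟨P, hP⟩ := hp
    obtain ⟨Q, hQ⟩ := hq
    refine ⟨P + Q, fun x => ?_⟩
    rw [map_add, map_add, map_add, ← hP, ← hQ]; ring

lemma EvPoly.of_diff {r : ℕ} {h : (Fin r → ℕ) → ℚ}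
    (hh : ∀ j, EvPoly (fun n => h (n + Pi.single j 1) - h n)) : EvPoly h := by
  choose c' P hP using hh
  let c : Fin r → ℕ := Finset.univ.sup c'
  have hc : ∀ j, c' j ≤ c := fun j => Finset.le_sup (Finset.mem_univ j)
  choose Q hQ using fun j => exists_antideriv j (P j)
  have tele : ∀ j (m : Fin r → ℕ), c ≤ m → ∀ t : ℕ,
      h (m + Pi.single j t) - h m = eval (fun i => ((m + Pi.single j t : Fin r → ℕ) i : ℚ)) (Q j)
        - eval (fun i => (m i : ℚ)) (Q j) := by
    intro j m hm t
    induction t with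
    | zero => simp
    | succ t ih =>
      have h1 := hP j (m + Pi.single j t) ((hc j).trans (hm.trans (le_add_of_nonneg_right (zero_le))))
      have h2 := hQ j (fun i => ((m + Pi.single j t : Fin r → ℕ) i : ℚ))
      have e1 : m + Pi.single j (t+1) = m + Pi.single j t + Pi.single j 1 := by
        rw [Pi.single_add, add_assoc]
      have e2 : (fun i => ((m + Pi.single j (t+1) : Fin r → ℕ) i : ℚ)) =
          (fun i => ((m + Pi.single j t : Fin r → ℕ) i : ℚ)) + Pi.single j 1 := by
        rw [e1]
        ext i
        by_cases hi : i = j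
        · subst hi; simp
        · simp [hi]
      rw [e2, e1]
      simp only [] at h1
      linarith
  have tele2 : ∀ j (m : Fin r → ℕ), c ≤ m →
      h m - h (Function.update m j (c j)) = eval (fun i => (m i : ℚ)) (Q j)
        - eval (fun i => (Function.update m j (c j) i : ℚ)) (Q j) := by
    intro j m hm
    have := tele j (Function.update m j (c j)) ?_ (m j - c j)
    · have e : Function.update m j (c j) + Pi.single j (m j - c j) = m := by
        ext i
        by_cases hi : i = j
        · subst hi; simp [Nat.add_sub_cancel' (hm i)]
        · simp [hi]
      rwa [e] at this
    · intro i
      by_cases hi : i = j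
      · subst hi; simp
      · simp [hi, hm i]
  have main : ∀ s : Finset (Fin r), ∃ T : MvPolynomial (Fin r) ℚ, ∀ n, c ≤ n →
      h n = eval (fun i => (n i : ℚ)) T + h (s.piecewise c n) := by
    intro s
    induction s using Finset.induction_on with
    | empty => exact ⟨0, fun n _ => by simp⟩
    | insert j s hj ih =>
      obtain ⟨T, hT⟩ := ih
      let sub : Finset (Fin r) → MvPolynomial (Fin r) ℚ → MvPolynomial (Fin r) ℚ := fun s' p =>
        bind₁ (fun i => if i ∈ s' then C (c i : ℚ) else X i) p
      have hsub : ∀ s' p (n : Fin r → ℕ), eval (fun i => (n i : ℚ)) (sub s' p) =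
          eval (fun i => (s'.piecewise c n i : ℚ)) p := by
        intro s' p n
        simp only [sub, eval_bind_aux]
        congr 2
        ext i
        by_cases hi : i ∈ s' <;> simp [hi]
      refine ⟨T + (sub s (Q j) - sub (insert j s) (Q j)), fun n hn => ?_⟩
      rw [map_add, map_sub, hsub, hsub, hT n hn]
      have h1 := tele2 j (s.piecewise c n) (by
        intro i
        by_cases hi : i ∈ s
        · simp [hi]
        · simp [hi, hn i])
      rw [← Finset.piecewise_insert] at h1
      linarith
  obtain ⟨T, hT⟩ := main Finset.univ
  refine ⟨c, T + C (h c), fun n hn => ?_⟩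
  rw [hT n hn]
  simp

end PolyPart

section HilbPart
variable {R : Type*} [CommRing R] {E : Type*} [AddCommGroup E] [Module R E] {r : ℕ}

/-- length of `Z / Y` -/
noncomputable def len (Y Z : Submodule R E) : ℕ∞ := Module.length R (Z ⧸ Y.comap Z.subtype)

lemma len_eq_of_surj {Y Z : Submodule R E} {T : Type*} [AddCommGroup T] [Module R T]
    (θ : Z →ₗ[R] T) (hs : Function.Surjective θ) (hk : LinearMap.ker θ = Y.comap Z.subtype) :
    Module.length R T = len Y Z := by
  rw [len, ← hk]
  exact (LinearMap.quotKerEquivOfSurjective θ hs).length_eq.symm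

lemma len_self (Y : Submodule R E) : len Y Y = 0 := by
  rw [len, Module.length_eq_zero_iff, Submodule.Quotient.subsingleton_iff]
  ext x; simp

lemma len_add {Y W Z : Submodule R E} (h1 : Y ≤ W) (h2 : W ≤ Z) : len Y Z = len Y W + len W Z := by
  let f : (W ⧸ Y.comap W.subtype) →ₗ[R] (Z ⧸ Y.comap Z.subtype) :=
    Submodule.mapQ _ _ (Submodule.inclusion h2) (by intro x hx; exact hx)
  let g : (Z ⧸ Y.comap Z.subtype) →ₗ[R] (Z ⧸ W.comap Z.subtype) :=
    Submodule.mapQ _ _ LinearMap.id (by intro x hx; exact h1 hx)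
  refine Module.length_eq_add_of_exact f g ?_ ?_ ?_
  · rw [← LinearMap.ker_eq_bot, LinearMap.ker_eq_bot']
    intro x
    induction x using Submodule.Quotient.induction_on with | _ x =>
    intro hx
    have : (Submodule.Quotient.mk (Submodule.inclusion h2 x) : Z ⧸ Y.comap Z.subtype) = 0 := hx
    rw [Submodule.Quotient.mk_eq_zero] at this ⊢
    exact this
  · intro x
    induction x using Submodule.Quotient.induction_on with | _ x =>
    exact ⟨Submodule.Quotient.mk x, rfl⟩
  · intro x
    induction x using Submodule.Quotient.induction_on with | _ x =>
    constructor
    · intro hx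
      have : (Submodule.Quotient.mk x : Z ⧸ W.comap Z.subtype) = 0 := hx
      rw [Submodule.Quotient.mk_eq_zero] at this
      exact ⟨Submodule.Quotient.mk ⟨x.1, this⟩, rfl⟩
    · rintro ⟨y, hy⟩
      induction y using Submodule.Quotient.induction_on with | _ y =>
      rw [← hy]
      change (Submodule.Quotient.mk (Submodule.inclusion h2 y) : Z ⧸ W.comap Z.subtype) = 0
      rw [Submodule.Quotient.mk_eq_zero]
      exact y.2

lemma len_map {E' : Type*} [AddCommGroup E'] [Module R E'] (φ : E →ₗ[R] E') (Z : Submodule R E)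
    (Y' : Submodule R E') : len (Z ⊓ Y'.comap φ) Z = len Y' (Y' ⊔ Z.map φ) := by
  symm
  let ψ : Z →ₗ[R] (Y' ⊔ Z.map φ : Submodule R E') :=
    LinearMap.codRestrict _ (φ ∘ₗ Z.subtype) (fun z => (le_sup_right : _ ≤ Y' ⊔ Z.map φ) ⟨z.1, z.2, rfl⟩)
  refine len_eq_of_surj ((Submodule.mkQ _) ∘ₗ ψ) ?_ ?_
  · intro x
    induction x using Submodule.Quotient.induction_on with | _ x =>
    obtain ⟨x, hx⟩ := x
    obtain ⟨y, hy, z', ⟨z, hz, rfl⟩, rfl⟩ := Submodule.mem_sup.1 hx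
    refine ⟨⟨z, hz⟩, ?_⟩
    change Submodule.Quotient.mk _ = Submodule.Quotient.mk _
    rw [Submodule.Quotient.eq]
    change φ z - (y + φ z) ∈ Y'
    simpa using hy
  · rw [LinearMap.ker_comp, Submodule.ker_mkQ]
    ext z
    simp [ψ]

lemma len_inf (Z Y : Submodule R E) : len (Z ⊓ Y) Z = len Y (Y ⊔ Z) := by
  simpa using len_map (LinearMap.id) Z Y

/-- stability of a family of submodules under a set of homogeneous operators -/
def Stab (σ : Finset (R × Fin r)) (W : (Fin r → ℕ) → Submodule R E) : Prop :=
  ∀ p ∈ σ, ∀ n, W n ≤ (W (n + Pi.single p.2 1)).comap (LinearMap.lsmul R E p.1)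

/-- ascending chain condition for stable families between `Y` and `Z` -/
def ACC (σ : Finset (R × Fin r)) (Y Z : (Fin r → ℕ) → Submodule R E) : Prop :=
  ∀ W : ℕ → (Fin r → ℕ) → Submodule R E, Monotone W → (∀ t, Stab σ (W t)) →
    (∀ t, Y ≤ W t) → (∀ t, W t ≤ Z) → ∃ t₀, ∀ t, t₀ ≤ t → W t = W t₀

open Classical in
lemma hilbert_aux (σ : Finset (R × Fin r))
    (Y Z : (Fin r → ℕ) → Submodule R E) (hYZ : Y ≤ Z) (hY : Stab σ Y) (hZ : Stab σ Z)
    (hacc : ACC σ Y Z) (hj : ∃ j, ∀ p ∈ σ, p.2 ≠ j) :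
    EvPoly (fun n => ((len (Y n) (Z n)).toNat : ℚ)) := by
  obtain ⟨j, hj⟩ := hj
  have key : ∃ t₀, ∀ t, t₀ ≤ t → (fun n => if n j < t then Z n else Y n) =
      (fun n => if n j < t₀ then Z n else Y n) := by
    refine hacc (fun t n => if n j < t then Z n else Y n) ?_ ?_ ?_ ?_
    · intro s t hst n
      by_cases h : n j < s
      · simp [h, h.trans_le hst]
      · by_cases h' : n j < t
        · simp [h, h', hYZ n]
        · simp [h, h']
    · intro t p hp n
      have h0 : (n + Pi.single p.2 1 : Fin r → ℕ) j = n j := by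
        simp [Pi.single_apply, (hj p hp).symm]
      by_cases h : n j < t
      · simp only [h0, h, if_true]; exact hZ p hp n
      · simp only [h0, h, if_false]; exact hY p hp n
    · intro t n
      by_cases h : n j < t
      · simp [h, hYZ n]
      · simp [h]
    · intro t n
      by_cases h : n j < t
      · simp [h]
      · simp [h, hYZ n]
  obtain ⟨t₀, ht₀⟩ := key
  · refine (EvPoly.const 0).congr (fun _ => t₀) fun n hn => ?_
    have h1 := congrFun (ht₀ (n j + 1) ((hn j).trans (Nat.le_succ _))) n
    have h2 : ¬ (n j < t₀) := not_lt.2 (hn j)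
    simp only [Nat.lt_succ_self, if_true, h2, if_false] at h1
    rw [h1, len_self]
    simp

open Classical in
theorem hilbert_poly (k : ℕ) : ∀ (σ : Finset (R × Fin r)), σ.card = k →
    ∀ (Y Z : (Fin r → ℕ) → Submodule R E), Y ≤ Z → Stab σ Y → Stab σ Z → ACC σ Y Z →
    (∀ n, len (Y n) (Z n) ≠ ⊤) → EvPoly (fun n => ((len (Y n) (Z n)).toNat : ℚ)) := by
  induction k with
  | zero =>
    intro σ hσ Y Z hYZ hY hZ hacc hfin
    by_cases hj : ∃ j, ∀ p ∈ σ, p.2 ≠ j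
    · exact hilbert_aux σ Y Z hYZ hY hZ hacc hj
    push Not at hj
    apply EvPoly.of_diff
    intro j
    obtain ⟨p, hp, -⟩ := hj j
    rw [Finset.card_eq_zero] at hσ
    simp [hσ] at hp
  | succ k ih =>
    intro σ hσ Y Z hYZ hY hZ hacc hfin
    by_cases hj : ∃ j, ∀ p ∈ σ, p.2 ≠ j
    · exact hilbert_aux σ Y Z hYZ hY hZ hacc hj
    push Not at hj
    apply EvPoly.of_diff
    intro j
    obtain ⟨p, hp, rfl⟩ := hj j
    set e : Fin r → ℕ := Pi.single p.2 1 with he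
    set x := LinearMap.lsmul R E p.1 with hx
    have hcomm : ∀ (a : R), (LinearMap.lsmul R E a) ∘ₗ x = x ∘ₗ (LinearMap.lsmul R E a) := by
      intro a; ext z; simp [hx, smul_smul, mul_comm]
    let K : (Fin r → ℕ) → Submodule R E := fun n => Z n ⊓ (Y (n + e)).comap x
    let C : (Fin r → ℕ) → Submodule R E := fun m => Y m ⊔ ⨆ n, ⨆ (_ : n + e = m), (Z n).map x
    have hCe : ∀ n, C (n + e) = Y (n + e) ⊔ (Z n).map x := by
      intro n
      simp only [C]
      congr 1
      apply le_antisymm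
      · refine iSup_le fun n' => iSup_le fun hn' => ?_
        rw [add_right_cancel hn']
      · exact le_iSup_of_le n (le_iSup_of_le rfl le_rfl)
    have hYK : Y ≤ K := fun n => le_inf (hYZ n) (hY p hp n)
    have hKZ : K ≤ Z := fun n => inf_le_left
    have hYC : Y ≤ C := fun n => le_sup_left
    have hCZ : C ≤ Z := by
      intro m
      refine sup_le (hYZ m) (iSup_le fun n => iSup_le fun hn => ?_)
      subst hn
      exact Submodule.map_le_iff_le_comap.2 (hZ p hp n)
    have hKs : Stab (σ.erase p) K := by
      intro q hq n
      change K n ≤ (Z (n + Pi.single q.2 1) ⊓ (Y (n + Pi.single q.2 1 + e)).comap x).comap _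
      rw [Submodule.comap_inf]
      refine le_inf (inf_le_left.trans (hZ q (Finset.mem_of_mem_erase hq) n)) ?_
      rw [← Submodule.comap_comp, ← hcomm, Submodule.comap_comp]
      refine inf_le_right.trans (Submodule.comap_mono ?_)
      have := hY q (Finset.mem_of_mem_erase hq) (n + e)
      rwa [add_right_comm] at this
    have hCs : Stab (σ.erase p) C := by
      intro q hq m
      refine sup_le ((hY q (Finset.mem_of_mem_erase hq) m).trans (Submodule.comap_mono (hYC _))) ?_
      refine iSup_le fun n => iSup_le fun hn => ?_
      subst hn
      rw [add_right_comm, hCe, Submodule.map_le_iff_le_comap, ← Submodule.comap_comp, hcomm,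
        Submodule.comap_comp]
      refine (hZ q (Finset.mem_of_mem_erase hq) n).trans (Submodule.comap_mono ?_)
      rw [← Submodule.map_le_iff_le_comap]
      exact le_sup_right
    have fin : ∀ n, len (Y n) (K n) ≠ ⊤ ∧ len (K n) (Z n) ≠ ⊤ := by
      intro n
      have := hfin n
      rw [len_add (hYK n) (hKZ n)] at this
      simpa using this
    have fin' : ∀ n, len (Y n) (C n) ≠ ⊤ ∧ len (C n) (Z n) ≠ ⊤ := by
      intro n
      have := hfin n
      rw [len_add (hYC n) (hCZ n)] at this
      simpa using this
    have h1 := ih (σ.erase p) (by rw [Finset.card_erase_of_mem hp, hσ]; rfl) Y K hYK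
      (fun q hq => hY q (Finset.mem_of_mem_erase hq)) hKs ?_ (fun n => (fin n).1)
    have h2 := ih (σ.erase p) (by rw [Finset.card_erase_of_mem hp, hσ]; rfl) C Z hCZ
      hCs (fun q hq => hZ q (Finset.mem_of_mem_erase hq)) ?_ (fun n => (fin' n).2)
    · refine ((h2.shift e).add h1.neg).congr 0 fun n _ => ?_
      have e1 := len_add (hYK n) (hKZ n)
      have e2 := len_add (hYC (n + e)) (hCZ (n + e))
      have e3 : len (K n) (Z n) = len (Y (n + e)) (C (n + e)) := by
        rw [hCe]; exact len_map x (Z n) (Y (n + e))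
      rw [← e3] at e2
      rw [e1, e2, ENat.toNat_add (fin n).1 (fin n).2, ENat.toNat_add (fin n).2 (fin' _).2]
      push_cast
      ring
    · intro W hW hWs hYW hWZ
      refine hacc W hW (fun t q hq => ?_) (fun t => hYC.trans (hYW t)) hWZ
      by_cases hqp : q = p
      · subst hqp
        intro n
        refine (hWZ t n).trans ?_
        rw [← Submodule.map_le_iff_le_comap]
        refine le_trans ?_ (hYW t (n + e))
        rw [hCe]
        exact le_sup_right
      · exact hWs t q (Finset.mem_erase.2 ⟨hqp, hq⟩)
    · intro W hW hWs hYW hWZ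
      refine hacc W hW (fun t q hq => ?_) hYW (fun t => (hWZ t).trans hKZ)
      by_cases hqp : q = p
      · subst hqp
        intro n
        refine (hWZ t n).trans (inf_le_right.trans (Submodule.comap_mono (hYW t _)))
      · exact hWs t q (Finset.mem_erase.2 ⟨hqp, hq⟩)

end HilbPart

section AccPart
variable {R : Type u} [CommRing R] {E : Type*} [AddCommGroup E] [Module R E] {r : ℕ}

lemma prodPow_add (I : Fin r → Ideal R) (m n : Fin r → ℕ) :
    prodPow I (m + n) = prodPow I m * prodPow I n := by
  simp [prodPow, pow_add, Finset.prod_mul_distrib]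

lemma prodPow_single (I : Fin r → Ideal R) (j : Fin r) (t : ℕ) :
    prodPow I (Pi.single j t) = I j ^ t := by
  rw [prodPow, Finset.prod_eq_single j]
  · simp
  · intro b _ hb; simp [hb]
  · simp

lemma prodPow_zero (I : Fin r → Ideal R) : prodPow I 0 = 1 := by
  simp [prodPow]

/-- generators for the ideals -/
def Gen (I : Fin r → Ideal R) (σ : Finset (R × Fin r)) : Prop :=
  (∀ p ∈ σ, p.1 ∈ I p.2) ∧ ∀ j, I j ≤ Ideal.span {x | (x, j) ∈ σ}

open Classical in
lemma exists_gen [IsNoetherianRing R] (I : Fin r → Ideal R) : ∃ σ, Gen I σ := by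
  choose s hs using fun j => (isNoetherianRing_iff_ideal_fg R).1 inferInstance (I j)
  refine ⟨Finset.univ.biUnion fun j => (s j).image fun x => (x, j), ?_, ?_⟩
  · intro p hp
    simp only [Finset.mem_biUnion, Finset.mem_image] at hp
    obtain ⟨j, -, x, hx, rfl⟩ := hp
    rw [← hs j]
    exact Ideal.subset_span hx
  · intro j
    rw [← hs j]
    refine Ideal.span_mono ?_
    intro x hx
    simpa using hx

open MvPolynomial

/-- the Rees presentation map -/
noncomputable def rhoMap (σ : Finset (R × Fin r)) : MvPolynomial σ R →ₐ[R] MvPolynomial (Fin r) R :=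
  aeval (fun p => C p.1.1 * X p.1.2)

/-- leading ideals of the Rees presentation -/
noncomputable def Jid (σ : Finset (R × Fin r)) (n : Fin r →₀ ℕ) : Ideal R :=
  (Subalgebra.toSubmodule (rhoMap σ).range).comap (monomial n)

lemma mem_Jid {σ : Finset (R × Fin r)} {n : Fin r →₀ ℕ} {a : R} :
    a ∈ Jid σ n ↔ ∃ p, rhoMap σ p = monomial n a := by
  simp [Jid]

lemma Jid_mul (σ : Finset (R × Fin r)) (m n : Fin r →₀ ℕ) : Jid σ m * Jid σ n ≤ Jid σ (m + n) := by
  rw [Ideal.mul_le]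
  intro a ha b hb
  rw [mem_Jid] at *
  obtain ⟨p, hp⟩ := ha
  obtain ⟨q, hq⟩ := hb
  exact ⟨p * q, by rw [map_mul, hp, hq, monomial_mul]⟩

lemma Jid_zero (σ : Finset (R × Fin r)) : Jid σ 0 = ⊤ := by
  rw [eq_top_iff]
  intro a _
  rw [mem_Jid]
  exact ⟨C a, by simp [rhoMap]⟩

lemma le_Jid {I : Fin r → Ideal R} {σ : Finset (R × Fin r)} (h : Gen I σ) (n : Fin r →₀ ℕ) :
    prodPow I n ≤ Jid σ n := by
  have h1 : ∀ j, I j ≤ Jid σ (Finsupp.single j 1) := by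
    intro j
    refine (h.2 j).trans (Ideal.span_le.2 ?_)
    intro x hx
    change x ∈ Jid σ _
    rw [mem_Jid]
    refine ⟨X ⟨(x, j), hx⟩, ?_⟩
    simp [rhoMap, C_mul_X_eq_monomial]
  have h2 : ∀ j t, I j ^ t ≤ Jid σ (Finsupp.single j t) := by
    intro j t
    induction t with
    | zero => simp [Jid_zero]
    | succ t ih =>
      rw [pow_succ, Finsupp.single_add]
      exact (Ideal.mul_mono ih (h1 j)).trans (Jid_mul _ _ _)
  have h3 : ∀ s : Finset (Fin r), ∏ j ∈ s, I j ^ n j ≤ Jid σ (∑ j ∈ s, Finsupp.single j (n j)) := by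
    classical
    intro s
    induction s using Finset.induction_on with
    | empty => simp [Jid_zero]
    | insert j s hj ih =>
      rw [Finset.prod_insert hj, Finset.sum_insert hj]
      exact (Ideal.mul_mono (h2 _ _) ih).trans (Jid_mul _ _ _)
  have := h3 Finset.univ
  rwa [Finsupp.univ_sum_single] at this

/-- the submodule over the big polynomial ring attached to a stable family -/
noncomputable def PhiSub {σ : Finset (R × Fin r)} {q : ℕ} (v : Fin q → E)
    (W : (Fin r → ℕ) → Submodule R E) (hW : Stab σ W) :
    Submodule (MvPolynomial σ R) (Fin q → MvPolynomial σ R) where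
  carrier := {p | ∀ n : Fin r →₀ ℕ, ∑ i, coeff n (rhoMap σ (p i)) • v i ∈ W n}
  zero_mem' := by intro n; simp
  add_mem' := by
    intro p p' hp hp' n
    simp only [Pi.add_apply, map_add, coeff_add, add_smul, Finset.sum_add_distrib]
    exact add_mem (hp n) (hp' n)
  smul_mem' := by
    intro s
    induction s using MvPolynomial.induction_on with
    | C a =>
      intro p hp n
      have : ∀ i, coeff n (rhoMap σ (((C a : MvPolynomial σ R) • p : Fin q → MvPolynomial σ R) i)) • v i = a • (coeff n (rhoMap σ (p i)) • v i) := by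
        intro i
        simp [rhoMap, mul_smul]
      simp only [this, ← Finset.smul_sum]
      exact Submodule.smul_mem _ _ (hp n)
    | add s t hs ht =>
      intro p hp n
      have h1 := hs hp n
      have h2 := ht hp n
      have := add_mem h1 h2
      rw [← Finset.sum_add_distrib] at this
      convert this using 2 with i
      rw [add_smul, Pi.add_apply, map_add, coeff_add, add_smul]
    | mul_X s x hs =>
      intro p hp
      have : (s * X x) • p = s • ((X x : MvPolynomial σ R) • p : Fin q → MvPolynomial σ R) := mul_smul _ _ _
      rw [this]
      refine hs ?_
      intro n
      have e : ∀ i, coeff n (rhoMap σ (((X x : MvPolynomial σ R) • p : Fin q → MvPolynomial σ R) i)) • v i =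
          x.1.1 • ((if x.1.2 ∈ n.support then coeff (n - Finsupp.single x.1.2 1) (rhoMap σ (p i)) else 0) • v i) := by
        intro i
        rw [Pi.smul_apply, smul_eq_mul, map_mul]
        have : rhoMap σ (X x) = C x.1.1 * X x.1.2 := by simp [rhoMap]
        rw [this, mul_assoc, coeff_C_mul, coeff_X_mul', mul_smul]
      simp only [e, ← Finset.smul_sum]
      by_cases hn : x.1.2 ∈ n.support
      · simp only [hn, if_true]
        have h1 := hp (n - Finsupp.single x.1.2 1)
        have h2 := hW x.1 x.2 _ h1
        have h3 : (((n - Finsupp.single x.1.2 1 : Fin r →₀ ℕ) : Fin r → ℕ) + Pi.single x.1.2 1 : Fin r → ℕ) = n := by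
          rw [← Finsupp.single_eq_pi_single, ← Finsupp.coe_add, tsub_add_cancel_of_le]
          rw [Finsupp.single_le_iff]
          rw [Finsupp.mem_support_iff] at hn
          lia
        rw [h3] at h2
        exact h2
      · simp [hn]

lemma mem_PhiSub {σ : Finset (R × Fin r)} {q : ℕ} {v : Fin q → E}
    {W : (Fin r → ℕ) → Submodule R E} {hW : Stab σ W} {p} : p ∈ PhiSub v W hW ↔
    ∀ n : Fin r →₀ ℕ, ∑ i, coeff n (rhoMap σ (p i)) • v i ∈ W n := Iff.rfl

lemma acc_basic [IsNoetherianRing R] {I : Fin r → Ideal R} {σ : Finset (R × Fin r)}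
    (h : Gen I σ) (V : Submodule R E) (hV : V.FG) :
    ACC σ (fun _ => (⊥ : Submodule R E)) (fun n => prodPow I n • V) := by
  classical
  intro W hmono hst _ hle
  obtain ⟨q, v, hv⟩ := Submodule.fg_iff_exists_fin_generating_family.1 hV
  let f : ℕ →o Submodule (MvPolynomial σ R) (Fin q → MvPolynomial σ R) :=
    ⟨fun t => PhiSub v (W t) (hst t), fun s t hst' p hp n => hmono hst' _ (hp n)⟩
  obtain ⟨t₀, ht₀⟩ := monotone_stabilizes_iff_noetherian.2 inferInstance f
  refine ⟨t₀, fun t ht => le_antisymm ?_ (hmono ht)⟩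
  intro n w hw
  let n' : Fin r →₀ ℕ := Finsupp.equivFunOnFinite.symm n
  have hn' : (n' : Fin r → ℕ) = n := rfl
  have h1 : w ∈ prodPow I n • V := hle t n hw
  rw [← hv, Submodule.mem_ideal_smul_span_iff_exists_sum] at h1
  obtain ⟨a, ha, hs⟩ := h1
  choose p hp using fun i => mem_Jid.1 (le_Jid h n' (ha i))
  have h2 : p ∈ f t := by
    rw [show f t = PhiSub v (W t) (hst t) from rfl, mem_PhiSub]
    intro m
    by_cases hm : n' = m
    · subst hm
      simp only [hp, coeff_monomial, if_true]
      rw [Finsupp.sum_fintype _ _ (by simp)] at hs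
      rw [hs]; exact hw
    · simp [hp, coeff_monomial, hm]
  rw [← ht₀ t ht, show f t₀ = PhiSub v (W t₀) (hst t₀) from rfl, mem_PhiSub] at h2
  have h3 := h2 n'
  simp only [hp, coeff_monomial, if_true] at h3
  rw [Finsupp.sum_fintype _ _ (by simp)] at hs
  rw [hs] at h3
  exact h3

lemma prodPow_smul_le {I : Fin r → Ideal R} {W : (Fin r → ℕ) → Submodule R E}
    (hW : ∀ j n, I j • W n ≤ W (n + Pi.single j 1)) (m n : Fin r → ℕ) :
    prodPow I m • W n ≤ W (n + m) := by
  classical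
  have h2 : ∀ j t n, I j ^ t • W n ≤ W (n + Pi.single j t) := by
    intro j t
    induction t with
    | zero => intro n; simp
    | succ t ih =>
      intro n
      rw [pow_succ', Submodule.mul_smul, Pi.single_add, ← add_assoc]
      exact (smul_mono_right _ (ih n)).trans (hW _ _)
  have h3 : ∀ s : Finset (Fin r), ∀ n, (∏ j ∈ s, I j ^ m j) • W n ≤ W (n + ∑ j ∈ s, Pi.single j (m j)) := by
    intro s
    induction s using Finset.induction_on with
    | empty => intro n; simp
    | insert j s hj ih =>
      intro n
      rw [Finset.prod_insert hj, Finset.sum_insert hj, mul_comm, Submodule.mul_smul, ← add_assoc]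
      exact (smul_mono_right _ (h2 _ _ _)).trans (ih _)
  have := h3 Finset.univ n
  rwa [Finset.univ_sum_single] at this

lemma stab_of {I : Fin r → Ideal R} {σ : Finset (R × Fin r)}
    (h : Gen I σ) {W : (Fin r → ℕ) → Submodule R E}
    (hW : ∀ j n, I j • W n ≤ W (n + Pi.single j 1)) : Stab σ W := by
  intro p hp n w hw
  exact hW _ _ (Submodule.smul_mem_smul (h.1 p hp) hw)

theorem artin_rees [IsNoetherianRing R] (I : Fin r → Ideal R) (V : Submodule R E) (hV : V.FG)
    (W : (Fin r → ℕ) → Submodule R E) (hWV : ∀ n, W n ≤ prodPow I n • V)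
    (hW : ∀ j n, I j • W n ≤ W (n + Pi.single j 1)) :
    ∃ c, ∀ n, W (n + c) = prodPow I n • W c := by
  obtain ⟨σ, hσ⟩ := exists_gen I
  let G : ℕ → (Fin r → ℕ) → Submodule R E := fun t n =>
    ⨆ m : Fin r → ℕ, ⨆ _ : m ≤ n ∧ ∀ j, m j ≤ t, prodPow I (n - m) • W m
  have hGW : ∀ t n, G t n ≤ W n := by
    intro t n
    refine iSup_le fun m => iSup_le fun hm => ?_
    have := prodPow_smul_le hW (n - m) m
    rwa [add_tsub_cancel_of_le hm.1] at this
  have key0 : ∃ t₀, ∀ t, t₀ ≤ t → G t = G t₀ := by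
    refine acc_basic hσ V hV G ?_ ?_ (fun t n => bot_le) (fun t n => (hGW t n).trans (hWV n))
    · intro s t hst n
      refine iSup_le fun m => iSup_le fun hm => ?_
      exact le_iSup_of_le m (le_iSup_of_le ⟨hm.1, fun j => (hm.2 j).trans hst⟩ le_rfl)
    · intro t
      refine stab_of hσ fun j n => ?_
      simp only [G, Submodule.smul_iSup]
      refine iSup_le fun m => iSup_le fun hm => ?_
      refine le_iSup_of_le m (le_iSup_of_le ⟨hm.1.trans (le_add_of_nonneg_right zero_le), hm.2⟩ ?_)
      rw [← Submodule.mul_smul]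
      refine Submodule.smul_mono_left ?_
      have : n + Pi.single j 1 - m = Pi.single j 1 + (n - m) := by
        rw [add_comm, add_tsub_assoc_of_le hm.1]
      rw [this, prodPow_add, prodPow_single, pow_one]
  obtain ⟨t₀, ht₀⟩ := key0
  have key : ∀ n, W n = G t₀ n := by
    intro n
    refine le_antisymm ?_ (hGW _ _)
    rw [← ht₀ (t₀ + ∑ j, n j) (Nat.le_add_right _ _)]
    refine le_iSup_of_le n (le_iSup_of_le ⟨le_rfl, fun j => ?_⟩ ?_)
    · exact (Finset.single_le_sum (fun _ _ => Nat.zero_le _) (Finset.mem_univ j)).trans (Nat.le_add_left _ _)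
    · simp [prodPow_zero]
  refine ⟨fun _ => t₀, fun n => le_antisymm ?_ ?_⟩
  · rw [key]
    refine iSup_le fun m => iSup_le fun hm => ?_
    have hm' : m ≤ fun _ => t₀ := hm.2
    rw [add_tsub_assoc_of_le hm', prodPow_add, Submodule.mul_smul]
    refine smul_mono_right _ ?_
    have := prodPow_smul_le hW ((fun _ => t₀) - m) m
    rwa [add_tsub_cancel_of_le hm'] at this
  · have := prodPow_smul_le hW n (fun _ => t₀)
    rwa [add_comm] at this
end AccPart

section GoodPart
variable {R : Type u} [CommRing R] {E : Type*} [AddCommGroup E] [Module R E] {r : ℕ}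

/-- families eventually of the form `A + I^n V` -/
def Good (I : Fin r → Ideal R) (Z : (Fin r → ℕ) → Submodule R E) : Prop :=
  ∃ (c : Fin r → ℕ) (A V : Submodule R E), ∀ n, Z (n + c) = A ⊔ prodPow I n • V

lemma Good.const (I : Fin r → Ideal R) (A : Submodule R E) : Good I (fun _ => A) :=
  ⟨0, A, ⊥, fun n => by simp⟩

lemma Good.basic (I : Fin r → Ideal R) (V : Submodule R E) : Good I (fun n => prodPow I n • V) :=
  ⟨0, ⊥, V, fun n => by simp⟩

lemma good_shift {I : Fin r → Ideal R} {Z : (Fin r → ℕ) → Submodule R E} {c A V}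
    (h : ∀ n, Z (n + c) = A ⊔ prodPow I n • V) (d : Fin r → ℕ) :
    ∀ n, Z (n + (d + c)) = A ⊔ prodPow I n • (prodPow I d • V) := by
  intro n
  rw [← add_assoc, h, prodPow_add, Submodule.mul_smul]

lemma Good.common {E' : Type*} [AddCommGroup E'] [Module R E']
    {I : Fin r → Ideal R} {Z : (Fin r → ℕ) → Submodule R E} {Y : (Fin r → ℕ) → Submodule R E'}
    (hZ : Good I Z) (hY : Good I Y) : ∃ c A V A' V', (∀ n, Z (n + c) = A ⊔ prodPow I n • V) ∧
      (∀ n, Y (n + c) = A' ⊔ prodPow I n • V') := by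
  obtain ⟨c, A, V, h⟩ := hZ
  obtain ⟨c', A', V', h'⟩ := hY
  refine ⟨c' + c, A, prodPow I c' • V, A', prodPow I c • V', good_shift h c', ?_⟩
  rw [add_comm]
  exact good_shift h' c

lemma Good.sup {I : Fin r → Ideal R} {Z Y : (Fin r → ℕ) → Submodule R E}
    (hZ : Good I Z) (hY : Good I Y) : Good I (fun n => Z n ⊔ Y n) := by
  obtain ⟨c, A, V, A', V', h, h'⟩ := hZ.common hY
  refine ⟨c, A ⊔ A', V ⊔ V', fun n => ?_⟩
  simp only []
  rw [h, h', Submodule.smul_sup, sup_sup_sup_comm]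

lemma Good.map {E' : Type*} [AddCommGroup E'] [Module R E']
    {I : Fin r → Ideal R} {Z : (Fin r → ℕ) → Submodule R E} (hZ : Good I Z) (φ : E →ₗ[R] E') :
    Good I (fun n => (Z n).map φ) := by
  obtain ⟨c, A, V, h⟩ := hZ
  refine ⟨c, A.map φ, V.map φ, fun n => ?_⟩
  simp only []
  rw [h, Submodule.map_sup, Submodule.map_smul'']

lemma Good.comap [IsNoetherianRing R] [IsNoetherian R E] {E' : Type*} [AddCommGroup E'] [Module R E']
    {I : Fin r → Ideal R} {Z : (Fin r → ℕ) → Submodule R E} (hZ : Good I Z) (φ : E' →ₗ[R] E) :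
    Good I (fun n => (Z n).comap φ) := by
  obtain ⟨c, A, V, h⟩ := hZ
  obtain ⟨d, hd⟩ := artin_rees I V (IsNoetherian.noetherian V)
    (fun n => prodPow I n • V ⊓ (A ⊔ LinearMap.range φ)) (fun n => inf_le_left) (by
      intro j n
      refine le_inf ((smul_mono_right _ inf_le_left).trans ?_) ((smul_mono_right _ inf_le_right).trans ?_)
      · rw [← Submodule.mul_smul, prodPow_add, prodPow_single, pow_one, mul_comm]
      · exact Submodule.smul_le_right)
  refine ⟨d + c, A.comap φ, (A ⊔ prodPow I d • V).comap φ, fun n => ?_⟩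
  simp only []
  rw [← add_assoc, h]
  apply le_antisymm
  · intro x hx
    obtain ⟨a, ha, w, hw, e⟩ := Submodule.mem_sup.1 (Submodule.mem_comap.1 hx)
    have hw2 : w ∈ A ⊔ LinearMap.range φ := by
      have : w = - a + φ x := by rw [← e]; abel
      rw [this]
      exact Submodule.add_mem_sup (neg_mem ha) ⟨x, rfl⟩
    have hw3 : w ∈ prodPow I n • (prodPow I d • V ⊓ (A ⊔ LinearMap.range φ)) := by
      rw [← hd n]; exact ⟨hw, hw2⟩
    have h4 : prodPow I d • V ⊓ (A ⊔ LinearMap.range φ) ≤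
        A ⊔ ((A ⊔ prodPow I d • V).comap φ).map φ := by
      rintro y ⟨hy1, hy2⟩
      obtain ⟨b, hb, _, ⟨z, rfl⟩, rfl⟩ := Submodule.mem_sup.1 hy2
      refine Submodule.add_mem_sup hb ⟨z, ?_, rfl⟩
      have : φ z = - b + (b + φ z) := by abel
      change φ z ∈ A ⊔ prodPow I d • V
      rw [this]
      exact Submodule.add_mem_sup (neg_mem hb) hy1
    have h5 := smul_mono_right (prodPow I n) h4 hw3
    rw [Submodule.smul_sup, ← Submodule.map_smul''] at h5
    obtain ⟨b, hb, _, ⟨u, hu, rfl⟩, rfl⟩ := Submodule.mem_sup.1 h5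
    have : x = (x - u) + u := by abel
    rw [this]
    refine Submodule.add_mem_sup ?_ hu
    rw [Submodule.mem_comap, map_sub, ← e]
    have : a + (b + φ u) - φ u = a + b := by abel
    rw [this]
    exact add_mem ha (Submodule.smul_le_right hb)
  · refine sup_le (Submodule.comap_mono le_sup_left) ?_
    rw [← Submodule.map_le_iff_le_comap, Submodule.map_smul'']
    refine (smul_mono_right _ (Submodule.map_comap_le _ _)).trans ?_
    rw [Submodule.smul_sup, ← Submodule.mul_smul, prodPow_add]
    exact sup_le_sup_right Submodule.smul_le_right _

lemma Good.inf [IsNoetherianRing R] [IsNoetherian R E] {I : Fin r → Ideal R}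
    {Z Y : (Fin r → ℕ) → Submodule R E}
    (hZ : Good I Z) (hY : Good I Y) : Good I (fun n => Z n ⊓ Y n) := by
  have h := ((hZ.map (LinearMap.inl R E E)).sup (hY.map (LinearMap.inr R E E))).comap
    (LinearMap.prod LinearMap.id LinearMap.id)
  have e : (fun n => Z n ⊓ Y n) = (fun n => Submodule.comap
    (LinearMap.prod LinearMap.id LinearMap.id) ((Z n).map (LinearMap.inl R E E) ⊔ (Y n).map (LinearMap.inr R E E))) := by
    ext n x
    rw [Submodule.map_inl, Submodule.map_inr, Submodule.prod_sup_prod]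
    simp
  rw [e]
  exact h

lemma Good.iInf [IsNoetherianRing R] [IsNoetherian R E] {I : Fin r → Ideal R} {ι : Type*} [Finite ι]
    {Z : ι → (Fin r → ℕ) → Submodule R E} (hZ : ∀ j, Good I (Z j)) : Good I (fun n => ⨅ j, Z j n) := by
  classical
  cases nonempty_fintype ι
  have : ∀ s : Finset ι, Good I (fun n => ⨅ j ∈ s, Z j n) := by
    intro s
    induction s using Finset.induction_on with
    | empty => simpa using Good.const I ⊤
    | insert j s hj ih =>
      simp only [Finset.iInf_insert]
      exact (hZ j).inf ih
  simpa using this Finset.univ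

/-- tuples in a submodule -/
def powS (b : ℕ) (B : Submodule R E) : Submodule R (Fin b → E) := ⨅ j, B.comap (LinearMap.proj j)

lemma mem_powS {b : ℕ} {B : Submodule R E} {x} : x ∈ powS b B ↔ ∀ j, x j ∈ B := by
  simp [powS]

lemma Good.powS [IsNoetherianRing R] [IsNoetherian R E] {I : Fin r → Ideal R}
    {Z : (Fin r → ℕ) → Submodule R E} (hZ : Good I Z) (b : ℕ) : Good I (fun n => powS b (Z n)) :=
  Good.iInf (fun j => hZ.comap (E' := Fin b → E) (LinearMap.proj (R := R) (φ := fun _ : Fin b => E) j))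

lemma len_ne_top [IsLocalRing R] [IsNoetherian R E] {Y Z : Submodule R E}
    (h : IsLocalRing.maximalIdeal R • Z ≤ Y) : len Y Z ≠ ⊤ := by
  rw [len]
  have htor : Module.IsTorsionBySet R (Z ⧸ Y.comap Z.subtype) (IsLocalRing.maximalIdeal R) := by
    rintro x ⟨a, ha⟩
    induction x using Submodule.Quotient.induction_on with | _ x =>
    change a • _ = _
    rw [← Submodule.Quotient.mk_smul, Submodule.Quotient.mk_eq_zero]
    exact h (Submodule.smul_mem_smul ha x.2)
  let : Field (R ⧸ IsLocalRing.maximalIdeal R) := Ideal.Quotient.field _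
  let := htor.module
  have : IsScalarTower R (R ⧸ IsLocalRing.maximalIdeal R) (Z ⧸ Y.comap Z.subtype) := htor.isScalarTower
  have : Module.Finite (R ⧸ IsLocalRing.maximalIdeal R) (Z ⧸ Y.comap Z.subtype) :=
    Module.Finite.of_restrictScalars_finite R _ _
  rw [Module.length_eq_of_surjective (S := R) (R := R ⧸ IsLocalRing.maximalIdeal R)
    Ideal.Quotient.mk_surjective]
  exact Module.length_ne_top

theorem count_core [IsNoetherianRing R] [IsLocalRing R] [IsNoetherian R E] (I : Fin r → Ideal R)
    (A A' V V' : Submodule R E) (hA : A' ≤ A) (hV : V' ≤ V)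
    (hm : ∀ n, IsLocalRing.maximalIdeal R • (A ⊔ prodPow I n • V) ≤ A' ⊔ prodPow I n • V') :
    EvPoly (fun n => ((len (A' ⊔ prodPow I n • V') (A ⊔ prodPow I n • V)).toNat : ℚ)) := by
  by_cases hI : ∀ j, I j = ⊤
  · have : ∀ n, prodPow I n = ⊤ := by
      intro n; simp [prodPow, hI, ← Ideal.one_eq_top]
    simp only [this]
    exact EvPoly.const _
  push Not at hI
  obtain ⟨j, hj⟩ := hI
  have hj := IsLocalRing.le_maximalIdeal hj
  obtain ⟨d, hd⟩ := artin_rees I V (IsNoetherian.noetherian V)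
    (fun n => prodPow I n • V ⊓ A) (fun n => inf_le_left) (by
      intro j n
      refine le_inf ((smul_mono_right _ inf_le_left).trans ?_) ((smul_mono_right _ inf_le_right).trans ?_)
      · rw [← Submodule.mul_smul, prodPow_add, prodPow_single, pow_one, mul_comm]
      · exact Submodule.smul_le_right)
  have h1 : ∀ n, Pi.single j 1 + d ≤ n → A ⊓ prodPow I n • V ≤ IsLocalRing.maximalIdeal R • A := by
    intro n hn
    obtain ⟨m, rfl⟩ := exists_add_of_le hn
    have : Pi.single j 1 + d + m = (m + Pi.single j 1) + d := by
      rw [add_comm _ m, add_assoc]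
    rw [inf_comm, this, hd, prodPow_add, prodPow_single, pow_one]
    exact Submodule.smul_mono (Ideal.mul_le_right.trans hj) inf_le_right
  have h2 : ∀ n, Pi.single j 1 + d ≤ n → len (A' ⊔ prodPow I n • V) (A ⊔ prodPow I n • V) =
      len (A' ⊔ IsLocalRing.maximalIdeal R • A) A := by
    intro n hn
    have e1 : A ⊔ prodPow I n • V = (A' ⊔ prodPow I n • V) ⊔ A := by
      rw [sup_right_comm, sup_eq_right.2 hA]
    have e2 : A ⊓ (A' ⊔ prodPow I n • V) = A' ⊔ IsLocalRing.maximalIdeal R • A := by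
      apply le_antisymm
      · rw [inf_comm, sup_inf_assoc_of_le _ hA, inf_comm]
        exact sup_le_sup_left (h1 n hn) _
      · refine sup_le (le_inf hA le_sup_left) (le_inf Submodule.smul_le_right ?_)
        refine (smul_mono_right _ le_sup_left).trans ((hm n).trans ?_)
        exact sup_le_sup_left (smul_mono_right _ hV) _
    rw [e1, ← len_inf, e2]
  have hfin : ∀ n, len (prodPow I n • V ⊓ (A' ⊔ prodPow I n • V')) (prodPow I n • V) ≠ ⊤ := by
    intro n
    apply len_ne_top
    refine le_inf Submodule.smul_le_right ((smul_mono_right _ le_sup_right).trans (hm n))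
  have hst : ∀ (B : Submodule R E) j n, I j • (prodPow I n • B) ≤ prodPow I (n + Pi.single j 1) • B := by
    intro B j n
    rw [← Submodule.mul_smul, prodPow_add, prodPow_single, pow_one, mul_comm]
  have h3 : EvPoly (fun n => ((len (A' ⊔ prodPow I n • V') (A' ⊔ prodPow I n • V)).toNat : ℚ)) := by
    obtain ⟨σ, hσ⟩ := exists_gen I
    have := hilbert_poly σ.card σ rfl (fun n => prodPow I n • V ⊓ (A' ⊔ prodPow I n • V'))
      (fun n => prodPow I n • V) (fun n => inf_le_left) (stab_of hσ ?_) (stab_of hσ (hst V)) ?_ hfin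
    · refine this.congr 0 fun n _ => ?_
      rw [len_inf, sup_assoc, sup_eq_right.2 (smul_mono_right _ hV)]
    · intro j n
      refine le_inf ((smul_mono_right _ inf_le_left).trans (hst _ _ _))
        ((smul_mono_right _ inf_le_right).trans ?_)
      rw [Submodule.smul_sup]
      exact sup_le_sup Submodule.smul_le_right (hst _ _ _)
    · intro W h1 h2 _ h4
      exact acc_basic hσ V (IsNoetherian.noetherian V) W h1 h2 (fun _ _ => bot_le) h4
  refine (h3.add (EvPoly.const ((len (A' ⊔ IsLocalRing.maximalIdeal R • A) A).toNat : ℚ))).congr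
    (Pi.single j 1 + d) fun n hn => ?_
  have a1 : A' ⊔ prodPow I n • V' ≤ A' ⊔ prodPow I n • V := sup_le_sup_left (smul_mono_right _ hV) _
  have a2 : A' ⊔ prodPow I n • V ≤ A ⊔ prodPow I n • V := sup_le_sup_right hA _
  rw [len_add a1 a2, ENat.toNat_add, h2 n hn]
  · push_cast; rfl
  · exact len_ne_top ((smul_mono_right _ a2).trans (hm n))
  · exact len_ne_top ((hm n).trans a1)

theorem count [IsNoetherianRing R] [IsLocalRing R] [IsNoetherian R E] {I : Fin r → Ideal R}
    {Y Z : (Fin r → ℕ) → Submodule R E} (hY : Good I Y) (hZ : Good I Z) (hYZ : ∀ n, Y n ≤ Z n)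
    (hm : ∀ n, IsLocalRing.maximalIdeal R • Z n ≤ Y n) :
    EvPoly (fun n => ((len (Y n) (Z n)).toNat : ℚ)) := by
  obtain ⟨c, A, V, A', V', h, h'⟩ := hZ.common hY
  apply EvPoly.of_shift c
  have e : ∀ n, Z (n + c) = (A ⊔ A') ⊔ prodPow I n • (V ⊔ V') := by
    intro n
    rw [Submodule.smul_sup, sup_sup_sup_comm, ← h, ← h', sup_eq_left.2 (hYZ _)]
  have := count_core I (A ⊔ A') A' (V ⊔ V') V' le_sup_right le_sup_right (by
    intro n; rw [← e, ← h']; exact hm _)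
  refine this.congr 0 fun n _ => ?_
  rw [e, h']
end GoodPart

section FinalPart
open CategoryTheory
variable {R : Type u} [CommRing R]

lemma hom_lift {K X : Type*} [AddCommGroup K] [Module R K] [AddCommGroup X] [Module R X]
    {p a : ℕ} {z : Fin p → K} (hz : Submodule.span R (Set.range z) = ⊤) {A : Fin p → Fin a → R}
    (hA : ∀ w : Fin p → R, ∑ j, w j • z j = 0 → ∃ v : Fin a → R, ∀ j, w j = ∑ k, A j k * v k)
    (x : Fin p → X) (hx : ∀ k, ∑ j, A j k • x j = 0) : ∃ g : K →ₗ[R] X, ∀ j, g (z j) = x j := by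
  let s := Fintype.linearCombination R z
  have hs : Function.Surjective s := by
    rw [← LinearMap.range_eq_top, Fintype.range_linearCombination, hz]
  have hk : LinearMap.ker s ≤ LinearMap.ker (Fintype.linearCombination R x) := by
    intro w hw
    rw [LinearMap.mem_ker, Fintype.linearCombination_apply] at hw ⊢
    obtain ⟨v, hv⟩ := hA w hw
    simp only [hv, Finset.sum_smul]
    rw [Finset.sum_comm]
    refine Finset.sum_eq_zero fun k _ => ?_
    have : ∀ j, (A j k * v k) • x j = v k • (A j k • x j) := by
      intro j; rw [smul_smul, mul_comm]
    simp only [this, ← Finset.smul_sum, hx, smul_zero]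
  refine ⟨(LinearMap.ker s).liftQ _ hk ∘ₗ (LinearMap.quotKerEquivOfSurjective s hs).symm.toLinearMap, ?_⟩
  intro j
  have h1 : s (Pi.single j 1) = z j := by
    simp [s, Fintype.linearCombination_apply_single]
  have h2 : (LinearMap.quotKerEquivOfSurjective s hs).symm (z j) =
      Submodule.Quotient.mk (Pi.single j 1) := by
    rw [LinearEquiv.symm_apply_eq, ← h1]
    rfl
  simp only [LinearMap.comp_apply, LinearEquiv.coe_coe, h2]
  rw [Submodule.liftQ_apply]
  simp [Fintype.linearCombination_apply_single]

/-- tuples satisfying relations modulo `N` -/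
def relS {M : Type*} [AddCommGroup M] [Module R M] {p a : ℕ} (A : Fin p → Fin a → R)
    (N : Submodule R M) : Submodule R (Fin p → M) :=
  (powS a N).comap (matX M (fun k j => A j k))

lemma mem_relS {M K : Type*} [AddCommGroup M] [Module R M] [AddCommGroup K] [Module R K] {p a : ℕ}
    {z : Fin p → K} (hz : Submodule.span R (Set.range z) = ⊤) {A : Fin p → Fin a → R}
    (hA0 : ∀ k, ∑ j, A j k • z j = 0)
    (hA : ∀ w : Fin p → R, ∑ j, w j • z j = 0 → ∃ v : Fin a → R, ∀ j, w j = ∑ k, A j k * v k)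
    (N : Submodule R M) (x : Fin p → M) :
    x ∈ relS A N ↔ ∃ g : K →ₗ[R] M ⧸ N, ∀ j, g (z j) = N.mkQ (x j) := by
  have h0 : x ∈ relS A N ↔ ∀ k, ∑ j, A j k • N.mkQ (x j) = 0 := by
    rw [relS, Submodule.mem_comap, mem_powS]
    refine forall_congr' fun k => ?_
    rw [matX_apply, ← Submodule.Quotient.mk_eq_zero, ← Submodule.mkQ_apply, map_sum]
    simp only [map_smul]
  rw [h0]
  constructor
  · exact hom_lift hz hA _
  · rintro ⟨g, hg⟩ k
    simp only [← hg, ← map_smul, ← map_sum, hA0, map_zero]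

/-- the boundary submodule -/
def bdS {M : Type*} [AddCommGroup M] [Module R M] {p q a : ℕ} (F : Fin p → Fin q → R)
    (A : Fin q → Fin a → R) (N : Submodule R M) : Submodule R (Fin p → M) :=
  (relS A N).map (matX M F) ⊔ powS p N

lemma mem_bdS {M K L : Type*} [AddCommGroup M] [Module R M] [AddCommGroup K] [Module R K]
    [AddCommGroup L] [Module R L] (f : K →ₗ[R] L) {p q a : ℕ}
    (z : Fin p → K)
    {y : Fin q → L} (hy : Submodule.span R (Set.range y) = ⊤) {A : Fin q → Fin a → R}
    (hA0 : ∀ k, ∑ j, A j k • y j = 0)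
    (hA : ∀ w : Fin q → R, ∑ j, w j • y j = 0 → ∃ v : Fin a → R, ∀ j, w j = ∑ k, A j k * v k)
    {F : Fin p → Fin q → R} (hF : ∀ j, f (z j) = ∑ l, F j l • y l)
    (N : Submodule R M) (x : Fin p → M) :
    x ∈ bdS F A N ↔ ∃ h : L →ₗ[R] M ⧸ N, ∀ j, h (f (z j)) = N.mkQ (x j) := by
  have key : ∀ (t : Fin q → M) (h : L →ₗ[R] M ⧸ N), (∀ l, h (y l) = N.mkQ (t l)) →
      ∀ j, h (f (z j)) = N.mkQ (matX M F t j) := by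
    intro t h ht j
    rw [hF, matX_apply, map_sum, map_sum]
    simp only [map_smul, ht]
  constructor
  · intro hx
    obtain ⟨_, ⟨t, ht, rfl⟩, w, hw, rfl⟩ := Submodule.mem_sup.1 hx
    obtain ⟨h, hh⟩ := (mem_relS hy hA0 hA N t).1 ht
    refine ⟨h, fun j => ?_⟩
    rw [key t h hh j, Pi.add_apply, map_add]
    have : N.mkQ (w j) = 0 := by
      rw [Submodule.mkQ_apply, Submodule.Quotient.mk_eq_zero]; exact mem_powS.1 hw j
    rw [this, add_zero]
  · rintro ⟨h, hh⟩
    choose t ht using fun l => N.mkQ_surjective (h (y l))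
    have h1 : t ∈ relS A N := (mem_relS hy hA0 hA N t).2 ⟨h, fun l => (ht l).symm⟩
    have : x = matX M F t + (x - matX M F t) := by abel
    rw [this]
    refine Submodule.add_mem_sup ⟨t, h1, rfl⟩ (mem_powS.2 fun j => ?_)
    rw [← Submodule.Quotient.mk_eq_zero, ← Submodule.mkQ_apply, Pi.sub_apply, map_sub, ← hh,
      key t h (fun l => (ht l).symm), sub_self]

/-- the subquotient relation -/
def SubQ {E : Type*} [AddCommGroup E] [Module R E] (B B' : Submodule R E) (T : Type*)
    [AddCommGroup T] [Module R T] : Prop :=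
  B' ≤ B ∧ ∃ π : B →ₗ[R] T, Function.Surjective π ∧ LinearMap.ker π = B'.comap B.subtype

lemma coherent_pres [IsNoetherianRing R] {K L : Type u} [AddCommGroup K] [Module R K]
    [Module.Finite R K] [AddCommGroup L] [Module R L] [Module.Finite R L] (f : K →ₗ[R] L) :
    ∃ (p a q a' : ℕ) (A : Fin p → Fin a → R) (A' : Fin q → Fin a' → R) (F : Fin p → Fin q → R),
    ∀ (M : Type u) [AddCommGroup M] [Module R M] (N : Submodule R M),
      SubQ (relS A N) (bdS F A' N) (coherentApply f (M ⧸ N)) := by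
  obtain ⟨p, z, hz⟩ := exists_gens (R := R) K
  obtain ⟨q, y, hy⟩ := exists_gens (R := R) L
  obtain ⟨a, A, hA0, hA⟩ := gens_rels (R := R) z
  obtain ⟨a', A', hA0', hA'⟩ := gens_rels (R := R) y
  have : ∀ j, ∃ F : Fin q → R, f (z j) = ∑ l, F l • y l := by
    intro j
    have : f (z j) ∈ Submodule.span R (Set.range y) := by rw [hy]; trivial
    obtain ⟨c, hc⟩ := (Submodule.mem_span_range_iff_exists_fun R).1 this
    exact ⟨c, hc.symm⟩
  choose F hF using this
  refine ⟨p, a, q, a', A, A', F, fun M _ _ N => ⟨?_, ?_⟩⟩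
  · intro x hx
    obtain ⟨h, hh⟩ := (mem_bdS f z hy hA0' hA' hF N x).1 hx
    exact (mem_relS hz hA0 hA N x).2 ⟨h ∘ₗ f, hh⟩
  let ev : (K →ₗ[R] M ⧸ N) →ₗ[R] (Fin p → M ⧸ N) := LinearMap.pi fun j => LinearMap.applyₗ (z j)
  have hev : ∀ g j, ev g j = g (z j) := fun g j => rfl
  have inj : Function.Injective ev := by
    intro g g' h
    refine LinearMap.ext_on hz ?_
    rintro _ ⟨j, rfl⟩
    exact congrFun h j
  let mk : (Fin p → M) →ₗ[R] (Fin p → M ⧸ N) := LinearMap.pi fun j => N.mkQ ∘ₗ LinearMap.proj j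
  have hmk : ∀ x j, mk x j = N.mkQ (x j) := fun x j => rfl
  let m : relS A N →ₗ[R] LinearMap.range ev :=
    LinearMap.codRestrict _ (mk ∘ₗ (relS A N).subtype) (by
      intro x
      obtain ⟨g, hg⟩ := (mem_relS hz hA0 hA N x).1 x.2
      exact ⟨g, funext hg⟩)
  let π0 : relS A N →ₗ[R] (K →ₗ[R] M ⧸ N) := (LinearEquiv.ofInjective ev inj).symm.toLinearMap ∘ₗ m
  have hπ0 : ∀ x j, π0 x (z j) = N.mkQ (x.1 j) := by
    intro x j
    have : LinearEquiv.ofInjective ev inj (π0 x) = m x := by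
      simp [π0]
    have h2 := congrFun (congrArg Subtype.val this) j
    exact h2
  refine ⟨(LinearMap.range (LinearMap.lcomp R (M ⧸ N) f)).mkQ ∘ₗ π0, ?_, ?_⟩
  · refine (Submodule.mkQ_surjective _).comp ?_
    intro g
    choose x hx using fun j => N.mkQ_surjective (g (z j))
    refine ⟨⟨x, (mem_relS hz hA0 hA N x).2 ⟨g, fun j => (hx j).symm⟩⟩, ?_⟩
    refine LinearMap.ext_on hz ?_
    rintro _ ⟨j, rfl⟩
    rw [hπ0, hx]
  · ext x
    rw [LinearMap.ker_comp, Submodule.ker_mkQ, Submodule.mem_comap, Submodule.mem_comap,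
      Submodule.subtype_apply, mem_bdS f z hy hA0' hA' hF N x.1]
    constructor
    · rintro ⟨h, hh⟩
      refine ⟨h, fun j => ?_⟩
      rw [← hπ0, ← hh]
      rfl
    · rintro ⟨h, hh⟩
      refine ⟨h, ?_⟩
      refine LinearMap.ext_on hz ?_
      rintro _ ⟨j, rfl⟩
      rw [hπ0, ← hh]
      rfl

lemma matX_powS {E : Type*} [AddCommGroup E] [Module R E] {a b : ℕ} (A : Fin b → Fin a → R)
    {B : Submodule R E} {x : Fin a → E} (hx : x ∈ powS a B) : matX E A x ∈ powS b B := by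
  rw [mem_powS] at *
  intro i
  rw [matX_apply]
  exact Submodule.sum_mem _ fun j _ => Submodule.smul_mem _ _ (hx j)

lemma subq_tor {E T T'' : Type*} [AddCommGroup E] [Module R E] [AddCommGroup T] [Module R T]
    [AddCommGroup T''] [Module R T''] {B B' : Submodule R E} (h : SubQ B B' T)
    {a b c : ℕ} {A : Fin b → Fin a → R} {D : Fin c → Fin b → R} (hT : IsMatHom T A D T'') :
    SubQ (powS b B ⊓ (powS c B').comap (matX E D)) ((powS a B).map (matX E A) ⊔ powS b B') T'' := by
  obtain ⟨hB, π, hπ, hk⟩ := h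
  obtain ⟨hAD, θ, hθ, hkθ⟩ := hT
  let P : ∀ d, powS d B →ₗ[R] (Fin d → T) := fun d => LinearMap.pi fun j =>
    π ∘ₗ LinearMap.codRestrict B (LinearMap.proj j ∘ₗ (powS d B).subtype) (fun x => mem_powS.1 x.2 j)
  have hP : ∀ d (x : powS d B) j, P d x j = π ⟨x.1 j, mem_powS.1 x.2 j⟩ := fun d x j => rfl
  have hPs : ∀ d, Function.Surjective (P d) := by
    intro d t
    choose x hx using fun j => hπ (t j)
    refine ⟨⟨fun j => (x j).1, mem_powS.2 fun j => (x j).2⟩, ?_⟩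
    ext j
    exact hx j
  have hP0 : ∀ d (x : powS d B), P d x = 0 ↔ x.1 ∈ powS d B' := by
    intro d x
    rw [mem_powS, funext_iff]
    refine forall_congr' fun j => ?_
    rw [hP, Pi.zero_apply, ← LinearMap.mem_ker, hk]
    rfl
  have hPm : ∀ {d e : ℕ} (C : Fin e → Fin d → R) (x : powS d B),
      P e ⟨matX E C x.1, matX_powS C x.2⟩ = matX T C (P d x) := by
    intro d e C x
    ext i
    rw [hP, matX_apply]
    simp only [hP, ← map_smul, ← map_sum]
    congr 1
    apply Subtype.ext
    simp [matX_apply]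
  constructor
  · refine sup_le ?_ ?_
    · rintro _ ⟨x, hx, rfl⟩
      refine ⟨matX_powS A hx, ?_⟩
      have h1 := hPm D ⟨matX E A x, matX_powS A hx⟩
      rw [hPm A ⟨x, hx⟩, hAD ⟨_, rfl⟩] at h1
      exact (hP0 _ _).1 h1
    · intro x hx
      refine ⟨mem_powS.2 fun j => hB (mem_powS.1 hx j), matX_powS D hx⟩
  · have memk : ∀ (x : powS b B), P b x ∈ LinearMap.ker (matX T D) ↔ matX E D x.1 ∈ powS c B' := by
      intro x
      rw [LinearMap.mem_ker, ← hPm, hP0]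
    let Q : (powS b B ⊓ (powS c B').comap (matX E D) : Submodule R (Fin b → E)) →ₗ[R]
        LinearMap.ker (matX T D) :=
      LinearMap.codRestrict _ (P b ∘ₗ Submodule.inclusion inf_le_left) (fun x => (memk _).2 x.2.2)
    have hQ : ∀ x, (Q x).1 = P b ⟨x.1, x.2.1⟩ := fun x => rfl
    refine ⟨θ ∘ₗ Q, hθ.comp ?_, ?_⟩
    · rintro ⟨t, ht⟩
      obtain ⟨x, rfl⟩ := hPs b t
      exact ⟨⟨x.1, x.2, (memk x).1 ht⟩, rfl⟩
    · ext x
      rw [LinearMap.ker_comp, hkθ]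
      simp only [Submodule.mem_comap, Submodule.subtype_apply, hQ]
      constructor
      · rintro ⟨s, hs⟩
        obtain ⟨w, rfl⟩ := hPs a s
        rw [← hPm, ← sub_eq_zero, ← map_sub, hP0] at hs
        have : x.1 = matX E A w.1 + - (matX E A w.1 - x.1) := by abel
        rw [this]
        exact Submodule.add_mem_sup ⟨w.1, w.2, rfl⟩ (neg_mem hs)
      · intro hx
        obtain ⟨_, ⟨w, hw, rfl⟩, v, hv, e⟩ := Submodule.mem_sup.1 hx
        refine ⟨P a ⟨w, hw⟩, ?_⟩
        rw [← hPm, ← sub_eq_zero, ← map_sub, hP0]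
        change matX E A w - x.1 ∈ _
        rw [← e]
        simpa using hv

theorem main_aux [IsNoetherianRing R] [IsLocalRing R]
    {r : ℕ} (I : Fin r → Ideal R)
    (M : Type u) [AddCommGroup M] [Module R M] [Module.Finite R M]
    (N : Submodule R M)
    {K L : Type u} [AddCommGroup K] [Module R K] [Module.Finite R K]
    [AddCommGroup L] [Module R L] [Module.Finite R L]
    (f : K →ₗ[R] L) (i : ℕ) :
    ∃ (c : Fin r → ℕ) (P : MvPolynomial (Fin r) ℚ), ∀ n : Fin r → ℕ, c ≤ n →
      ∃ m : ℕ,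
        bettiNumber R i (coherentApply f (M ⧸ (prodPow I n • N : Submodule R M))) = m ∧
        (m : ℚ) = MvPolynomial.eval (fun i => (n i : ℚ)) P := by
  obtain ⟨p, a, q, a', A, A', F, h1⟩ := coherent_pres f
  obtain ⟨s, b, c, S, D, h2⟩ := tor_pres (R := R) i (IsLocalRing.ResidueField R)
  have h3 := fun n => subq_tor (h1 M (prodPow I n • N : Submodule R M))
    (h2 (coherentApply f (M ⧸ (prodPow I n • N : Submodule R M))))
  have gN := Good.basic I N
  have gB : Good I (fun n => relS A (prodPow I n • N : Submodule R M)) :=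
    (gN.powS a).comap _
  have gB1 : Good I (fun n => relS A' (prodPow I n • N : Submodule R M)) :=
    (gN.powS a').comap _
  have gB' : Good I (fun n => bdS F A' (prodPow I n • N : Submodule R M)) :=
    (gB1.map _).sup (gN.powS p)
  have gZ := (gB.powS b).inf ((gB'.powS c).comap (matX (Fin p → M) D))
  have gY := ((gB.powS s).map (matX (Fin p → M) S)).sup (gB'.powS b)
  have hm : ∀ n, IsLocalRing.maximalIdeal R • (powS b (relS A (prodPow I n • N : Submodule R M)) ⊓
      (powS c (bdS F A' (prodPow I n • N : Submodule R M))).comap (matX (Fin p → M) D)) ≤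
      (powS s (relS A (prodPow I n • N : Submodule R M))).map (matX (Fin p → M) S) ⊔
        powS b (bdS F A' (prodPow I n • N : Submodule R M)) := by
    intro n
    obtain ⟨-, θ, hθ, hk⟩ := h3 n
    rw [Submodule.smul_le]
    intro x hx z hz
    have h4 : x • (⟨z, hz⟩ : (powS b (relS A (prodPow I n • N : Submodule R M)) ⊓
      (powS c (bdS F A' (prodPow I n • N : Submodule R M))).comap (matX (Fin p → M) D) :
        Submodule R _)) ∈ LinearMap.ker θ := by
      rw [LinearMap.mem_ker, map_smul]
      apply tor_smul_eq_zero
      intro t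
      obtain ⟨t, rfl⟩ := IsLocalRing.residue_surjective t
      change x • (Ideal.Quotient.mk _ t) = 0
      rw [← Ideal.Quotient.mk_eq_mk, ← Submodule.Quotient.mk_smul, Submodule.Quotient.mk_eq_zero]
      exact Ideal.mul_mem_right _ _ hx
    rw [hk] at h4
    exact h4
  obtain ⟨c, P, hP⟩ := count gY gZ (fun n => (h3 n).1) hm
  refine ⟨c, P, fun n hn => ⟨_, ?_, hP n hn⟩⟩
  obtain ⟨-, θ, hθ, hk⟩ := h3 n
  have h5 := len_eq_of_surj θ hθ hk
  rw [bettiNumber, moduleLength, ← Module.coe_length, h5]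
  have h6 := len_ne_top (hm n)
  rw [← WithBot.coe_natCast]
  congr 1
  exact (ENat.natCast_toNat h6).symm

end FinalPart

/-- over a Noetherian local ring, the Betti numbers
`β_i^R(F(M/IⁿN))` are eventually given by a polynomial in `n`. -/
theorem stmt11 {R : Type u} [CommRing R] [IsNoetherianRing R] [IsLocalRing R]
    {r : ℕ} (hr : 1 ≤ r) (I : Fin r → Ideal R)
    (M : Type u) [AddCommGroup M] [Module R M] [Module.Finite R M]
    (N : Submodule R M)
    {K L : Type u} [AddCommGroup K] [Module R K] [Module.Finite R K]
    [AddCommGroup L] [Module R L] [Module.Finite R L]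
    (f : K →ₗ[R] L) (i : ℕ) :
    ∃ (c : Fin r → ℕ) (P : MvPolynomial (Fin r) ℚ), ∀ n : Fin r → ℕ, c ≤ n →
      ∃ m : ℕ,
        bettiNumber R i (coherentApply f (M ⧸ (prodPow I n • N : Submodule R M))) = m ∧
        (m : ℚ) = MvPolynomial.eval (fun i => (n i : ℚ)) P := by
  exact main_aux I M N f i
end

section
/- Let (R, 𝔪) be a commutative Noetherian local ring with residue field k, r ≥ 1 an integer, I_1,…,I_r ideals of R, and N ⊆ M finitely generated R-modules. Let f : K → L be an R-linear map between finitely generated R-modules and let F denote the associated coherent functor, F(X) := Hom_R(K,X) / {g ∘ f : g ∈ Hom_R(L,X)}. Fix i ≥ 0. Then there exist c ∈ ℕ^r and a polynomial P ∈ ℚ[x_1,…,x_r] such that the i-th Bass number satisfies μ_R^i(F(M/I^n N)) = P(n) for all n ≥ c. -/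
universe u

open CategoryTheory

/-- The `i`-th Bass number of `X` over a local ring `(R,𝔪,k)`:
`μ_R^i(X) = dim_k Ext_R^i(k, X)`, computed as the `R`-length of `Ext_R^i(k, X)`
(which coincides with its `k`-dimension since `𝔪` annihilates this module). -/
noncomputable def bassNumber (R : Type u) [CommRing R] [IsLocalRing R] (i : ℕ)
    (X : Type u) [AddCommGroup X] [Module R X] : WithBot ℕ∞ :=
  moduleLength R
    ↥(((Ext R (ModuleCat.{u} R) i).obj
        (Opposite.op (ModuleCat.of R (IsLocalRing.ResidueField R)))).obj
      (ModuleCat.of R X))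


namespace Stmt12

section Resolution

variable {R : Type u} [CommRing R]

/-- The syzygy step: bundle of a finite module, to define iterated syzygies. -/
structure FinMod (R : Type u) [CommRing R] where
  /-- carrier -/
  Z : Type u
  [grp : AddCommGroup Z]
  [mod : Module R Z]
  [fin : Module.Finite R Z]

attribute [instance] FinMod.grp FinMod.mod FinMod.fin

/-- number of generators -/
noncomputable def numGen (Z : FinMod R) : ℕ :=
  (Module.Finite.exists_fin' R Z.Z).choose

/-- A finite free cover. -/
noncomputable def cover (Z : FinMod R) :
    (Fin (numGen Z) → R) →ₗ[R] Z.Z :=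
  (Module.Finite.exists_fin' R Z.Z).choose_spec.choose

lemma cover_surjective (Z : FinMod R) :
    Function.Surjective (cover Z) :=
  (Module.Finite.exists_fin' R Z.Z).choose_spec.choose_spec

/-- syzygy -/
noncomputable abbrev syz1 [IsNoetherianRing R] (Z : FinMod R) : FinMod R :=
  { Z := LinearMap.ker (cover Z) }

/-- Differential. -/
noncomputable def dd [IsNoetherianRing R] (Z : FinMod R) :
    (Fin (numGen (syz1 Z)) → R) →ₗ[R] (Fin (numGen Z) → R) :=
  (LinearMap.ker (cover Z)).subtype ∘ₗ (cover (syz1 Z))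

lemma dd_ker [IsNoetherianRing R] (Z : FinMod R) :
    LinearMap.ker (dd Z) = LinearMap.ker (cover (syz1 Z)) := by
  unfold dd
  rw [LinearMap.ker_comp, Submodule.ker_subtype]
  rfl

lemma dd_range [IsNoetherianRing R] (Z : FinMod R) :
    LinearMap.range (dd Z) = LinearMap.ker (cover Z) := by
  unfold dd
  rw [LinearMap.range_comp, LinearMap.range_eq_top.2 (cover_surjective _)]
  simp

/-- Iterated syzygies. -/
noncomputable def syz [IsNoetherianRing R] (Z : FinMod R) : ℕ → FinMod R
  | 0 => Z
  | n + 1 => syz1 (syz Z n)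

lemma exists_seq [IsNoetherianRing R] (Z : Type u) [AddCommGroup Z] [Module R Z]
    [Module.Finite R Z] :
    ∃ (X : ℕ → ModuleCat.{u} R) (d : ∀ n, X (n+1) →ₗ[R] X n) (p : X 0 →ₗ[R] Z),
      (∀ n, Module.Finite R (X n)) ∧ (∀ n, Projective (X n)) ∧
      (∀ n, LinearMap.range (d (n+1)) = LinearMap.ker (d n)) ∧
      LinearMap.range (d 0) = LinearMap.ker p ∧ Function.Surjective p := by
  refine ⟨fun n => ModuleCat.of R (Fin (numGen (syz ⟨Z⟩ n)) → R),
    fun n => dd (syz ⟨Z⟩ n), cover (⟨Z⟩ : FinMod R), fun n => ?_, fun n => ?_, fun n => ?_, ?_, ?_⟩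
  · change Module.Finite R (Fin (numGen (syz ⟨Z⟩ n)) → R)
    infer_instance
  · rw [← IsProjective.iff_projective]
    infer_instance
  · exact (dd_range (syz1 (syz ⟨Z⟩ n))).trans (dd_ker _).symm
  · exact dd_range (⟨Z⟩ : FinMod R)
  · exact cover_surjective _

lemma exists_res [IsNoetherianRing R] (Z : Type u) [AddCommGroup Z] [Module R Z]
    [Module.Finite R Z] :
    ∃ P : ProjectiveResolution (ModuleCat.of R Z), ∀ n, Module.Finite R (P.complex.X n) := by
  obtain ⟨X, d, p, hfin, hproj, hex, hex0, hsurj⟩ := exists_seq (R := R) Z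
  have hdd : ∀ n, (ModuleCat.ofHom (d (n+1)) : X (n+1+1) ⟶ X (n+1)) ≫
      (ModuleCat.ofHom (d n) : X (n+1) ⟶ X n) = 0 := by
    intro n
    ext1
    simp only [ModuleCat.hom_comp, ModuleCat.hom_ofHom, ModuleCat.hom_zero]
    rw [← LinearMap.range_le_ker_iff, hex]
  have hd0 : (ModuleCat.ofHom (d 0) : X 1 ⟶ X 0) ≫
      (ModuleCat.ofHom p : X 0 ⟶ ModuleCat.of R Z) = 0 := by
    ext1
    simp only [ModuleCat.hom_comp, ModuleCat.hom_ofHom, ModuleCat.hom_zero]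
    rw [← LinearMap.range_le_ker_iff, hex0]
  let C : ChainComplex (ModuleCat.{u} R) ℕ :=
    ChainComplex.of X (fun n => ModuleCat.ofHom (d n)) hdd
  have hC : ∀ n, C.d (n+1) n = ModuleCat.ofHom (d n) := fun n =>
    ChainComplex.of_d X (fun n => (ModuleCat.ofHom (d n) : X (n+1) ⟶ X n)) n
  have hCex : ∀ n, C.ExactAt (n + 1) := by
    intro n
    rw [HomologicalComplex.exactAt_iff' _ (n + 1 + 1) (n + 1) n (by simp) (by simp)]
    have e : C.sc' (n+1+1) (n+1) n ≅ ShortComplex.mk (ModuleCat.ofHom (d (n+1)))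
      (ModuleCat.ofHom (d n)) (hdd n) :=
      ShortComplex.isoMk (Iso.refl _) (Iso.refl _) (Iso.refl _)
        (by
          simp only [Iso.refl_hom]
          erw [Category.id_comp, Category.comp_id]
          exact (hC (n+1)).symm)
        (by
          simp only [Iso.refl_hom]
          erw [Category.id_comp, Category.comp_id]
          exact (hC n).symm)
    rw [ShortComplex.exact_iff_of_iso e, ShortComplex.moduleCat_exact_iff_ker_sub_range]
    simp only [ModuleCat.hom_ofHom]
    rw [hex]
  refine ⟨{ complex := C
            projective := hproj
            π := (ChainComplex.toSingle₀Equiv _ _).symm ⟨ModuleCat.ofHom p, by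
              rw [hC]; exact hd0⟩
            quasiIso := ⟨fun n => ?_⟩ }, hfin⟩
  cases n
  · rw [ChainComplex.quasiIsoAt₀_iff, ShortComplex.quasiIso_iff_of_zeros']
    · refine (ShortComplex.exact_and_epi_g_iff_of_iso
          (S₂ := ShortComplex.mk (ModuleCat.ofHom (d 0))
            (ModuleCat.ofHom p) hd0) ?_).2 ⟨?_, ?_⟩
      · refine ShortComplex.isoMk (Iso.refl _) (Iso.refl _) (Iso.refl _) ?_ ?_
        · simp only [Iso.refl_hom]
          erw [Category.id_comp]
        · simp only [Iso.refl_hom]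
          erw [Category.id_comp]
      · rw [ShortComplex.moduleCat_exact_iff_ker_sub_range]
        simp only [ModuleCat.hom_ofHom]
        rw [hex0]
      · rw [ModuleCat.epi_iff_surjective]
        exact hsurj
    all_goals rfl
  · rw [quasiIsoAt_iff_exactAt']
    · apply hCex
    · apply ChainComplex.exactAt_succ_single_obj

end Resolution


section ExtCoherent

variable {R : Type u} [CommRing R]

/-- Homology of the Hom complex of `Q2 → Q1 → Q0` as a coherent functor. -/
lemma coherent_of_complex {Q0 Q1 Q2 Y : Type u} [AddCommGroup Q0] [AddCommGroup Q1]
    [AddCommGroup Q2] [AddCommGroup Y] [Module R Q0] [Module R Q1] [Module R Q2] [Module R Y]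
    (d1 : Q1 →ₗ[R] Q0) (d2 : Q2 →ₗ[R] Q1) (h : d1 ∘ₗ d2 = 0)
    (hle : LinearMap.range d2 ≤ LinearMap.ker d1)
    {V1 V2 V3 : Type u} [AddCommGroup V1] [AddCommGroup V2] [AddCommGroup V3]
    [Module R V1] [Module R V2] [Module R V3]
    (f : V1 →ₗ[R] V2) (g : V2 →ₗ[R] V3) (hfg : ∀ x, f x ∈ LinearMap.ker g)
    (e1 : V1 ≃ₗ[R] (Q0 →ₗ[R] Y)) (e2 : V2 ≃ₗ[R] (Q1 →ₗ[R] Y)) (e3 : V3 ≃ₗ[R] (Q2 →ₗ[R] Y))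
    (hf : ∀ x, e2 (f x) = e1 x ∘ₗ d1) (hg : ∀ x, e3 (g x) = e2 x ∘ₗ d2) :
    Nonempty ((LinearMap.ker g ⧸ LinearMap.range (f.codRestrict (LinearMap.ker g) hfg)) ≃ₗ[R]
      coherentApply ((LinearMap.range d2).liftQ d1 hle) Y) := by
  have hmem : ∀ φ : (Q1 ⧸ LinearMap.range d2) →ₗ[R] Y,
      e2.symm (φ ∘ₗ (LinearMap.range d2).mkQ) ∈ LinearMap.ker g := by
    intro φ
    rw [LinearMap.mem_ker]
    apply e3.injective
    rw [hg, map_zero, LinearEquiv.apply_symm_apply, LinearMap.comp_assoc,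
      LinearMap.range_mkQ_comp, LinearMap.comp_zero]
  let F : ((Q1 ⧸ LinearMap.range d2) →ₗ[R] Y) →ₗ[R] LinearMap.ker g :=
    (e2.symm.toLinearMap ∘ₗ LinearMap.lcomp R Y (LinearMap.range d2).mkQ).codRestrict _ hmem
  have hker : ∀ v ∈ LinearMap.ker g, LinearMap.range d2 ≤ LinearMap.ker (e2 v) := by
    intro v hv
    rw [LinearMap.range_le_ker_iff, ← hg, LinearMap.mem_ker.1 hv, map_zero]
  have hF : Function.Bijective F := by
    constructor
    · intro φ ψ hφψ
      have := congrArg (fun z => e2 z.1) hφψ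
      change e2 (e2.symm (φ ∘ₗ (LinearMap.range d2).mkQ)) =
        e2 (e2.symm (ψ ∘ₗ (LinearMap.range d2).mkQ)) at this
      rw [LinearEquiv.apply_symm_apply, LinearEquiv.apply_symm_apply] at this
      exact Submodule.linearMap_qext _ this
    · rintro ⟨v, hv⟩
      refine ⟨(LinearMap.range d2).liftQ (e2 v) ?_, ?_⟩
      · exact hker v hv
      · apply Subtype.ext
        change e2.symm (((LinearMap.range d2).liftQ (e2 v) (hker v hv)) ∘ₗ (LinearMap.range d2).mkQ) = v
        rw [Submodule.liftQ_mkQ, LinearEquiv.symm_apply_apply]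
  refine ⟨(Submodule.Quotient.equiv _ _ (LinearEquiv.ofBijective F hF) ?_).symm⟩
  ext ⟨v, hv⟩
  simp only [Submodule.mem_map, LinearMap.mem_range]
  constructor
  · rintro ⟨_, ⟨ψ, rfl⟩, h2⟩
    refine ⟨e1.symm ψ, ?_⟩
    rw [← h2]
    apply Subtype.ext
    apply e2.injective
    simp only [LinearMap.codRestrict_apply, hf, LinearEquiv.apply_symm_apply]
    change _ = e2 (e2.symm _)
    rw [LinearEquiv.apply_symm_apply]
    ext x
    simp
  · rintro ⟨x, hx⟩
    refine ⟨_, ⟨e1 x, rfl⟩, ?_⟩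
    rw [← hx]
    apply Subtype.ext
    apply e2.injective
    simp only [LinearMap.codRestrict_apply, hf]
    change e2 (e2.symm _) = _
    rw [LinearEquiv.apply_symm_apply]
    ext x
    simp

/-- `Hom` in `ModuleCat` as linear maps -/
def homLE (A B : ModuleCat.{u} R) : (A ⟶ B) ≃ₗ[R] (A →ₗ[R] B) :=
  ModuleCat.homLinearEquiv (S := R)

open ProjectiveResolution in
lemma ext_coherent [IsNoetherianRing R] (Z : Type u) [AddCommGroup Z] [Module R Z]
    [Module.Finite R Z] (i : ℕ) :
    ∃ (A B : Type u) (_ : AddCommGroup A) (_ : AddCommGroup B) (_ : Module R A) (_ : Module R B)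
      (_ : Module.Finite R A) (_ : Module.Finite R B) (g : A →ₗ[R] B),
      (∀ (Y : Type u) [AddCommGroup Y] [Module R Y],
        Nonempty (↥(((Ext R (ModuleCat.{u} R) i).obj
        (Opposite.op (ModuleCat.of R Z))).obj
          (ModuleCat.of R Y)) ≃ₗ[R] coherentApply g Y)) ∧
      ∀ a : R, (∀ z : Z, a • z = 0) → ∀ (Y : Type u) [AddCommGroup Y] [Module R Y],
        ∀ y : coherentApply g Y, a • y = 0 := by
  obtain ⟨P, hP⟩ := exists_res (R := R) Z
  have hn : (ComplexShape.down ℕ).next i = i - 1 := by cases i <;> simp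
  have hp : (ComplexShape.up ℕ).prev i = i - 1 := by cases i <;> simp
  let d1 := (P.complex.d i (i-1)).hom
  let d2 := (P.complex.d (i+1) i).hom
  have h12 : d1 ∘ₗ d2 = 0 := by
    rw [← ModuleCat.hom_comp, P.complex.d_comp_d]; rfl
  have hle := LinearMap.range_le_ker_iff.2 h12
  refine ⟨P.complex.X i ⧸ LinearMap.range d2, P.complex.X (i-1), inferInstance, inferInstance,
    inferInstance, inferInstance, inferInstance, inferInstance,
    (LinearMap.range d2).liftQ d1 hle, ?_, ?_⟩
  · intro Y _ _
    let K := P.complex.linearYonedaObj R (ModuleCat.of R Y)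
    let e1 := P.isoExt (R := R) i (ModuleCat.of R Y)
    let e2 : K.homology i ≅ (K.sc' (i-1) i (i+1)).homology :=
      ShortComplex.homologyMapIso (K.isoSc' (i-1) i (i+1) hp (by simp))
    let e3 := (K.sc' (i-1) i (i+1)).moduleCatHomologyIso
    have := coherent_of_complex (Y := Y) d1 d2 h12 hle (K.sc' (i-1) i (i+1)).f.hom
      (K.sc' (i-1) i (i+1)).g.hom (fun x => by
        have := (K.sc' (i-1) i (i+1)).moduleCat_zero_apply x
        exact this) (homLE _ _) (homLE _ _) (homLE _ _) (fun x => rfl) (fun x => rfl)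
    obtain ⟨e4⟩ := this
    exact ⟨(e1 ≪≫ e2 ≪≫ e3).toLinearEquiv ≪≫ₗ e4⟩
  · intro a ha Y _ _ y
    obtain ⟨φ, rfl⟩ := Submodule.Quotient.mk_surjective _ y
    have H : Homotopy (a • 𝟙 P.complex) 0 := by
      refine liftHomotopy (P := P) (Q := P) 0 _ _ ?_ ?_
      · have h0 : a • P.π = 0 := by
          apply HomologicalComplex.hom_ext
          intro n
          cases n with
          | zero =>
            ext x
            exact ha _
          | succ n => simp
        simp [h0]
      · simp
    have H1 := H.comm i
    have H2 : ∀ x : P.complex.X i, ∃ w : P.complex.X (i+1), a • x =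
        (H.hom (i-1) i).hom (d1 x) + d2 w := by
      intro x
      rw [dNext_nat, Homotopy.prevD_chainComplex, HomologicalComplex.zero_f, add_zero] at H1
      have h3 := congrArg (fun f => f.hom x) H1
      exact ⟨(H.hom i (i+1)).hom x, h3⟩
    rw [← Submodule.Quotient.mk_smul, Submodule.Quotient.mk_eq_zero]
    refine ⟨φ ∘ₗ (LinearMap.range d2).mkQ ∘ₗ (H.hom (i-1) i).hom, ?_⟩
    apply Submodule.linearMap_qext
    ext x
    obtain ⟨w, hw⟩ := H2 x
    have : (LinearMap.range d2).mkQ (a • x) = (LinearMap.range d2).mkQ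
        ((H.hom (i-1) i).hom (d1 x)) := by
      rw [hw, map_add]
      simp
    change φ ((LinearMap.range d2).mkQ ((H.hom (i-1) i).hom (d1 x))) =
      a • φ ((LinearMap.range d2).mkQ x)
    rw [← this, map_smul, map_smul]

end ExtCoherent


section ArtinRees

variable {R : Type u} [CommRing R] {r : ℕ} (I : Fin r → Ideal R)

lemma prodPow_add (m n : Fin r → ℕ) : prodPow I (m + n) = prodPow I m * prodPow I n := by
  simp [prodPow, pow_add, Finset.prod_mul_distrib]

lemma prodPow_zero : prodPow I 0 = 1 := by simp [prodPow]

lemma prodPow_single (i : Fin r) (k : ℕ) : prodPow I (Pi.single i k) = I i ^ k := by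
  unfold prodPow
  rw [Finset.prod_eq_single i]
  · simp
  · intro b _ hb; simp [Pi.single_eq_of_ne hb]
  · simp

lemma prodPow_nsmul (k : ℕ) (m : Fin r → ℕ) : prodPow I (k • m) = prodPow I m ^ k := by
  simp only [prodPow, ← Finset.prod_pow, Pi.smul_apply, smul_eq_mul, mul_comm k, pow_mul]

lemma prodPow_sum {ι : Type*} (s : Finset ι) (f : ι → (Fin r → ℕ)) :
    prodPow I (∑ j ∈ s, f j) = ∏ j ∈ s, prodPow I (f j) := by
  classical
  induction s using Finset.induction_on with
  | empty => simp [prodPow_zero]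
  | insert a s ha ih => rw [Finset.sum_insert ha, Finset.prod_insert ha, prodPow_add, ih]

/-- A family of submodules stable under the ideals. -/
def Stable {W : Type u} [AddCommGroup W] [Module R W] (X : (Fin r → ℕ) → Submodule R W) : Prop :=
  ∀ m n, prodPow I m • X n ≤ X (m + n)

variable {J : Type} [Fintype J] (d : J → Fin r) (a : J → R)

/-- weights -/
def wt (j : J) : Fin r → ℕ := Pi.single (d j) 1

open MvPolynomial

lemma eval_monomial_mem (ha : ∀ j, a j ∈ I (d j)) (α : J →₀ ℕ) (b : R) :
    eval a (monomial α b) ∈ prodPow I (Finsupp.weight (wt d) α) := by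
  rw [eval_monomial, Finsupp.weight_apply, Finsupp.sum_fintype _ _ (by simp),
    Finsupp.prod_fintype _ _ (by simp), prodPow_sum]
  apply Ideal.mul_mem_left
  apply Ideal.prod_mem_prod
  intro j _
  rw [prodPow_nsmul]
  apply Ideal.pow_mem_pow
  rw [wt, prodPow_single, pow_one]
  exact ha j

/-- values of homogeneous polynomials -/
noncomputable def homVal (n : Fin r → ℕ) : Ideal R :=
  (weightedHomogeneousSubmodule R (wt d) n).map (aeval a : MvPolynomial J R →ₐ[R] R).toLinearMap

lemma homVal_mul (m n : Fin r → ℕ) : homVal d a m * homVal d a n ≤ homVal d a (m + n) := by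
  rw [Ideal.mul_le]
  rintro _ ⟨p, hp, rfl⟩ _ ⟨q, hq, rfl⟩
  exact ⟨p * q, IsWeightedHomogeneous.mul hp hq, by simp⟩

lemma one_le_homVal : (1 : Ideal R) ≤ homVal d a 0 := by
  rw [Ideal.one_eq_top, top_le_iff, Ideal.eq_top_iff_one]
  exact ⟨1, isWeightedHomogeneous_one R _, by simp⟩

lemma prodPow_le_homVal (hI : ∀ i, I i = Ideal.span (a '' {j | d j = i})) (n : Fin r → ℕ) :
    prodPow I n ≤ homVal d a n := by
  classical
  have h1 : ∀ i, I i ≤ homVal d a (Pi.single i 1) := by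
    intro i
    rw [hI, Ideal.span_le]
    rintro _ ⟨j, hj, rfl⟩
    refine ⟨X j, ?_, by simp⟩
    have := isWeightedHomogeneous_X R (wt d) j
    rw [wt, hj] at this
    exact this
  have h2 : ∀ i k, I i ^ k ≤ homVal d a (Pi.single i k) := by
    intro i k
    induction k with
    | zero => simpa using one_le_homVal d a
    | succ k ih =>
      rw [pow_succ, Pi.single_add]
      exact (Ideal.mul_mono ih (h1 i)).trans (homVal_mul d a _ _)
  have h3 : ∀ s : Finset (Fin r), ∏ i ∈ s, I i ^ n i ≤ homVal d a (∑ i ∈ s, Pi.single i (n i)) := by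
    intro s
    induction s using Finset.induction_on with
    | empty => simpa using one_le_homVal d a
    | insert x s hx ih =>
      rw [Finset.prod_insert hx, Finset.sum_insert hx]
      exact (Ideal.mul_mono (h2 _ _) ih).trans (homVal_mul d a _ _)
  have := h3 Finset.univ
  rwa [Finset.univ_sum_single] at this

lemma exists_gens [IsNoetherianRing R] : ∃ (J : Type) (_ : Fintype J) (_ : DecidableEq J)
    (d : J → Fin r) (a : J → R), ∀ i, I i = Ideal.span (a '' {j | d j = i}) := by
  classical
  have h : ∀ i, ∃ (k : ℕ) (s : Fin k → R), I i = Ideal.span (Set.range s) := by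
    intro i
    obtain ⟨k, s, hs⟩ := Submodule.fg_iff_exists_fin_generating_family.1
      (IsNoetherian.noetherian (I i))
    exact ⟨k, s, hs.symm⟩
  choose k s hs using h
  refine ⟨Σ i, Fin (k i), inferInstance, inferInstance, Sigma.fst, fun j => s j.1 j.2, fun i => ?_⟩
  rw [hs i]
  congr 1
  ext x
  constructor
  · rintro ⟨y, rfl⟩
    exact ⟨⟨i, y⟩, rfl, rfl⟩
  · rintro ⟨⟨i', y⟩, h, rfl⟩
    obtain rfl : i' = i := h
    exact ⟨y, rfl⟩

variable {W : Type u} [AddCommGroup W] [Module R W]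

/-- evaluation of vectors of polynomials -/
noncomputable def evv {s : ℕ} (v : Fin s → W) : (Fin s → MvPolynomial J R) →+ W where
  toFun p := ∑ l, eval a (p l) • v l
  map_zero' := by simp
  map_add' p q := by simp [add_smul, Finset.sum_add_distrib]

lemma evv_smul {s : ℕ} (v : Fin s → W) (q : MvPolynomial J R) (p : Fin s → MvPolynomial J R) :
    evv a v (q • p) = eval a q • evv a v p := by
  simp [evv, Finset.smul_sum, mul_smul]

/-- homogeneous vectors -/
def HomV {s : ℕ} (p : Fin s → MvPolynomial J R) (n : Fin r → ℕ) : Prop :=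
  ∀ l, IsWeightedHomogeneous (wt d) (p l) n

/-- components -/
noncomputable def compV {s : ℕ} (n : Fin r → ℕ) :
    (Fin s → MvPolynomial J R) →+ (Fin s → MvPolynomial J R) where
  toFun p l := weightedHomogeneousComponent (wt d) n (p l)
  map_zero' := by ext1; simp
  map_add' p q := by ext1; simp

lemma exists_homV (hI : ∀ i, I i = Ideal.span (a '' {j | d j = i})) {s : ℕ} (v : Fin s → W)
    (n : Fin r → ℕ) (w : W) (hw : w ∈ prodPow I n • Submodule.span R (Set.range v)) :
    ∃ p : Fin s → MvPolynomial J R, HomV d p n ∧ evv a v p = w := by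
  induction hw using Submodule.smul_induction_on' with
  | smul x hx c hc =>
    obtain ⟨q, hq, rfl⟩ := prodPow_le_homVal I d a hI n hx
    obtain ⟨b, rfl⟩ := (Submodule.mem_span_range_iff_exists_fun R).1 hc
    refine ⟨fun l => C (b l) * q, fun l => ?_, ?_⟩
    · have := (isWeightedHomogeneous_C (wt d) (b l)).mul hq
      rwa [zero_add] at this
    · change ∑ l, eval a (C (b l) * q) • v l = aeval a q • ∑ l, b l • v l
      rw [Finset.smul_sum]
      refine Finset.sum_congr rfl fun l _ => ?_
      rw [map_mul, eval_C, aeval_eq_eval, smul_smul, mul_comm]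
  | add x hx y hy h1 h2 =>
    obtain ⟨p, hp, rfl⟩ := h1
    obtain ⟨q, hq, rfl⟩ := h2
    exact ⟨p + q, fun l => (hp l).add (hq l), map_add _ _ _⟩

theorem artinRees [IsNoetherianRing R] [IsNoetherian R W] (C : Submodule R W)
    (X : (Fin r → ℕ) → Submodule R W) (hX : Stable I X) (hXC : ∀ n, X n ≤ prodPow I n • C) :
    ∃ c, ∀ n, X (c + n) = prodPow I n • X c := by
  classical
  obtain ⟨J, _, _, d, a, hI⟩ := exists_gens I
  have ha : ∀ j, a j ∈ I (d j) := fun j => by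
    rw [hI]; exact Ideal.subset_span ⟨j, rfl, rfl⟩
  obtain ⟨s, v, rfl⟩ := Submodule.fg_iff_exists_fin_generating_family.1 (IsNoetherian.noetherian C)
  let T : Set (Fin s → MvPolynomial J R) := {p | ∃ m, HomV d p m ∧ evv a v p ∈ X m}
  obtain ⟨T', hT', hspan⟩ := Submodule.fg_span_iff_fg_span_finset_subset T |>.1
    (IsNoetherian.noetherian (Submodule.span (MvPolynomial J R) T))
  have hT'' : ∀ p, ∃ m, p ∈ T' → HomV d p m ∧ evv a v p ∈ X m := by
    intro p
    by_cases hp : p ∈ T'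
    · obtain ⟨m, hm⟩ := hT' hp
      exact ⟨m, fun _ => hm⟩
    · exact ⟨0, fun h => absurd h hp⟩
  choose deg hdeg using hT''
  refine ⟨T'.sup deg, fun n => le_antisymm ?_ ?_⟩
  · intro w hw
    obtain ⟨p, hp, rfl⟩ := exists_homV I d a hI v _ w (hXC _ hw)
    have hpT : p ∈ Submodule.span (MvPolynomial J R) (T' : Set _) := by
      rw [← hspan]
      exact Submodule.subset_span ⟨_, hp, hw⟩
    have hcomp : compV d (T'.sup deg + n) p = p := by
      funext l
      exact (hp l).weightedHomogeneousComponent_same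
    obtain ⟨q, -, hq⟩ := Submodule.mem_span_finset.1 hpT
    have key : ∀ t ∈ T', ∀ q : MvPolynomial J R,
        evv a v (compV d (T'.sup deg + n) (q • t)) ∈ prodPow I n • X (T'.sup deg) := by
      intro t ht q
      induction q using MvPolynomial.induction_on' with
      | add p q hp hq =>
        rw [add_smul, map_add, map_add]
        exact add_mem hp hq
      | monomial α b =>
        obtain ⟨h1, h2⟩ := hdeg t ht
        have hle : deg t ≤ T'.sup deg := Finset.le_sup ht
        have hmon : HomV d (monomial α b • t) (Finsupp.weight (wt d) α + deg t) := by
          intro l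
          exact (isWeightedHomogeneous_monomial (wt d) α b rfl).mul (h1 l)
        by_cases hα : Finsupp.weight (wt d) α + deg t = T'.sup deg + n
        · have : compV d (T'.sup deg + n) (monomial α b • t) = monomial α b • t := by
            funext l
            rw [← hα]
            exact (hmon l).weightedHomogeneousComponent_same
          rw [this, evv_smul]
          have hw : Finsupp.weight (wt d) α = n + (T'.sup deg - deg t) := by
            funext i
            have := congrFun hα i
            have := hle i
            simp only [Pi.add_apply, Pi.sub_apply] at *
            omega
          have h3 := eval_monomial_mem I d a ha α b
          rw [hw, prodPow_add] at h3
          have h4 := Submodule.smul_mem_smul h3 h2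
          rw [mul_smul] at h4
          refine Submodule.smul_mono le_rfl ?_ h4
          have := hX (T'.sup deg - deg t) (deg t)
          rwa [tsub_add_cancel_of_le hle] at this
        · have : compV d (T'.sup deg + n) (monomial α b • t) = 0 := by
            funext l
            exact (hmon l).weightedHomogeneousComponent_ne _ (Ne.symm hα)
          rw [this, map_zero]
          exact zero_mem _
    rw [← hcomp, ← hq, map_sum, map_sum]
    exact Submodule.sum_mem _ fun t ht => key t ht _
  · rw [add_comm]
    exact hX _ _

end ArtinRees


section PolyDiff

open MvPolynomial

variable {r : ℕ}

lemma antidiff (i : Fin r) (P : MvPolynomial (Fin r) ℚ) :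
    ∃ A : MvPolynomial (Fin r) ℚ, ∀ x : Fin r → ℚ,
      eval (x + Pi.single i 1) A - eval x A = eval x P := by
  classical
  induction P using MvPolynomial.induction_on' with
  | add p q hp hq =>
    obtain ⟨A, hA⟩ := hp
    obtain ⟨B, hB⟩ := hq
    refine ⟨A + B, fun x => ?_⟩
    rw [map_add, map_add, map_add, ← hA, ← hB]; ring
  | monomial α b =>
    refine ⟨C (b / (α i + 1)) * Polynomial.aeval (X i) (Polynomial.bernoulli (α i + 1)) *
      ∏ j ∈ Finset.univ.erase i, X j ^ α j, fun x => ?_⟩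
    have h1 : ∀ y : Fin r → ℚ, eval y (Polynomial.aeval (X i : MvPolynomial (Fin r) ℚ)
        (Polynomial.bernoulli (α i + 1))) = (Polynomial.bernoulli (α i + 1)).eval (y i) := by
      intro y
      have := Polynomial.aeval_algHom_apply (aeval y : MvPolynomial (Fin r) ℚ →ₐ[ℚ] ℚ) (X i)
        (Polynomial.bernoulli (α i + 1))
      rw [aeval_X, Polynomial.coe_aeval_eq_eval] at this
      rw [this, aeval_eq_eval]
    have h2 : ∏ j ∈ Finset.univ.erase i, (x + Pi.single i 1 : Fin r → ℚ) j ^ α j =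
        ∏ j ∈ Finset.univ.erase i, x j ^ α j := by
      refine Finset.prod_congr rfl fun j hj => ?_
      rw [Pi.add_apply, Pi.single_eq_of_ne (Finset.ne_of_mem_erase hj), add_zero]
    have h3 : eval x (monomial α b) = b * (x i ^ α i * ∏ j ∈ Finset.univ.erase i, x j ^ α j) := by
      rw [eval_monomial, Finsupp.prod_fintype _ _ (by simp),
        Finset.mul_prod_erase Finset.univ (fun j => x j ^ α j) (Finset.mem_univ i)]
    rw [h3]
    simp only [map_mul, eval_C, h1, map_prod, map_pow, eval_X, h2]
    rw [Pi.add_apply, Pi.single_eq_same, add_comm (x i) 1, Polynomial.bernoulli_eval_one_add]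
    have : ((α i : ℚ) + 1) ≠ 0 := by positivity
    push_cast
    field_simp
    ring

/-- casting exponents -/
def cst (n : Fin r → ℕ) : Fin r → ℚ := fun i => (n i : ℚ)

lemma step_diff (H : (Fin r → ℕ) → ℚ) (c : Fin r → ℕ) (j : Fin r) (A : MvPolynomial (Fin r) ℚ)
    (h : ∀ n, c ≤ n → H (n + Pi.single j 1) - H n =
      eval (cst n + Pi.single j 1) A - eval (cst n) A) (m : Fin r → ℕ) (hm : c ≤ m) :
    H m - H (Function.update m j (c j)) =
      eval (cst m) A - eval (cst (Function.update m j (c j))) A := by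
  have key : ∀ k : ℕ, H (Function.update m j (c j + k)) - H (Function.update m j (c j)) =
      eval (cst (Function.update m j (c j + k))) A -
        eval (cst (Function.update m j (c j))) A := by
    intro k
    induction k with
    | zero => simp
    | succ k ih =>
      have h1 : Function.update m j (c j + (k+1)) =
          Function.update m j (c j + k) + Pi.single j 1 := by
        funext i
        by_cases hi : i = j
        · subst hi; simp [add_assoc]
        · simp [hi]
      have h2 : cst (Function.update m j (c j + k) + Pi.single j 1) =
          cst (Function.update m j (c j + k)) + Pi.single j 1 := by
        funext i
        by_cases hi : i = j
        · subst hi; simp [cst]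
        · simp [cst, hi]
      have h3 := h (Function.update m j (c j + k)) (by
        intro i
        by_cases hi : i = j
        · subst hi; simp
        · simpa [hi] using hm i)
      rw [h1, h2]
      linarith
  have := key (m j - c j)
  rwa [Nat.add_sub_cancel' (hm j), Function.update_eq_self] at this

lemma poly_of_diff (H : (Fin r → ℕ) → ℚ) (c : Fin r → ℕ) (P : Fin r → MvPolynomial (Fin r) ℚ)
    (h : ∀ i n, c ≤ n → H (n + Pi.single i 1) - H n = eval (cst n) (P i)) :
    ∃ Q : MvPolynomial (Fin r) ℚ, ∀ n, c ≤ n → H n = eval (cst n) Q := by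
  classical
  choose A hA using fun i => antidiff i (P i)
  have key : ∀ s : Finset (Fin r), ∃ Q : MvPolynomial (Fin r) ℚ, ∀ n, c ≤ n →
      H n - H (fun i => if i ∈ s then c i else n i) = eval (cst n) Q := by
    intro s
    induction s using Finset.induction_on with
    | empty => exact ⟨0, fun n _ => by simp⟩
    | insert j s hj ih =>
      obtain ⟨Q, hQ⟩ := ih
      have hsub : ∀ (t : Finset (Fin r)) (B : MvPolynomial (Fin r) ℚ), ∀ n : Fin r → ℕ,
          eval (cst (fun i => if i ∈ t then c i else n i)) B =
          eval (cst n) (bind₁ (fun i => if i ∈ t then C (c i : ℚ) else X i) B) := by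
        intro t B n
        rw [← aeval_eq_eval, ← aeval_eq_eval, aeval_bind₁]
        congr 2
        funext i
        by_cases hi : i ∈ t <;> simp [hi, cst]
      refine ⟨Q + bind₁ (fun i => if i ∈ s then C (c i : ℚ) else X i) (A j) -
        bind₁ (fun i => if i ∈ insert j s then C (c i : ℚ) else X i) (A j), fun n hn => ?_⟩
      have h1 := step_diff H c j (A j) (fun n hn => by rw [hA]; exact h j n hn)
        (fun i => if i ∈ s then c i else n i) (by
          intro i
          by_cases hi : i ∈ s
          · simp [hi]
          · simpa [hi] using hn i)
      have h2 : Function.update (fun i => if i ∈ s then c i else n i) j (c j) =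
          fun i => if i ∈ insert j s then c i else n i := by
        funext i
        by_cases hi : i = j
        · subst hi; simp
        · simp [hi]
      rw [h2] at h1
      rw [map_sub, map_add, ← hsub, ← hsub, ← hQ n hn]
      linarith
  obtain ⟨Q, hQ⟩ := key Finset.univ
  refine ⟨Q + C (H c), fun n hn => ?_⟩
  have := hQ n hn
  simp only [Finset.mem_univ, if_true] at this
  rw [map_add, eval_C, ← this]
  ring

/-- eventually polynomial lengths -/
def EvPoly (l : (Fin r → ℕ) → ℕ∞) : Prop :=
  ∃ (c : Fin r → ℕ) (P : MvPolynomial (Fin r) ℚ), ∀ n, c ≤ n →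
    ∃ m : ℕ, l n = m ∧ (m : ℚ) = eval (cst n) P

lemma EvPoly.add {l l' : (Fin r → ℕ) → ℕ∞} (h : EvPoly l) (h' : EvPoly l') :
    EvPoly (fun n => l n + l' n) := by
  obtain ⟨c, P, hP⟩ := h
  obtain ⟨c', P', hP'⟩ := h'
  refine ⟨c ⊔ c', P + P', fun n hn => ?_⟩
  obtain ⟨m, h1, h2⟩ := hP n (le_sup_left.trans hn)
  obtain ⟨m', h1', h2'⟩ := hP' n (le_sup_right.trans hn)
  exact ⟨m + m', by simp [h1, h1'], by simp [h2, h2']⟩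

lemma EvPoly.congr {l l' : (Fin r → ℕ) → ℕ∞} (h : EvPoly l) (c : Fin r → ℕ)
    (hl : ∀ n, c ≤ n → l' n = l n) : EvPoly l' := by
  obtain ⟨c', P, hP⟩ := h
  refine ⟨c ⊔ c', P, fun n hn => ?_⟩
  rw [hl n (le_sup_left.trans hn)]
  exact hP n (le_sup_right.trans hn)

lemma EvPoly.const (c : Fin r → ℕ) (k : ℕ) {l : (Fin r → ℕ) → ℕ∞}
    (h : ∀ n, c ≤ n → l n = k) : EvPoly l :=
  ⟨c, C (k : ℚ), fun n hn => ⟨k, h n hn, by simp⟩⟩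

/-- shifting -/
lemma EvPoly.shift {l : (Fin r → ℕ) → ℕ∞} (c : Fin r → ℕ) (h : EvPoly (fun n => l (c + n))) :
    EvPoly l := by
  obtain ⟨c', P, hP⟩ := h
  refine ⟨c + c', bind₁ (fun i => X i - C (c i : ℚ)) P, fun n hn => ?_⟩
  have hc : c ≤ n := le_self_add.trans hn
  obtain ⟨m, h1, h2⟩ := hP (n - c) (by
    intro i
    have := hn i
    simp only [Pi.add_apply, Pi.sub_apply] at *
    omega)
  refine ⟨m, ?_, ?_⟩
  · rw [← h1]
    change l n = l (c + (n - c))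
    rw [add_tsub_cancel_of_le hc]
  · rw [h2, ← aeval_eq_eval, ← aeval_eq_eval, aeval_bind₁]
    congr 2
    funext i
    simp [cst, Nat.cast_sub (hc i)]

end PolyDiff


section Len

variable {R : Type u} [CommRing R] {W W' : Type u} [AddCommGroup W] [Module R W]
  [AddCommGroup W'] [Module R W']

/-- length of a subquotient -/
noncomputable def lq (Y X : Submodule R W) : ℕ∞ := Module.length R (X ⧸ Y.submoduleOf X)

lemma lq_eq_of_surj {Y X : Submodule R W} {V : Type u} [AddCommGroup V] [Module R V]
    (φ : X →ₗ[R] V) (hs : Function.Surjective φ) (hk : ∀ x : X, φ x = 0 ↔ (x : W) ∈ Y) :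
    lq Y X = Module.length R V := by
  have h : Y.submoduleOf X = LinearMap.ker φ := by
    ext x
    rw [LinearMap.mem_ker, hk]; rfl
  unfold lq
  rw [h]
  exact (LinearMap.quotKerEquivOfSurjective φ hs).length_eq

lemma lq_add {Y Z X : Submodule R W} (h1 : Y ≤ Z) (h2 : Z ≤ X) :
    lq Y X = lq Y Z + lq Z X := by
  let f : (Z ⧸ Y.submoduleOf Z) →ₗ[R] (X ⧸ Y.submoduleOf X) :=
    Submodule.mapQ _ _ (Submodule.inclusion h2) (fun x hx => hx)
  let g : (X ⧸ Y.submoduleOf X) →ₗ[R] (X ⧸ Z.submoduleOf X) :=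
    Submodule.mapQ _ _ LinearMap.id (fun x hx => h1 hx)
  refine Module.length_eq_add_of_exact f g ?_ ?_ ?_
  · rw [injective_iff_map_eq_zero]
    intro x hx
    obtain ⟨x, rfl⟩ := Submodule.Quotient.mk_surjective _ x
    change Submodule.Quotient.mk _ = _ at hx
    rw [Submodule.Quotient.mk_eq_zero] at hx
    rw [Submodule.Quotient.mk_eq_zero]
    exact hx
  · intro x
    obtain ⟨x, rfl⟩ := Submodule.Quotient.mk_surjective _ x
    exact ⟨Submodule.Quotient.mk x, rfl⟩
  · intro x
    obtain ⟨x, rfl⟩ := Submodule.Quotient.mk_surjective _ x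
    constructor
    · intro hx
      change Submodule.Quotient.mk _ = _ at hx
      rw [Submodule.Quotient.mk_eq_zero] at hx
      exact ⟨Submodule.Quotient.mk ⟨x.1, hx⟩, rfl⟩
    · rintro ⟨y, hy⟩
      obtain ⟨y, rfl⟩ := Submodule.Quotient.mk_surjective _ y
      rw [← hy]
      change Submodule.Quotient.mk _ = _
      rw [Submodule.Quotient.mk_eq_zero]
      exact y.2

lemma lq_map (f : W →ₗ[R] W') (X : Submodule R W) (Y : Submodule R W') :
    lq (X ⊓ Y.comap f) X = lq Y (Y ⊔ X.map f) := by
  let φ : X →ₗ[R] (↥(Y ⊔ X.map f) ⧸ Y.submoduleOf (Y ⊔ X.map f)) :=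
    Submodule.mkQ _ ∘ₗ (f ∘ₗ X.subtype).codRestrict _ (fun x =>
      Submodule.mem_sup_right (Submodule.mem_map_of_mem x.2))
  refine lq_eq_of_surj φ ?_ ?_
  · intro y
    obtain ⟨⟨y, hy⟩, rfl⟩ := Submodule.Quotient.mk_surjective _ y
    obtain ⟨y', hy', _, ⟨x, hx, rfl⟩, rfl⟩ := Submodule.mem_sup.1 hy
    refine ⟨⟨x, hx⟩, ?_⟩
    change Submodule.Quotient.mk _ = _
    rw [Submodule.Quotient.eq]
    change f x - (y' + f x) ∈ Y
    simpa using hy'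
  · intro x
    change Submodule.Quotient.mk _ = _ ↔ _
    rw [Submodule.Quotient.mk_eq_zero]
    change f x ∈ Y ↔ _
    simp

lemma lq_self_of_le {Y X : Submodule R W} (h : X ≤ Y) : lq Y X = 0 := by
  unfold lq
  rw [Module.length_eq_zero_iff, Submodule.Quotient.subsingleton_iff]
  exact Submodule.submoduleOf_eq_top.2 h

lemma lq_ne_top [IsLocalRing R] [IsNoetherianRing R] [IsNoetherian R W] {Y X : Submodule R W}
    (h : IsLocalRing.maximalIdeal R • X ≤ Y) : lq Y X ≠ ⊤ := by
  unfold lq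
  have hk : Module.IsTorsionBySet R (X ⧸ Y.submoduleOf X) (IsLocalRing.maximalIdeal R) := by
    intro x a
    obtain ⟨x, rfl⟩ := Submodule.Quotient.mk_surjective _ x
    rw [← Submodule.Quotient.mk_smul, Submodule.Quotient.mk_eq_zero]
    exact h (Submodule.smul_mem_smul a.2 x.2)
  have hsurj : Function.Surjective (algebraMap R (R ⧸ IsLocalRing.maximalIdeal R)) :=
    Ideal.Quotient.mk_surjective
  letI := hk.module
  haveI : IsScalarTower R (R ⧸ IsLocalRing.maximalIdeal R) (X ⧸ Y.submoduleOf X) :=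
    hk.isScalarTower
  letI : Field (R ⧸ IsLocalRing.maximalIdeal R) := Ideal.Quotient.field _
  haveI : Module.Finite (R ⧸ IsLocalRing.maximalIdeal R) (X ⧸ Y.submoduleOf X) :=
    Module.Finite.of_restrictScalars_finite R _ _
  rw [Module.length_eq_of_surjective hsurj]
  exact Module.length_ne_top

end Len

section Hilbert

variable {R : Type u} [CommRing R] {r : ℕ} (I : Fin r → Ideal R)
variable {J : Type} [Fintype J] [DecidableEq J] (d : J → Fin r) (a : J → R)
variable {W : Type u} [AddCommGroup W] [Module R W]

lemma Stable.smul_mem {X : (Fin r → ℕ) → Submodule R W} (hX : Stable I X) {m n : Fin r → ℕ}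
    {b : R} {x : W} (hb : b ∈ prodPow I m) (hx : x ∈ X n) : b • x ∈ X (m + n) :=
  hX m n (Submodule.smul_mem_smul hb hx)

theorem hilbert [IsLocalRing R] [IsNoetherianRing R] [IsNoetherian R W]
    (hI : ∀ i, I i = Ideal.span (a '' {j | d j = i})) (C : Submodule R W) (T : Finset J) :
    ∀ (X Y : (Fin r → ℕ) → Submodule R W), Stable I X → Stable I Y → (∀ n, Y n ≤ X n) →
      (∀ n, X n ≤ prodPow I n • C) → (∀ n, IsLocalRing.maximalIdeal R • X n ≤ Y n) →
      (∀ j, j ∉ T → ∀ n, ∀ x ∈ X n, a j • x ∈ Y (wt d j + n)) →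
      EvPoly (fun n => lq (Y n) (X n)) := by
  induction T using Finset.strongInduction with
  | H T ih =>
  intro X Y hX hY hYX hXC hm hT
  have ha : ∀ j, a j ∈ prodPow I (wt d j) := fun j => by
    rw [wt, prodPow_single, pow_one, hI]; exact Ideal.subset_span ⟨j, rfl, rfl⟩
  by_cases hcase : ∃ i, ∀ j ∈ T, d j ≠ i
  · obtain ⟨i, hi⟩ := hcase
    obtain ⟨c, hc⟩ := artinRees I C X hX hXC
    refine EvPoly.const (c + Pi.single i 1) 0 fun n hn => ?_
    rw [Nat.cast_zero]
    apply lq_self_of_le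
    obtain ⟨k, rfl⟩ := exists_add_of_le hn
    have h1 : X (c + Pi.single i 1 + k) = prodPow I (Pi.single i 1) • X (c + k) := by
      rw [add_assoc, hc, hc, prodPow_add, mul_smul]
    rw [h1, prodPow_single, pow_one, hI, Submodule.span_smul_eq]
    rw [Submodule.set_smul_le_iff]
    rintro _ x ⟨j, hj, rfl⟩ hx
    have hj' : j ∉ T := fun h => hi j h hj
    have := hT j hj' _ x hx
    have e : wt d j + (c + k) = c + Pi.single i 1 + k := by
      rw [wt, hj]; abel
    rwa [e] at this
  · push Not at hcase
    choose g hgT hg using hcase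
    have key : ∀ i, ∃ (c : Fin r → ℕ) (P : MvPolynomial (Fin r) ℚ), ∀ n, c ≤ n →
        ((lq (Y (n + Pi.single i 1)) (X (n + Pi.single i 1))).toNat : ℚ) -
          ((lq (Y n) (X n)).toNat : ℚ) = MvPolynomial.eval (cst n) P := by
      intro i
      obtain ⟨j, hj⟩ : ∃ j, j = g i := ⟨_, rfl⟩
      have hjT : j ∈ T := hj ▸ hgT i
      have hwt : wt d j = Pi.single i 1 := by rw [wt, hj, hg]
      rw [← hwt]
      let μ : W →ₗ[R] W := LinearMap.lsmul R W (a j)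
      have hμ : ∀ x, μ x = a j • x := fun _ => rfl
      let K : (Fin r → ℕ) → Submodule R W := fun n => X n ⊓ (Y (n + wt d j)).comap μ
      let X' : (Fin r → ℕ) → Submodule R W := fun n => X (n + wt d j)
      let Y' : (Fin r → ℕ) → Submodule R W := fun n => Y (n + wt d j) ⊔ (X n).map μ
      have hYK : ∀ n, Y n ≤ K n := by
        intro n y hy
        refine ⟨hYX n hy, ?_⟩
        change a j • y ∈ Y (n + wt d j)
        rw [add_comm]
        exact hY.smul_mem I (ha j) hy
      have hKX : ∀ n, K n ≤ X n := fun n => inf_le_left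
      have hYX' : ∀ n, Y' n ≤ X' n := by
        intro n
        refine sup_le (hYX _) ?_
        rintro _ ⟨x, hx, rfl⟩
        change a j • x ∈ X (n + wt d j)
        rw [add_comm]
        exact hX.smul_mem I (ha j) hx
      have hmX' : ∀ n, IsLocalRing.maximalIdeal R • X' n ≤ Y' n := fun n =>
        (hm _).trans le_sup_left
      have hmK : ∀ n, IsLocalRing.maximalIdeal R • K n ≤ Y n := fun n =>
        (Submodule.smul_mono le_rfl (hKX n)).trans (hm n)
      have hss : T.erase j ⊂ T := Finset.erase_ssubset hjT
      have h1 : EvPoly (fun n => lq (Y n) (K n)) := by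
        refine ih _ hss K Y ?_ hY hYK (fun n => (hKX n).trans (hXC n)) hmK ?_
        · intro m n
          rw [Submodule.smul_le]
          rintro b hb x ⟨hx1, hx2⟩
          refine ⟨hX.smul_mem I hb hx1, ?_⟩
          change a j • b • x ∈ Y (m + n + wt d j)
          rw [smul_comm, add_assoc]
          exact hY.smul_mem I hb hx2
        · intro j' hj' n x hx
          by_cases e : j' = j
          · subst e
            rw [add_comm]
            exact hx.2
          · exact hT j' (fun h => hj' (Finset.mem_erase.2 ⟨e, h⟩)) n x hx.1
      have h2 : EvPoly (fun n => lq (Y' n) (X' n)) := by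
        refine ih _ hss X' Y' ?_ ?_ hYX' ?_ hmX' ?_
        · intro m n
          change _ ≤ X (m + n + wt d j)
          rw [add_assoc]
          exact hX m _
        · intro m n
          change _ • (_ ⊔ _) ≤ Y (m + n + wt d j) ⊔ _
          rw [Submodule.smul_sup, add_assoc]
          refine sup_le_sup (hY m _) ?_
          rw [← Submodule.map_smul'']
          exact Submodule.map_mono (hX m n)
        · intro n
          refine (hXC _).trans ?_
          rw [prodPow_add]
          exact Submodule.smul_mono_left Ideal.mul_le_left
        · intro j' hj' n x hx
          by_cases e : j' = j
          · subst e
            refine Submodule.mem_sup_right ⟨x, ?_, rfl⟩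
            have : X' n = X (wt d j' + n) := by change X (n + wt d j') = _; rw [add_comm]
            rw [← this]; exact hx
          · have := hT j' (fun h => hj' (Finset.mem_erase.2 ⟨e, h⟩)) _ x hx
            rw [← add_assoc] at this
            exact Submodule.mem_sup_left this
      obtain ⟨c1, P1, hP1⟩ := h1
      obtain ⟨c2, P2, hP2⟩ := h2
      refine ⟨c1 ⊔ c2, P2 - P1, fun n hn => ?_⟩
      obtain ⟨m1, e1, e1'⟩ := hP1 n (le_sup_left.trans hn)
      obtain ⟨m2, e2, e2'⟩ := hP2 n (le_sup_right.trans hn)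
      have e3 := lq_add (hYK n) (hKX n)
      have e4 : lq (Y (n + wt d j)) (X (n + wt d j)) = _ :=
        lq_add (Y := Y (n + wt d j)) (Z := Y' n) (X := X' n) le_sup_left (hYX' n)
      have e5 : lq (K n) (X n) = lq (Y (n + wt d j)) (Y' n) := lq_map μ (X n) (Y (n + wt d j))
      simp only at e1 e2
      have e6 : lq (K n) (X n) ≠ ⊤ := lq_ne_top ((hm n).trans (hYK n))
      obtain ⟨q, hq⟩ := ENat.ne_top_iff_exists.1 e6
      rw [e3, e4, ← e5, ← hq, e1, e2, map_sub, ← e1', ← e2', ← Nat.cast_add, ← Nat.cast_add,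
        ENat.toNat_natCast, ENat.toNat_natCast]
      push_cast
      ring
    choose c P hP using key
    obtain ⟨Q, hQ⟩ := poly_of_diff (fun n => ((lq (Y n) (X n)).toNat : ℚ))
      (Finset.univ.sup c) P (fun i n hn => hP i n ((Finset.le_sup (Finset.mem_univ i)).trans hn))
    exact ⟨Finset.univ.sup c, Q, fun n hn => ⟨_, (ENat.natCast_toNat (lq_ne_top (hm n))).symm, hQ n hn⟩⟩

end Hilbert

section Good

variable {R : Type u} [CommRing R] {r : ℕ} (I : Fin r → Ideal R)
variable {W W' : Type u} [AddCommGroup W] [Module R W] [AddCommGroup W'] [Module R W']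

/-- eventually of the form `A + I^n D` -/
def Good (S : (Fin r → ℕ) → Submodule R W) : Prop :=
  ∃ (c : Fin r → ℕ) (A D : Submodule R W), ∀ n, S (c + n) = A ⊔ prodPow I n • D

lemma Good.const (A : Submodule R W) : Good I (fun _ => A) :=
  ⟨0, A, ⊥, fun n => by simp⟩

lemma Good.pow (D : Submodule R W) : Good I (fun n => prodPow I n • D) :=
  ⟨0, ⊥, D, fun n => by simp⟩

lemma Good.raise {S : (Fin r → ℕ) → Submodule R W} {c : Fin r → ℕ} {A D : Submodule R W}
    (h : ∀ n, S (c + n) = A ⊔ prodPow I n • D) (c' : Fin r → ℕ) (hc : c ≤ c') :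
    ∀ n, S (c' + n) = A ⊔ prodPow I n • (prodPow I (c' - c) • D) := by
  intro n
  rw [← mul_smul, ← prodPow_add, ← h]
  congr 1
  rw [add_comm n, ← add_assoc, add_tsub_cancel_of_le hc]

lemma Good.common {S S' : (Fin r → ℕ) → Submodule R W} (h : Good I S) {S' : (Fin r → ℕ) → Submodule R W'}
    (h' : Good I S') : ∃ (c : Fin r → ℕ) (A D : Submodule R W) (A' D' : Submodule R W'),
      ∀ n, S (c + n) = A ⊔ prodPow I n • D ∧ S' (c + n) = A' ⊔ prodPow I n • D' := by
  obtain ⟨c, A, D, h⟩ := h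
  obtain ⟨c', A', D', h'⟩ := h'
  exact ⟨c ⊔ c', A, _, A', _, fun n => ⟨Good.raise I h _ le_sup_left n,
    Good.raise I h' _ le_sup_right n⟩⟩

lemma Good.sup {S S' : (Fin r → ℕ) → Submodule R W} (h : Good I S) (h' : Good I S') :
    Good I (fun n => S n ⊔ S' n) := by
  obtain ⟨c, A, D, A', D', h⟩ := Good.common I (S' := S) h h'
  refine ⟨c, A ⊔ A', D ⊔ D', fun n => ?_⟩
  simp only [(h n).1, (h n).2, Submodule.smul_sup]
  exact sup_sup_sup_comm _ _ _ _

lemma Good.map {S : (Fin r → ℕ) → Submodule R W} (h : Good I S) (f : W →ₗ[R] W') :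
    Good I (fun n => (S n).map f) := by
  obtain ⟨c, A, D, h⟩ := h
  refine ⟨c, A.map f, D.map f, fun n => ?_⟩
  simp only [h, Submodule.map_sup, Submodule.map_smul'']

lemma Good.finset_sup {ι : Type*} (s : Finset ι) (S : ι → (Fin r → ℕ) → Submodule R W)
    (h : ∀ i ∈ s, Good I (S i)) : Good I (fun n => s.sup fun i => S i n) := by
  classical
  induction s using Finset.induction_on with
  | empty => exact Good.const I ⊥
  | insert a s ha ih =>
    simp only [Finset.sup_insert]
    exact Good.sup I (h a (Finset.mem_insert_self _ _))
      (ih fun i hi => h i (Finset.mem_insert_of_mem hi))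

lemma Good.pi {k : ℕ} {S : (Fin r → ℕ) → Submodule R W} (h : Good I S) :
    Good I (fun n => Submodule.pi Set.univ (fun _ : Fin k => S n)) := by
  have : (fun n => Submodule.pi Set.univ (fun _ : Fin k => S n)) =
      fun n => Finset.univ.sup fun i : Fin k => (S n).map (LinearMap.single R (fun _ => W) i) := by
    funext n
    rw [← Submodule.iSup_map_single, Finset.sup_univ_eq_iSup]
  rw [this]
  exact Good.finset_sup I _ _ fun i _ => h.map I _

lemma Good.comap [IsNoetherianRing R] [IsNoetherian R W] [IsNoetherian R W']
    {S : (Fin r → ℕ) → Submodule R W} (h : Good I S) (f : W' →ₗ[R] W) :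
    Good I (fun n => (S n).comap f) := by
  obtain ⟨c, A, D, h⟩ := h
  let g : W' →ₗ[R] W ⧸ A := A.mkQ ∘ₗ f
  have hcomap : ∀ n, (S (c + n)).comap f = (prodPow I n • D.map A.mkQ).comap g := by
    intro n
    rw [Submodule.comap_comp, ← Submodule.map_smul'', Submodule.comap_map_mkQ, h]
  obtain ⟨k, hk⟩ := artinRees I (D.map A.mkQ)
    (fun n => LinearMap.range g ⊓ prodPow I n • D.map A.mkQ)
    (by
      intro m n
      refine le_inf ?_ ?_
      · exact Submodule.smul_le_right.trans inf_le_left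
      · rw [prodPow_add, mul_smul]
        exact Submodule.smul_mono le_rfl inf_le_right)
    (fun n => inf_le_right)
  refine ⟨c + k, LinearMap.ker g, (prodPow I k • D.map A.mkQ).comap g, fun n => ?_⟩
  have hk' : LinearMap.range g ⊓ prodPow I (k + n) • D.map A.mkQ =
      prodPow I n • (LinearMap.range g ⊓ prodPow I k • D.map A.mkQ) := hk n
  change (S (c + k + n)).comap f = _
  rw [add_assoc, hcomap, sup_comm, ← Submodule.comap_map_eq, Submodule.map_smul'',
    Submodule.map_comap_eq, ← hk', Submodule.comap_inf]
  exact (inf_eq_right.2 fun x _ => ⟨x, rfl⟩).symm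

lemma Good.prod {S : (Fin r → ℕ) → Submodule R W} {S' : (Fin r → ℕ) → Submodule R W'}
    (h : Good I S) (h' : Good I S') : Good I (fun n => (S n).prod (S' n)) := by
  have : (fun n => (S n).prod (S' n)) =
      fun n => (S n).map (LinearMap.inl R W W') ⊔ (S' n).map (LinearMap.inr R W W') := by
    funext n
    rw [Submodule.map_inl, Submodule.map_inr, Submodule.prod_sup_prod]
    simp
  rw [this]
  exact (h.map I _).sup I (h'.map I _)

lemma Good.inf [IsNoetherianRing R] [IsNoetherian R W] {S S' : (Fin r → ℕ) → Submodule R W}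
    (h : Good I S) (h' : Good I S') : Good I (fun n => S n ⊓ S' n) :=
  (h.prod I h').comap I (LinearMap.prod LinearMap.id LinearMap.id)

/-- vectors, viewed as maps from a free module, sending `G` into `S` -/
def homSet {a : ℕ} (G : Submodule R (Fin a → R)) (S : Submodule R W) :
    Submodule R (Fin a → W) where
  carrier := {w | ∀ x ∈ G, Fintype.linearCombination R w x ∈ S}
  zero_mem' := by intro x _; simp [Fintype.linearCombination_apply]
  add_mem' := by
    intro v w hv hw x hx
    have := S.add_mem (hv x hx) (hw x hx)
    simpa [Fintype.linearCombination_apply, Finset.sum_add_distrib] using this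
  smul_mem' := by
    intro b w hw x hx
    have := S.smul_mem b (hw x hx)
    simpa [Fintype.linearCombination_apply, Finset.smul_sum, smul_comm b] using this

/-- evaluation at a vector -/
def evAt {a : ℕ} (x : Fin a → R) : (Fin a → W) →ₗ[R] W where
  toFun w := Fintype.linearCombination R w x
  map_add' v w := by simp [Fintype.linearCombination_apply, Finset.sum_add_distrib]
  map_smul' b w := by simp [Fintype.linearCombination_apply, Finset.smul_sum, smul_comm b]

lemma Good.homSet [IsNoetherianRing R] [IsNoetherian R W] {a : ℕ} (G : Submodule R (Fin a → R))
    {S : (Fin r → ℕ) → Submodule R W} (h : Good I S) : Good I (fun n => homSet G (S n)) := by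
  obtain ⟨k, s, rfl⟩ := Submodule.fg_iff_exists_fin_generating_family.1 (IsNoetherian.noetherian G)
  have := (h.pi I (k := k)).comap I (LinearMap.pi fun l => evAt (W := W) (s l))
  convert this using 2 with n
  ext w
  simp only [Submodule.mem_comap, Submodule.mem_pi, LinearMap.pi_apply]
  constructor
  · intro hw l _
    exact hw _ (Submodule.subset_span ⟨l, rfl⟩)
  · intro hw
    have : Submodule.span R (Set.range s) ≤ (S n).comap (Fintype.linearCombination R w) := by
      rw [Submodule.span_le]
      rintro _ ⟨l, rfl⟩
      exact hw l trivial
    exact this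

end Good

section SubQ

variable {R : Type u} [CommRing R]
variable {W V A : Type u} [AddCommGroup W] [Module R W] [AddCommGroup V] [Module R V]
  [AddCommGroup A] [Module R A]

/-- lifts of maps into a subquotient -/
def hs {a : ℕ} (π : (Fin a → R) →ₗ[R] A) (Z B : Submodule R W) : Submodule R (Fin a → W) :=
  homSet ⊤ Z ⊓ homSet (LinearMap.ker π) B

lemma exists_T {a : ℕ} (π : (Fin a → R) →ₗ[R] A) (hπ : Function.Surjective π)
    (Z B : Submodule R W) (q : Z →ₗ[R] V) (hq : Function.Surjective q)
    (hqk : ∀ z, q z = 0 ↔ (z : W) ∈ B) :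
    ∃ T : hs π Z B →ₗ[R] (A →ₗ[R] V), Function.Surjective T ∧
      ∀ w x, T w (π x) = q ⟨Fintype.linearCombination R w.1 x, w.2.1 x trivial⟩ := by
  have h1 : ∀ w : hs π Z B, ∃ t : A →ₗ[R] V, ∀ x,
      t (π x) = q ⟨Fintype.linearCombination R w.1 x, w.2.1 x trivial⟩ := by
    intro w
    let t0 : (Fin a → R) →ₗ[R] V :=
      q ∘ₗ (Fintype.linearCombination R w.1).codRestrict Z fun x => w.2.1 x trivial
    have ht0 : LinearMap.ker π ≤ LinearMap.ker t0 := by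
      intro x hx
      exact (hqk _).2 (w.2.2 x hx)
    refine ⟨(LinearMap.ker π).liftQ t0 ht0 ∘ₗ (π.quotKerEquivOfSurjective hπ).symm, fun x => ?_⟩
    have : (π.quotKerEquivOfSurjective hπ).symm (π x) = Submodule.Quotient.mk x := by
      rw [LinearEquiv.symm_apply_eq]; rfl
    rw [LinearMap.comp_apply, LinearEquiv.coe_coe, this]
    rfl
  choose t ht using h1
  refine ⟨{ toFun := t, map_add' := ?_, map_smul' := ?_ }, ?_, ht⟩
  · intro v w
    ext y
    obtain ⟨x, rfl⟩ := hπ y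
    rw [LinearMap.add_apply, ht, ht, ht, ← map_add]
    congr 1
    ext
    exact map_add (evAt x) v.1 w.1
  · intro b w
    ext y
    obtain ⟨x, rfl⟩ := hπ y
    rw [LinearMap.smul_apply, ht, ht, RingHom.id_apply, ← map_smul]
    congr 1
    ext
    exact map_smul (evAt x) b w.1
  · intro h
    choose z hz using fun i : Fin a => hq (h (π (Pi.single i 1)))
    have hZ : ∀ x, Fintype.linearCombination R (fun i => (z i : W)) x ∈ Z := by
      intro x
      rw [Fintype.linearCombination_apply]
      exact Submodule.sum_mem _ fun i _ => Z.smul_mem _ (z i).2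
    have hval : ∀ x, q ⟨_, hZ x⟩ = h (π x) := by
      intro x
      have e : (⟨_, hZ x⟩ : Z) = Fintype.linearCombination R z x := by
        ext
        simp [Fintype.linearCombination_apply]
      rw [e, Fintype.linearCombination_apply, map_sum]
      conv_rhs => rw [pi_eq_sum_univ' x]
      simp only [map_sum, map_smul, hz]
    refine ⟨⟨fun i => z i, fun x _ => hZ x, fun x hx => ?_⟩, ?_⟩
    · rw [← hqk ⟨_, hZ x⟩, hval, LinearMap.mem_ker.1 hx, map_zero]
    · ext y
      obtain ⟨x, rfl⟩ := hπ y
      exact (ht _ x).trans (hval x)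

variable {A' : Type u} [AddCommGroup A'] [Module R A']

/-- precomposition on vectors -/
def pre {a b : ℕ} (γ : (Fin a → R) →ₗ[R] (Fin b → R)) : (Fin b → W) →ₗ[R] (Fin a → W) :=
  LinearMap.pi fun i => evAt (γ (Pi.single i 1))

lemma pre_apply {a b : ℕ} (γ : (Fin a → R) →ₗ[R] (Fin b → R)) (u : Fin b → W) (x : Fin a → R) :
    Fintype.linearCombination R (pre γ u) x = Fintype.linearCombination R u (γ x) := by
  conv_rhs => rw [pi_eq_sum_univ' x]
  rw [Fintype.linearCombination_apply]
  simp only [map_sum, map_smul]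
  rfl

lemma subq_coherent {a b : ℕ} (π : (Fin a → R) →ₗ[R] A) (hπ : Function.Surjective π)
    (π' : (Fin b → R) →ₗ[R] A') (hπ' : Function.Surjective π') (g : A →ₗ[R] A')
    (γ : (Fin a → R) →ₗ[R] (Fin b → R)) (hγ : ∀ x, π' (γ x) = g (π x))
    (Z B : Submodule R W) (hBZ : B ≤ Z) (q : Z →ₗ[R] V) (hq : Function.Surjective q)
    (hqk : ∀ z, q z = 0 ↔ (z : W) ∈ B) :
    (hs π' Z B).map (pre γ) ⊔ homSet ⊤ B ≤ hs π Z B ∧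
    ∃ q' : hs π Z B →ₗ[R] coherentApply g V, Function.Surjective q' ∧
      ∀ z, q' z = 0 ↔ (z : Fin a → W) ∈ (hs π' Z B).map (pre γ) ⊔ homSet ⊤ B := by
  obtain ⟨T, hT, hTx⟩ := exists_T π hπ Z B q hq hqk
  obtain ⟨T', hT', hTx'⟩ := exists_T π' hπ' Z B q hq hqk
  have hpre : ∀ u ∈ hs π' Z B, pre γ u ∈ hs π Z B := by
    intro u hu
    refine ⟨fun x _ => ?_, fun x hx => ?_⟩
    · rw [pre_apply]
      exact hu.1 _ trivial
    · rw [pre_apply]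
      refine hu.2 _ ?_
      rw [LinearMap.mem_ker, hγ, LinearMap.mem_ker.1 hx, map_zero]
  have hle : (hs π' Z B).map (pre γ) ⊔ homSet ⊤ B ≤ hs π Z B := by
    refine sup_le ?_ ?_
    · rintro _ ⟨u, hu, rfl⟩
      exact hpre u hu
    · intro w hw
      exact ⟨fun x hx => hBZ (hw x hx), fun x _ => hw x trivial⟩
  have hTpre : ∀ u : hs π' Z B, T ⟨pre γ u.1, hpre _ u.2⟩ = T' u ∘ₗ g := by
    intro u
    ext y
    obtain ⟨x, rfl⟩ := hπ y
    rw [LinearMap.comp_apply, ← hγ, hTx, hTx']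
    congr 2
    exact pre_apply _ _ _
  have hT0 : ∀ w : hs π Z B, T w = 0 ↔ (w : Fin a → W) ∈ homSet ⊤ B := by
    intro w
    constructor
    · intro h x _
      have := hTx w x
      rw [h, LinearMap.zero_apply] at this
      exact (hqk _).1 this.symm
    · intro h
      ext y
      obtain ⟨x, rfl⟩ := hπ y
      rw [hTx, LinearMap.zero_apply, hqk]
      exact h x trivial
  refine ⟨hle, Submodule.mkQ _ ∘ₗ T, (Submodule.mkQ_surjective _).comp hT, fun w => ?_⟩
  rw [LinearMap.comp_apply, Submodule.mkQ_apply, Submodule.Quotient.mk_eq_zero]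
  constructor
  · rintro ⟨h, hh⟩
    obtain ⟨u, rfl⟩ := hT' h
    have hh' : T' u ∘ₗ g = T w := hh
    have h0 : T (w - ⟨pre γ u.1, hpre _ u.2⟩) = 0 := by
      rw [map_sub, hTpre, hh', sub_self]
    rw [hT0] at h0
    refine Submodule.mem_sup.2 ⟨pre γ u.1, ⟨u.1, u.2, rfl⟩, _, h0, ?_⟩
    simp
  · intro hw
    obtain ⟨_, ⟨u, hu, rfl⟩, β, hβ, e⟩ := Submodule.mem_sup.1 hw
    refine ⟨T' ⟨u, hu⟩, ?_⟩
    change T' ⟨u, hu⟩ ∘ₗ g = T w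
    rw [← hTpre, eq_comm, ← sub_eq_zero, ← map_sub, hT0]
    change w.1 - pre γ u ∈ _
    rw [← e, add_sub_cancel_left]
    exact hβ

end SubQ

section GoodSQ

variable {R : Type u} [CommRing R] {r : ℕ} (I : Fin r → Ideal R)

/-- families which are subquotients of a fixed f.g. module by good families -/
def GoodSQ (V : (Fin r → ℕ) → Type u) [∀ n, AddCommGroup (V n)] [∀ n, Module R (V n)] : Prop :=
  ∃ (W : Type u) (_ : AddCommGroup W) (_ : Module R W) (_ : IsNoetherian R W)
    (Z B : (Fin r → ℕ) → Submodule R W), Good I Z ∧ Good I B ∧ ∀ n, B n ≤ Z n ∧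
      ∃ q : Z n →ₗ[R] V n, Function.Surjective q ∧ ∀ z, q z = 0 ↔ (z : W) ∈ B n

lemma GoodSQ.coherent [IsNoetherianRing R] (V : (Fin r → ℕ) → Type u) [∀ n, AddCommGroup (V n)]
    [∀ n, Module R (V n)] (h : GoodSQ I V) {A A' : Type u} [AddCommGroup A] [Module R A]
    [Module.Finite R A] [AddCommGroup A'] [Module R A'] [Module.Finite R A'] (g : A →ₗ[R] A') :
    GoodSQ I (fun n => coherentApply g (V n)) := by
  obtain ⟨W, _, _, _, Z, B, hZ, hB, h⟩ := h
  obtain ⟨a, π, hπ⟩ := Module.Finite.exists_fin' R A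
  obtain ⟨b, π', hπ'⟩ := Module.Finite.exists_fin' R A'
  obtain ⟨γ, hγ⟩ := Module.projective_lifting_property π' (g ∘ₗ π) hπ'
  have hγ' : ∀ x, π' (γ x) = g (π x) := fun x => LinearMap.congr_fun hγ x
  refine ⟨Fin a → W, inferInstance, inferInstance, inferInstance, fun n => hs π (Z n) (B n),
    fun n => (hs π' (Z n) (B n)).map (pre γ) ⊔ homSet ⊤ (B n), ?_, ?_, fun n => ?_⟩
  · exact (hZ.homSet I _).inf I (hB.homSet I _)
  · exact (((hZ.homSet I _).inf I (hB.homSet I _)).map I _).sup I (hB.homSet I _)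
  · obtain ⟨h1, q, h2, h3⟩ := h n
    exact subq_coherent π hπ π' hπ' g γ hγ' _ _ h1 q h2 h3

lemma GoodSQ.congr (V V' : (Fin r → ℕ) → Type u) [∀ n, AddCommGroup (V n)]
    [∀ n, Module R (V n)] [∀ n, AddCommGroup (V' n)]
    [∀ n, Module R (V' n)] (h : GoodSQ I V) (e : ∀ n, Nonempty (V n ≃ₗ[R] V' n)) :
    GoodSQ I V' := by
  obtain ⟨W, _, _, _, Z, B, hZ, hB, h⟩ := h
  refine ⟨W, _, _, inferInstance, Z, B, hZ, hB, fun n => ?_⟩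
  obtain ⟨h1, q, h2, h3⟩ := h n
  obtain ⟨e⟩ := e n
  refine ⟨h1, e.toLinearMap ∘ₗ q, e.surjective.comp h2, fun z => ?_⟩
  rw [← h3]
  simp

lemma GoodSQ.quot [IsNoetherianRing R] {M : Type u} [AddCommGroup M] [Module R M]
    [Module.Finite R M] (N : Submodule R M) :
    GoodSQ I (fun n => M ⧸ (prodPow I n • N : Submodule R M)) := by
  refine ⟨M, inferInstance, inferInstance, inferInstance, fun _ => ⊤, fun n => prodPow I n • N,
    Good.const I _, Good.pow I _, fun n => ⟨le_top, Submodule.mkQ _ ∘ₗ Submodule.subtype _,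
      (Submodule.mkQ_surjective _).comp fun x => ⟨⟨x, trivial⟩, rfl⟩, fun z => ?_⟩⟩
  simp

lemma GoodSQ.evPoly [IsNoetherianRing R] [IsLocalRing R] (V : (Fin r → ℕ) → Type u)
    [∀ n, AddCommGroup (V n)] [∀ n, Module R (V n)] (h : GoodSQ I V)
    (hm : ∀ n, ∀ a ∈ IsLocalRing.maximalIdeal R, ∀ v : V n, a • v = 0) :
    EvPoly (fun n => Module.length R (V n)) := by
  obtain ⟨W, _, _, _, Z, B, hZ, hB, h⟩ := h
  have hlen : ∀ n, Module.length R (V n) = lq (B n) (Z n) := by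
    intro n
    obtain ⟨h1, q, h2, h3⟩ := h n
    exact (lq_eq_of_surj q h2 h3).symm
  have hBZ : ∀ n, B n ≤ Z n := fun n => (h n).1
  have hmZ : ∀ n, IsLocalRing.maximalIdeal R • Z n ≤ B n := by
    intro n
    obtain ⟨h1, q, h2, h3⟩ := h n
    rw [Submodule.smul_le]
    intro a ha z hz
    refine (h3 (a • ⟨z, hz⟩)).1 ?_
    rw [map_smul]
    exact hm n a ha _
  simp only [hlen]
  obtain ⟨c, A, C, A0, D, hc⟩ := Good.common I (S' := Z) hZ hB
  apply EvPoly.shift c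
  -- replace by the shifted families
  obtain ⟨Z', hZ'⟩ : ∃ Z' : (Fin r → ℕ) → Submodule R W, ∀ n, Z (c + n) = Z' n := ⟨_, fun _ => rfl⟩
  obtain ⟨B', hB'⟩ : ∃ B' : (Fin r → ℕ) → Submodule R W, ∀ n, B (c + n) = B' n := ⟨_, fun _ => rfl⟩
  have hBZ' : ∀ n, B' n ≤ Z' n := fun n => by rw [← hB', ← hZ']; exact hBZ _
  have hmZ' : ∀ n, IsLocalRing.maximalIdeal R • Z' n ≤ B' n := fun n => by
    rw [← hB', ← hZ']; exact hmZ _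
  simp only [hZ', hB'] at hc ⊢
  obtain ⟨A, hA0, hc⟩ : ∃ A : Submodule R W, A0 ≤ A ∧ ∀ n, Z' n = A ⊔ prodPow I n • C ∧
      B' n = A0 ⊔ prodPow I n • D := by
    refine ⟨A0 ⊔ A, le_sup_left, fun n => ⟨?_, (hc n).2⟩⟩
    rw [sup_assoc, ← (hc n).1, eq_comm, sup_eq_right]
    refine le_trans ?_ (hBZ' n)
    rw [(hc n).2]
    exact le_sup_left
  have hAZ : ∀ n, A ≤ Z' n := fun n => (hc n).1 ▸ le_sup_left
  have hsplit : ∀ n, lq (B' n) (Z' n) = lq (B' n) (B' n ⊔ A) + lq (B' n ⊔ A) (Z' n) := fun n =>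
    lq_add le_sup_left (sup_le (hBZ' n) (hAZ n))
  simp only [hsplit]
  apply EvPoly.add
  · -- eventually constant
    have hanti : ∀ m n, m ≤ n → B' n ≤ B' m := by
      intro m n hmn
      obtain ⟨k, rfl⟩ := exists_add_of_le hmn
      rw [(hc _).2, (hc _).2, prodPow_add]
      exact sup_le_sup le_rfl (Submodule.smul_mono_left Ideal.mul_le_left)
    have e1 : ∀ n, lq (B' n) (B' n ⊔ A) = lq (A ⊓ B' n) A := by
      intro n
      have := lq_map (LinearMap.id : W →ₗ[R] W) A (B' n)
      rw [Submodule.map_id, Submodule.comap_id] at this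
      exact this.symm
    simp only [e1]
    have hmA : ∀ n, IsLocalRing.maximalIdeal R • A ≤ A ⊓ B' n := fun n =>
      le_inf Submodule.smul_le_right ((Submodule.smul_mono le_rfl (hAZ n)).trans (hmZ' n))
    have e2 : ∀ n, lq (IsLocalRing.maximalIdeal R • A) A =
        lq (IsLocalRing.maximalIdeal R • A) (A ⊓ B' n) + lq (A ⊓ B' n) A := fun n =>
      lq_add (hmA n) inf_le_left
    have fin1 : lq (IsLocalRing.maximalIdeal R • A) A ≠ ⊤ := lq_ne_top le_rfl
    let g : (Fin r → ℕ) → ℕ∞ := fun n => lq (IsLocalRing.maximalIdeal R • A) (A ⊓ B' n)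
    let n0 := Function.argmin g
    have hg : ∀ n, n0 ≤ n → g n = g n0 := by
      intro n hn
      refine le_antisymm ?_ (Function.argmin_le g n)
      have := lq_add (hmA n) (inf_le_inf_left A (hanti _ _ hn))
      change g n0 = g n + _ at this
      rw [this]
      exact le_self_add
    refine EvPoly.const n0 (lq (A ⊓ B' n0) A).toNat fun n hn => ?_
    have fin2 : ∀ n, lq (A ⊓ B' n) A ≠ ⊤ := fun n => lq_ne_top (hmA n)
    rw [ENat.natCast_toNat (fin2 n0)]
    have e3 := (e2 n).symm.trans (e2 n0)
    have fin3 : g n0 ≠ ⊤ := fun h => fin1 (by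
      rw [e2 n0]
      change g n0 + _ = ⊤
      rw [h, top_add])
    change g n + _ = g n0 + _ at e3
    rw [hg n hn] at e3
    exact ENat.add_right_injective_of_ne_top fin3 e3
  · -- Hilbert
    have hD : ∀ n, (B' n ⊔ A).map A.mkQ = prodPow I n • D.map A.mkQ := by
      intro n
      rw [(hc n).2, Submodule.map_sup, Submodule.map_sup, Submodule.map_smul'',
        Submodule.mkQ_map_self, sup_bot_eq, sup_eq_right.2]
      refine (Submodule.map_mono hA0).trans ?_
      rw [Submodule.mkQ_map_self]
      exact bot_le
    have hC : ∀ n, (Z' n).map A.mkQ = prodPow I n • C.map A.mkQ := by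
      intro n
      rw [(hc n).1, Submodule.map_sup, Submodule.map_smul'', Submodule.mkQ_map_self, bot_sup_eq]
    have hDC : ∀ n, prodPow I n • D.map A.mkQ ≤ prodPow I n • C.map A.mkQ := by
      intro n
      rw [← hD, ← hC]
      exact Submodule.map_mono (sup_le (hBZ' n) (hAZ n))
    have hA : ∀ n, lq (B' n ⊔ A) (Z' n) =
        lq (prodPow I n • D.map A.mkQ) (prodPow I n • C.map A.mkQ) := by
      intro n
      have := lq_map A.mkQ (Z' n) (prodPow I n • D.map A.mkQ)
      rw [hC, sup_eq_right.2 (hDC n), ← hD, Submodule.comap_map_mkQ, sup_comm, sup_assoc, sup_idem,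
        inf_eq_right.2 (sup_le (hBZ' n) (hAZ n)), hD] at this
      exact this
    simp only [hA]
    obtain ⟨J, _, _, d, a, hI⟩ := exists_gens I
    refine hilbert I d a hI (C.map A.mkQ) Finset.univ _ _ ?_ ?_ hDC (fun _ => le_rfl) ?_ ?_
    · intro m n
      simp only [prodPow_add, mul_smul, le_refl]
    · intro m n
      simp only [prodPow_add, mul_smul, le_refl]
    · intro n
      rw [← hD, ← hC, ← Submodule.map_smul'']
      exact Submodule.map_mono ((hmZ' n).trans le_sup_left)
    · intro j hj
      exact absurd (Finset.mem_univ j) hj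

end GoodSQ

end Stmt12

/-- over a Noetherian local ring, the Bass numbers
`μ_R^i(F(M/IⁿN))` are eventually given by a polynomial in `n`. -/
theorem stmt12 {R : Type u} [CommRing R] [IsNoetherianRing R] [IsLocalRing R]
    {r : ℕ} (hr : 1 ≤ r) (I : Fin r → Ideal R)
    (M : Type u) [AddCommGroup M] [Module R M] [Module.Finite R M]
    (N : Submodule R M)
    {K L : Type u} [AddCommGroup K] [Module R K] [Module.Finite R K]
    [AddCommGroup L] [Module R L] [Module.Finite R L]
    (f : K →ₗ[R] L) (i : ℕ) :
    ∃ (c : Fin r → ℕ) (P : MvPolynomial (Fin r) ℚ), ∀ n : Fin r → ℕ, c ≤ n →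
      ∃ m : ℕ,
        bassNumber R i (coherentApply f (M ⧸ (prodPow I n • N : Submodule R M))) = m ∧
        (m : ℚ) = MvPolynomial.eval (fun i => (n i : ℚ)) P := by
  obtain ⟨A, B, _, _, _, _, _, _, g, hg, hann⟩ :=
    Stmt12.ext_coherent (R := R) (IsLocalRing.ResidueField R) i
  have hgood := ((Stmt12.GoodSQ.quot I N).coherent I _ f).coherent I _ g
  obtain ⟨c, P, h⟩ := hgood.evPoly I _ (fun n a ha v => hann a (fun z => by
    obtain ⟨z, rfl⟩ := IsLocalRing.residue_surjective z
    rw [Algebra.smul_def, IsLocalRing.ResidueField.algebraMap_eq,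
      (IsLocalRing.residue_eq_zero_iff a).2 ha, zero_mul]) _ v)
  refine ⟨c, P, fun n hn => ?_⟩
  obtain ⟨m, h1, h2⟩ := h n hn
  refine ⟨m, ?_, h2⟩
  obtain ⟨e⟩ := hg (coherentApply f (M ⧸ (prodPow I n • N : Submodule R M)))
  unfold bassNumber moduleLength
  rw [← Module.coe_length]
  refine (congrArg _ (e.length_eq.trans h1)).trans ?_
  rfl
end
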